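/- Let ψ be a smooth global degree-one 1-equivariant wave map (ψ(t,0⁺) = 0, ψ(t,∞) = π) with E(ψ⃗) = E(Q) + η < 3E(Q). Then there exists a finite-energy solution φ_L of the linear equation φ_tt − φ_rr − (1/r)φ_r + φ/r² = 0 such that for every A ≥ 0, ‖ψ⃗(t) − (π,0) − φ⃗_L(t)‖_{H×L²(r ≥ t−A)} → 0 as t → ∞. Moreover, there exist a constant C < 2E(Q) = 8 and a sequence τ_n → ∞ such that E(φ⃗_L(τ_n)) ≤ C for all sufficiently large n, where E is the wave-map energy functional applied to the data of φ_L at time τ_n. -/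

import Mathlib

open MeasureTheory Real Filter Set

noncomputable section

/-- The ground state harmonic map `Q(r) = 2 arctan r`. -/
def Q (r : ℝ) : ℝ := 2 * Real.arctan r

/-- Time derivative `∂ₜψ(t,r)`. -/
def pT (ψ : ℝ → ℝ → ℝ) (t r : ℝ) : ℝ := deriv (fun s => ψ s r) t

/-- Radial derivative `∂ᵣψ(t,r)`. -/
def pR (ψ : ℝ → ℝ → ℝ) (t r : ℝ) : ℝ := deriv (fun ρ => ψ t ρ) r

/-- Energy density `((∂ₜψ)² + (∂ᵣψ)² + sin²ψ/r²) · r`. -/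
def eDen (ψ : ℝ → ℝ → ℝ) (t r : ℝ) : ℝ :=
  ((pT ψ t r) ^ 2 + (pR ψ t r) ^ 2 + (Real.sin (ψ t r)) ^ 2 / r ^ 2) * r

/-- Localized energy `E_{r₁}^{r₂}(ψ⃗(t))`. -/
def locE (ψ : ℝ → ℝ → ℝ) (t r₁ r₂ : ℝ) : ℝ := ∫ r in Set.Ioc r₁ r₂, eDen ψ t r

/-- Total energy `E(ψ⃗(t))`. -/
def totE (ψ : ℝ → ℝ → ℝ) (t : ℝ) : ℝ := ∫ r in Set.Ioi (0:ℝ), eDen ψ t r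

/-- `ψ` is a smooth global 1-equivariant wave map on `[0,∞) × (0,∞)`. -/
def IsWaveMap (ψ : ℝ → ℝ → ℝ) : Prop :=
  ContDiffOn ℝ (⊤ : ℕ∞) (fun p : ℝ × ℝ => ψ p.1 p.2) (Set.Ici (0:ℝ) ×ˢ Set.Ioi (0:ℝ)) ∧
  ∀ t r : ℝ, 0 ≤ t → 0 < r →
    deriv (fun s => pT ψ s r) t - deriv (fun ρ => pR ψ t ρ) r
      - (1 / r) * pR ψ t r + Real.sin (2 * ψ t r) / (2 * r ^ 2) = 0

/-- Finite energy: the energy density is integrable at each time `t ≥ 0`. -/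
def FiniteEnergy (ψ : ℝ → ℝ → ℝ) : Prop :=
  ∀ t : ℝ, 0 ≤ t → MeasureTheory.IntegrableOn (eDen ψ t) (Set.Ioi 0) volume

/-- The energy is conserved. -/
def EnergyConserved (ψ : ℝ → ℝ → ℝ) : Prop :=
  ∀ t : ℝ, 0 ≤ t → totE ψ t = totE ψ 0

/-- Squared `H × L²` norm density `(ψ₁² + (∂ᵣψ₀)² + ψ₀²/r²) · r`. -/
def hl2Den (f g : ℝ → ℝ) (r : ℝ) : ℝ :=
  ((g r) ^ 2 + (deriv f r) ^ 2 + (f r) ^ 2 / r ^ 2) * r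

/-- Squared `H × L²` norm of the pair `(f, g)` over the set of radii `S`. -/
def hl2Sq (f g : ℝ → ℝ) (S : Set ℝ) : ℝ := ∫ r in S, hl2Den f g r

/-- Squared `H` norm of `f` over the set of radii `S`. -/
def hSq (f : ℝ → ℝ) (S : Set ℝ) : ℝ :=
  ∫ r in S, ((deriv f r) ^ 2 + (f r) ^ 2 / r ^ 2) * r

/-- Squared (radial) `L²` norm. -/
def l2Sq (g : ℝ → ℝ) : ℝ := ∫ r in Set.Ioi (0:ℝ), (g r) ^ 2 * r

/-- Wave map energy of a pair of data `(f, g)`. -/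
def pairE (f g : ℝ → ℝ) : ℝ :=
  ∫ r in Set.Ioi (0:ℝ), ((g r) ^ 2 + (deriv f r) ^ 2 + (Real.sin (f r)) ^ 2 / r ^ 2) * r

/-- `φ` is a smooth solution of the linearized equation
`φ_tt − φ_rr − (1/r) φ_r + φ/r² = 0` on `ℝ × (0,∞)`. -/
def IsLinearWave (φ : ℝ → ℝ → ℝ) : Prop :=
  ContDiffOn ℝ (⊤ : ℕ∞) (fun p : ℝ × ℝ => φ p.1 p.2) (Set.univ ×ˢ Set.Ioi (0:ℝ)) ∧
  ∀ t r : ℝ, 0 < r →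
    deriv (fun s => pT φ s r) t - deriv (fun ρ => pR φ t ρ) r
      - (1 / r) * pR φ t r + φ t r / r ^ 2 = 0

/-- A linear wave has finite energy: its `H × L²` density is integrable at each time. -/
def LinFiniteEnergy (φ : ℝ → ℝ → ℝ) : Prop :=
  ∀ t : ℝ, MeasureTheory.IntegrableOn (hl2Den (φ t) (pT φ t)) (Set.Ioi 0) volume

/-- Degree one boundary conditions: `ψ(t,0⁺) = 0`, `ψ(t,∞) = π`. -/
def DegreeOneBC (ψ : ℝ → ℝ → ℝ) : Prop :=
  ∀ t : ℝ, 0 ≤ t →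
    Filter.Tendsto (ψ t) (nhdsWithin 0 (Set.Ioi 0)) (nhds 0) ∧
    Filter.Tendsto (ψ t) Filter.atTop (nhds Real.pi)

/-- Degree zero boundary conditions: `φ(t,0⁺) = 0`, `φ(t,∞) = 0`. -/
def DegreeZeroBC (φ : ℝ → ℝ → ℝ) : Prop :=
  ∀ t : ℝ, 0 ≤ t →
    Filter.Tendsto (φ t) (nhdsWithin 0 (Set.Ioi 0)) (nhds 0) ∧
    Filter.Tendsto (φ t) Filter.atTop (nhds 0)


/-! ### Directional derivatives in the `(t, r)` plane -/

open scoped Topology ContDiff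

/-- Directional derivative of a function on the `(t, r)` plane. -/
def dd (v : ℝ × ℝ) (f : ℝ × ℝ → ℝ) (p : ℝ × ℝ) : ℝ := fderiv ℝ f p v

/-- The direction `∂ₜ`. -/
def eT : ℝ × ℝ := (1, 0)

/-- The direction `∂ᵣ`. -/
def eR : ℝ × ℝ := (0, 1)

/-- The outgoing null direction `(∂ₜ + ∂ᵣ) / 2`. -/
def eL : ℝ × ℝ := (1 / 2, 1 / 2)

/-- The incoming null direction `(∂ₜ - ∂ᵣ) / 2`. -/
def eN : ℝ × ℝ := (1 / 2, -1 / 2)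

section DirectionalDerivatives

variable {U : Set (ℝ × ℝ)} {f g : ℝ × ℝ → ℝ} {p v w : ℝ × ℝ}

lemma ContDiffOn.differentiableAt_of_isOpen (hf : ContDiffOn ℝ ∞ f U) (hU : IsOpen U)
    (hp : p ∈ U) : DifferentiableAt ℝ f p :=
  (hf.contDiffAt (hU.mem_nhds hp)).differentiableAt (by simp)

lemma ContDiffOn.dd (hf : ContDiffOn ℝ ∞ f U) (hU : IsOpen U) (v : ℝ × ℝ) :
    ContDiffOn ℝ ∞ (dd v f) U :=
  ((contDiffOn_infty_iff_fderiv_of_isOpen hU).1 hf).2.clm_apply contDiffOn_const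

lemma dd_comm (hf : ContDiffOn ℝ ∞ f U) (hU : IsOpen U) (hp : p ∈ U) :
    dd v (dd w f) p = dd w (dd v f) p := by
  have hd : DifferentiableAt ℝ (fderiv ℝ f) p :=
    (((contDiffOn_infty_iff_fderiv_of_isOpen hU).1 hf).2.contDiffAt
      (hU.mem_nhds hp)).differentiableAt (by simp)
  have key (a b : ℝ × ℝ) : dd a (dd b f) p = fderiv ℝ (fderiv ℝ f) p a b := by
    have : HasFDerivAt (dd b f) ((fderiv ℝ (fderiv ℝ f) p).flip b) p := by
      exact (hd.hasFDerivAt.clm_apply (hasFDerivAt_const b p)).congr_fderiv (by ext <;> simp)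
    simp [dd, this.fderiv]
  rw [key, key]
  exact (hf.contDiffAt (hU.mem_nhds hp)).isSymmSndFDerivAt
    (by simpa using WithTop.coe_le_coe.2 (le_top : (2 : ℕ∞) ≤ ⊤)) v w

lemma dd_mul (hf : DifferentiableAt ℝ f p) (hg : DifferentiableAt ℝ g p) :
    dd v (fun x => f x * g x) p = dd v f p * g p + f p * dd v g p := by
  have := (hf.hasFDerivAt.mul hg.hasFDerivAt).fderiv
  simp only [dd]
  erw [this]
  simp
  ring

lemma dd_comp {F : ℝ → ℝ} {F' : ℝ} (hF : HasDerivAt F F' (f p)) (hf : DifferentiableAt ℝ f p) :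
    dd v (fun x => F (f x)) p = F' * dd v f p := by
  have := (hF.comp_hasFDerivAt p hf.hasFDerivAt).fderiv
  simp only [dd]
  erw [this]
  simp

lemma dd_add (hf : DifferentiableAt ℝ f p) (hg : DifferentiableAt ℝ g p) :
    dd v (fun x => f x + g x) p = dd v f p + dd v g p := by
  simp [dd, fderiv_fun_add hf hg]

lemma dd_sub (hf : DifferentiableAt ℝ f p) (hg : DifferentiableAt ℝ g p) :
    dd v (fun x => f x - g x) p = dd v f p - dd v g p := by
  simp [dd, fderiv_fun_sub hf hg]

lemma dd_const_mul (c : ℝ) (hf : DifferentiableAt ℝ f p) :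
    dd v (fun x => c * f x) p = c * dd v f p := by
  simp [dd, fderiv_const_mul hf]

lemma dd_congr (hU : IsOpen U) (hp : p ∈ U) (h : ∀ x ∈ U, f x = g x) : dd v f p = dd v g p := by
  have : f =ᶠ[𝓝 p] g := by filter_upwards [hU.mem_nhds hp] with x hx using h x hx
  simp [dd, this.fderiv_eq]

lemma dd_snd : dd v (fun x => x.2) p = v.2 := by
  have : fderiv ℝ (fun x : ℝ × ℝ => x.2) p = ContinuousLinearMap.snd ℝ ℝ ℝ := fderiv_snd
  simp [dd, this]

lemma dd_eL : dd eL f p = (dd eT f p + dd eR f p) / 2 := by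
  have : eL = (1 / 2 : ℝ) • eT + (1 / 2 : ℝ) • eR := by simp [eL, eT, eR]
  simp only [dd, this, map_add, map_smul, smul_eq_mul]; ring

lemma dd_eN : dd eN f p = (dd eT f p - dd eR f p) / 2 := by
  have : eN = (1 / 2 : ℝ) • eT - (1 / 2 : ℝ) • eR := by simp [eN, eT, eR]; norm_num
  simp only [dd, this, map_sub, map_smul, smul_eq_mul]; ring

lemma hasDerivAt_along {γ : ℝ → ℝ × ℝ} {s : ℝ} (hf : DifferentiableAt ℝ f (γ s))
    (hγ : HasDerivAt γ v s) : HasDerivAt (fun x => f (γ x)) (dd v f (γ s)) s :=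
  hf.hasFDerivAt.comp_hasDerivAt s hγ

lemma hasDerivAt_radial {t r : ℝ} (hf : DifferentiableAt ℝ f (t, r)) :
    HasDerivAt (fun ρ => f (t, ρ)) (dd eR f (t, r)) r :=
  hasDerivAt_along (γ := fun ρ => (t, ρ)) hf ((hasDerivAt_const r t).prodMk (hasDerivAt_id r))

lemma hasDerivAt_time {t r : ℝ} (hf : DifferentiableAt ℝ f (t, r)) :
    HasDerivAt (fun s => f (s, r)) (dd eT f (t, r)) t :=
  hasDerivAt_along (γ := fun s => (s, r)) hf ((hasDerivAt_id t).prodMk (hasDerivAt_const t r))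

end DirectionalDerivatives

/-- The point with null coordinates `u = t - r`, `v = t + r`. -/
def nul (u v : ℝ) : ℝ × ℝ := ((v + u) / 2, (v - u) / 2)

lemma hasDerivAt_nul_fst (u v : ℝ) : HasDerivAt (fun x => nul x v) eN u := by
  have h1 : HasDerivAt (fun x : ℝ => (v + x) / 2) (1 / 2) u :=
    ((hasDerivAt_id u).const_add v).div_const 2
  have h2 : HasDerivAt (fun x : ℝ => (v - x) / 2) (-1 / 2) u :=
    ((hasDerivAt_id u).const_sub v).div_const 2
  exact h1.prodMk h2

lemma hasDerivAt_nul_snd (u v : ℝ) : HasDerivAt (fun x => nul u x) eL v := by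
  have h1 : HasDerivAt (fun x : ℝ => (x + u) / 2) (1 / 2) v :=
    ((hasDerivAt_id v).add_const u).div_const 2
  have h2 : HasDerivAt (fun x : ℝ => (x - u) / 2) (1 / 2) v :=
    ((hasDerivAt_id v).sub_const u).div_const 2
  exact h1.prodMk h2

lemma nul_self (t r : ℝ) : nul (t - r) (t + r) = (t, r) := by
  simp [nul]

/-! ### Energy densities and their potential -/

/-- Energy density of `w` for the self-interaction `V`. -/
def enD (V : ℝ → ℝ) (w : ℝ × ℝ → ℝ) (p : ℝ × ℝ) : ℝ :=
  (dd eT w p ^ 2 + dd eR w p ^ 2 + V (w p) / p.2 ^ 2) * p.2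

/-- Energy flux of `w`. -/
def fluxD (w : ℝ × ℝ → ℝ) (p : ℝ × ℝ) : ℝ := 2 * p.2 * dd eT w p * dd eR w p

/-- `P` has `∂ₜP` equal to the energy flux and `∂ᵣP` equal to the energy density of `w`. -/
def IsPotential (V : ℝ → ℝ) (w : ℝ × ℝ → ℝ) (U : Set (ℝ × ℝ)) (P : ℝ × ℝ → ℝ) : Prop :=
  ∀ p ∈ U, HasFDerivAt P
    (fluxD w p • ContinuousLinearMap.fst ℝ ℝ ℝ + enD V w p • ContinuousLinearMap.snd ℝ ℝ ℝ) p

section Potential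

variable {U : Set (ℝ × ℝ)} {V V' : ℝ → ℝ} {w P : ℝ × ℝ → ℝ}

lemma contDiffOn_enD (hU : IsOpen U) (hpos : ∀ p ∈ U, 0 < p.2) (hV : ContDiff ℝ ∞ V)
    (hw : ContDiffOn ℝ ∞ w U) : ContDiffOn ℝ ∞ (enD V w) U := by
  refine ContDiffOn.mul (ContDiffOn.add (ContDiffOn.add ((hw.dd hU eT).pow 2) ((hw.dd hU eR).pow 2))
    ((hV.comp_contDiffOn hw).div (contDiffOn_snd.pow 2) ?_)) contDiffOn_snd
  intro p hp
  exact pow_ne_zero 2 (hpos p hp).ne'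

lemma contDiffOn_fluxD (hU : IsOpen U) (hw : ContDiffOn ℝ ∞ w U) :
    ContDiffOn ℝ ∞ (fluxD w) U :=
  ((contDiffOn_const.mul contDiffOn_snd).mul (hw.dd hU eT)).mul (hw.dd hU eR)

/-- Energy conservation makes the energy form closed, hence exact on convex sets. -/
theorem exists_isPotential (hU : IsOpen U) (hconv : Convex ℝ U) (hpos : ∀ p ∈ U, 0 < p.2)
    (hV : ContDiff ℝ ∞ V) (hV' : ∀ x, HasDerivAt V (V' x) x) (hw : ContDiffOn ℝ ∞ w U)
    (heq : ∀ p ∈ U, dd eT (dd eT w) p - dd eR (dd eR w) p - dd eR w p / p.2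
      + V' (w p) / (2 * p.2 ^ 2) = 0) :
    ∃ P, IsPotential V w U P := by
  have he := contDiffOn_enD hU hpos hV hw
  have hq := contDiffOn_fluxD hU hw
  have hd : ∀ p ∈ U, HasFDerivAt (fun p => fluxD w p • ContinuousLinearMap.fst ℝ ℝ ℝ
      + enD V w p • ContinuousLinearMap.snd ℝ ℝ ℝ)
      ((fderiv ℝ (fluxD w) p).smulRight (ContinuousLinearMap.fst ℝ ℝ ℝ)
        + (fderiv ℝ (enD V w) p).smulRight (ContinuousLinearMap.snd ℝ ℝ ℝ)) p := by
    intro p hp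
    have h1 := (hq.differentiableAt_of_isOpen hU hp).hasFDerivAt.smul_const
      (ContinuousLinearMap.fst ℝ ℝ ℝ)
    have h2 := (he.differentiableAt_of_isOpen hU hp).hasFDerivAt.smul_const
      (ContinuousLinearMap.snd ℝ ℝ ℝ)
    exact h1.add h2
  refine Convex.exists_forall_hasFDerivAt_of_fderiv_symmetric hconv hU
    (fun p hp => (hd p hp).differentiableAt.differentiableWithinAt) ?_
  intro p hp x y
  have key : dd eT (enD V w) p = dd eR (fluxD w) p := by
    have dw := hw.differentiableAt_of_isOpen hU hp
    have dT := (hw.dd hU eT).differentiableAt_of_isOpen hU hp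
    have dR := (hw.dd hU eR).differentiableAt_of_isOpen hU hp
    have hr : p.2 ≠ 0 := (hpos p hp).ne'
    have d2 : DifferentiableAt ℝ (fun x : ℝ × ℝ => x.2) p := differentiableAt_snd
    have hcomm : dd eT (dd eR w) p = dd eR (dd eT w) p := dd_comm hw hU hp
    have ht := hasDerivAt_time (f := enD V w) (t := p.1) (r := p.2)
      (he.differentiableAt_of_isOpen hU hp)
    have ht' := (((hasDerivAt_time (t := p.1) (r := p.2) dT).pow 2).add
      ((hasDerivAt_time (t := p.1) (r := p.2) dR).pow 2) |>.add
      (((hV' (w p)).comp p.1 (hasDerivAt_time (t := p.1) (r := p.2) dw)).div_const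
        (p.2 ^ 2))).mul_const p.2
    have hr1 := hasDerivAt_radial (f := fluxD w) (t := p.1) (r := p.2)
      (hq.differentiableAt_of_isOpen hU hp)
    have hr' := (((hasDerivAt_id p.2).const_mul 2).mul
      (hasDerivAt_radial (t := p.1) (r := p.2) dT)).mul
      (hasDerivAt_radial (t := p.1) (r := p.2) dR)
    have e1 := ht.unique ht'
    have e2 := hr1.unique hr'
    simp only [Prod.mk.eta, id] at e1 e2
    rw [e1, e2, hcomm]
    have h0 := heq p hp
    have h1 : dd eT (dd eT w) p = dd eR (dd eR w) p + dd eR w p / p.2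
      - V' (w p) / (2 * p.2 ^ 2) := by linarith
    simp only [Pi.mul_apply]
    rw [h1]
    field_simp
    ring
  have hx (f : ℝ × ℝ → ℝ) (x : ℝ × ℝ) : fderiv ℝ f p x = x.1 * dd eT f p + x.2 * dd eR f p := by
    conv_lhs => rw [show x = x.1 • eT + x.2 • eR by ext <;> simp [eT, eR]]
    simp [dd]
  rw [(hd p hp).fderiv]
  simp [hx, key]
  ring

lemma IsPotential.eL (hP : IsPotential V w U P) {p} (hp : p ∈ U) :
    dd eL P p = (fluxD w p + enD V w p) / 2 := by
  rw [dd, (hP p hp).fderiv]; simp [_root_.eL]; ring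

lemma IsPotential.eN (hP : IsPotential V w U P) {p} (hp : p ∈ U) :
    dd eN P p = (fluxD w p - enD V w p) / 2 := by
  rw [dd, (hP p hp).fderiv]; simp [_root_.eN]; ring

lemma IsPotential.eR (hP : IsPotential V w U P) {p} (hp : p ∈ U) :
    dd eR P p = enD V w p := by
  rw [dd, (hP p hp).fderiv]; simp [_root_.eR]

lemma IsPotential.eT (hP : IsPotential V w U P) {p} (hp : p ∈ U) :
    dd eT P p = fluxD w p := by
  rw [dd, (hP p hp).fderiv]; simp [_root_.eT]

lemma IsPotential.differentiableAt (hP : IsPotential V w U P) {p} (hp : p ∈ U) :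
    DifferentiableAt ℝ P p := (hP p hp).differentiableAt

lemma enD_eq_null {p : ℝ × ℝ} (hp : 0 < p.2) :
    enD V w p = 2 * p.2 * dd eN w p ^ 2 + 2 * p.2 * dd eL w p ^ 2 + V (w p) / p.2 := by
  rw [enD, dd_eN, dd_eL]; field_simp; ring

lemma IsPotential.eL_eq (hP : IsPotential V w U P) {p} (hp : p ∈ U) (h0 : 0 < p.2) :
    dd _root_.eL P p = 2 * p.2 * dd _root_.eL w p ^ 2 + V (w p) / (2 * p.2) := by
  rw [hP.eL hp, fluxD, enD, dd_eL]; field_simp; ring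

lemma IsPotential.eN_eq (hP : IsPotential V w U P) {p} (hp : p ∈ U) (h0 : 0 < p.2) :
    dd _root_.eN P p = -(2 * p.2 * dd _root_.eN w p ^ 2 + V (w p) / (2 * p.2)) := by
  rw [hP.eN hp, fluxD, enD, dd_eN]; field_simp; ring

lemma enD_nonneg (hV0 : ∀ x, 0 ≤ V x) {p : ℝ × ℝ} (hp : 0 ≤ p.2) : 0 ≤ enD V w p := by
  have := hV0 (w p)
  unfold enD; positivity

lemma IsPotential.integral_eq (hP : IsPotential V w U P) (hU : IsOpen U)
    (hpos : ∀ p ∈ U, 0 < p.2) (hV : ContDiff ℝ ∞ V)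
    (hw : ContDiffOn ℝ ∞ w U) {t r₁ r₂ : ℝ} (h12 : r₁ ≤ r₂)
    (hmem : ∀ r ∈ Icc r₁ r₂, (t, r) ∈ U) :
    ∫ r in r₁..r₂, enD V w (t, r) = P (t, r₂) - P (t, r₁) := by
  refine intervalIntegral.integral_eq_sub_of_hasDerivAt (f := fun r => P (t, r)) ?_ ?_
  · intro r hr
    rw [uIcc_of_le h12] at hr
    rw [← hP.eR (hmem r hr)]
    exact hasDerivAt_radial (hP.differentiableAt (hmem r hr))
  · refine ContinuousOn.intervalIntegrable ?_
    rw [uIcc_of_le h12]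
    exact (contDiffOn_enD hU hpos hV hw).continuousOn.comp (by fun_prop) hmem

/-- The potential increases along outgoing null lines. -/
lemma IsPotential.le_outgoing (hP : IsPotential V w U P) (hpos : ∀ p ∈ U, 0 < p.2)
    (hV0 : ∀ x, 0 ≤ V x) {u v₁ v₂ : ℝ} (h12 : v₁ ≤ v₂) (hmem : ∀ v ∈ Icc v₁ v₂, nul u v ∈ U) :
    P (nul u v₁) ≤ P (nul u v₂) := by
  have hd : ∀ v ∈ Icc v₁ v₂, HasDerivAt (fun v => P (nul u v)) (dd _root_.eL P (nul u v)) v :=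
    fun v hv => hasDerivAt_along (hP.differentiableAt (hmem v hv)) (hasDerivAt_nul_snd u v)
  refine monotoneOn_of_deriv_nonneg (convex_Icc v₁ v₂)
    (fun v hv => (hd v hv).continuousAt.continuousWithinAt)
    (fun v hv => (hd v (interior_subset hv)).differentiableAt.differentiableWithinAt) ?_
    (left_mem_Icc.2 h12) (right_mem_Icc.2 h12) h12
  intro v hv
  have hv := interior_subset hv
  have h0 := hpos _ (hmem v hv)
  rw [(hd v hv).deriv, hP.eL_eq (hmem v hv) h0]
  have := hV0 (w (nul u v))
  positivity

/-- The potential decreases along incoming null lines. -/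
lemma IsPotential.le_incoming (hP : IsPotential V w U P) (hpos : ∀ p ∈ U, 0 < p.2)
    (hV0 : ∀ x, 0 ≤ V x) {u₁ u₂ v : ℝ} (h12 : u₁ ≤ u₂) (hmem : ∀ u ∈ Icc u₁ u₂, nul u v ∈ U) :
    P (nul u₂ v) ≤ P (nul u₁ v) := by
  have hd : ∀ u ∈ Icc u₁ u₂, HasDerivAt (fun u => P (nul u v)) (dd _root_.eN P (nul u v)) u :=
    fun u hu => hasDerivAt_along (hP.differentiableAt (hmem u hu)) (hasDerivAt_nul_fst u v)
  refine antitoneOn_of_deriv_nonpos (convex_Icc u₁ u₂)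
    (fun u hu => (hd u hu).continuousAt.continuousWithinAt)
    (fun u hu => (hd u (interior_subset hu)).differentiableAt.differentiableWithinAt) ?_
    (left_mem_Icc.2 h12) (right_mem_Icc.2 h12) h12
  intro u hu
  have hu := interior_subset hu
  have h0 := hpos _ (hmem u hu)
  rw [(hd u hu).deriv, hP.eN_eq (hmem u hu) h0]
  have := hV0 (w (nul u v))
  rw [neg_nonpos]
  positivity

end Potential


/-! ### Transport along outgoing null lines -/

/-- The outgoing strip `a ≤ t - r ≤ b`, `t + r ≥ v₀`. -/
def strip (a b v₀ : ℝ) : Set (ℝ × ℝ) := {p | p.1 - p.2 ∈ Icc a b ∧ v₀ ≤ p.1 + p.2}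

/-- The weight `r ^ (-1/2)`. -/
def rho (p : ℝ × ℝ) : ℝ := (√p.2)⁻¹

lemma nul_mem_strip {a b v₀ u v : ℝ} : nul u v ∈ strip a b v₀ ↔ u ∈ Icc a b ∧ v₀ ≤ v := by
  have h1 : (v + u) / 2 - (v - u) / 2 = u := by ring
  have h2 : (v + u) / 2 + (v - u) / 2 = v := by ring
  simp only [strip, nul, mem_ofPred_eq, h1, h2]

lemma rho_pos {p : ℝ × ℝ} (hp : 0 < p.2) : 0 < rho p := by
  unfold rho; positivity

lemma rho_sq {p : ℝ × ℝ} (hp : 0 < p.2) : rho p ^ 2 = p.2⁻¹ := by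
  rw [rho, inv_pow, Real.sq_sqrt hp.le]

/-- `g` and its first `m` derivatives in the incoming direction are bounded on `S`. -/
def BdN (S : Set (ℝ × ℝ)) : ℕ → (ℝ × ℝ → ℝ) → Prop
  | 0, g => ∃ C, ∀ p ∈ S, |g p| ≤ C
  | m + 1, g => (∃ C, ∀ p ∈ S, |g p| ≤ C) ∧ BdN S m (dd eN g)

section Transport

variable {U S : Set (ℝ × ℝ)} {f g : ℝ × ℝ → ℝ} {m : ℕ}

lemma contDiffOn_sqrt_snd (hpos : ∀ p ∈ U, 0 < p.2) :
    ContDiffOn ℝ ∞ (fun p : ℝ × ℝ => √p.2) U :=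
  contDiffOn_snd.sqrt fun p hp => (hpos p hp).ne'

lemma contDiffOn_rho (hpos : ∀ p ∈ U, 0 < p.2) : ContDiffOn ℝ ∞ rho U :=
  (contDiffOn_sqrt_snd hpos).inv fun p hp => (Real.sqrt_pos.2 (hpos p hp)).ne'

lemma dd_sqrt_snd {v p : ℝ × ℝ} (hp : 0 < p.2) :
    dd v (fun q : ℝ × ℝ => √q.2) p = v.2 / 2 * rho p := by
  rw [dd_comp (F := Real.sqrt) (f := fun q : ℝ × ℝ => q.2) (Real.hasDerivAt_sqrt hp.ne')
    differentiableAt_snd, dd_snd, rho]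
  field_simp

lemma dd_rho {v p : ℝ × ℝ} (hp : 0 < p.2) : dd v rho p = -(v.2 / 2) * rho p ^ 3 := by
  have hs : DifferentiableAt ℝ (fun q : ℝ × ℝ => √q.2) p :=
    differentiableAt_snd.sqrt hp.ne'
  have h0 : √p.2 ≠ 0 := (Real.sqrt_pos.2 hp).ne'
  have := dd_comp (v := v) (F := fun x => x⁻¹) (f := fun q : ℝ × ℝ => √q.2) (hasDerivAt_inv h0) hs
  change dd v (fun q : ℝ × ℝ => (√q.2)⁻¹) p = _
  rw [this, dd_sqrt_snd hp, rho]
  field_simp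

lemma BdN.bounded (h : BdN S m f) : ∃ C, ∀ p ∈ S, |f p| ≤ C := by
  cases m with
  | zero => exact h
  | succ m => exact h.1

lemma BdN.of_succ (h : BdN S (m + 1) f) : BdN S m f := by
  induction m generalizing f with
  | zero => exact h.1
  | succ m ih => exact ⟨h.1, ih h.2⟩

lemma BdN.congr (hU : IsOpen U) (hS : S ⊆ U) (hfg : ∀ p ∈ U, f p = g p) (h : BdN S m f) :
    BdN S m g := by
  induction m generalizing f g with
  | zero =>
    obtain ⟨C, hC⟩ := h
    exact ⟨C, fun p hp => hfg p (hS hp) ▸ hC p hp⟩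
  | succ m ih =>
    obtain ⟨⟨C, hC⟩, h⟩ := h
    exact ⟨⟨C, fun p hp => hfg p (hS hp) ▸ hC p hp⟩, ih (fun p hp => dd_congr hU hp hfg) h⟩

lemma BdN.add (hU : IsOpen U) (hS : S ⊆ U) (hf : ContDiffOn ℝ ∞ f U) (hg : ContDiffOn ℝ ∞ g U)
    (h₁ : BdN S m f) (h₂ : BdN S m g) : BdN S m (fun p => f p + g p) := by
  have hb : ∃ C, ∀ p ∈ S, |f p + g p| ≤ C := by
    obtain ⟨C₁, h₁⟩ := h₁.bounded
    obtain ⟨C₂, h₂⟩ := h₂.bounded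
    exact ⟨C₁ + C₂, fun p hp => (abs_add_le _ _).trans (add_le_add (h₁ p hp) (h₂ p hp))⟩
  induction m generalizing f g with
  | zero => exact hb
  | succ m ih =>
    refine ⟨hb, BdN.congr hU hS (fun p hp => (dd_add (hf.differentiableAt_of_isOpen hU hp)
      (hg.differentiableAt_of_isOpen hU hp)).symm) (ih (hf.dd hU eN) (hg.dd hU eN) h₁.2 h₂.2 ?_)⟩
    obtain ⟨C₁, h₁⟩ := h₁.2.bounded
    obtain ⟨C₂, h₂⟩ := h₂.2.bounded
    exact ⟨C₁ + C₂, fun p hp => (abs_add_le _ _).trans (add_le_add (h₁ p hp) (h₂ p hp))⟩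

lemma BdN.mul (hU : IsOpen U) (hS : S ⊆ U) (hf : ContDiffOn ℝ ∞ f U) (hg : ContDiffOn ℝ ∞ g U)
    (h₁ : BdN S m f) (h₂ : BdN S m g) : BdN S m (fun p => f p * g p) := by
  have hb {f g : ℝ × ℝ → ℝ} {m : ℕ} (h₁ : BdN S m f) (h₂ : BdN S m g) :
      ∃ C, ∀ p ∈ S, |f p * g p| ≤ C := by
    obtain ⟨C₁, h₁⟩ := h₁.bounded
    obtain ⟨C₂, h₂⟩ := h₂.bounded
    refine ⟨C₁ * C₂, fun p hp => ?_⟩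
    rw [abs_mul]
    exact mul_le_mul (h₁ p hp) (h₂ p hp) (abs_nonneg _) ((abs_nonneg _).trans (h₁ p hp))
  induction m generalizing f g with
  | zero => exact hb h₁ h₂
  | succ m ih =>
    refine ⟨hb h₁ h₂, BdN.congr hU hS (fun p hp => (dd_mul (hf.differentiableAt_of_isOpen hU hp)
      (hg.differentiableAt_of_isOpen hU hp)).symm) ?_⟩
    exact BdN.add hU hS ((hf.dd hU eN).mul hg) (hf.mul (hg.dd hU eN))
      (ih (hf.dd hU eN) hg h₁.2 h₂.of_succ) (ih hf (hg.dd hU eN) h₁.of_succ h₂.2)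

lemma BdN.const (hU : IsOpen U) (hS : S ⊆ U) (c : ℝ) : BdN S m (fun _ => c) := by
  induction m generalizing c with
  | zero => exact ⟨|c|, fun _ _ => le_rfl⟩
  | succ m ih =>
    exact ⟨⟨|c|, fun _ _ => le_rfl⟩, BdN.congr hU hS (fun p _ => by simp [dd]) (ih 0)⟩

lemma BdN.const_mul (hU : IsOpen U) (hS : S ⊆ U) (c : ℝ) (hf : ContDiffOn ℝ ∞ f U)
    (h : BdN S m f) : BdN S m (fun p => c * f p) :=
  BdN.mul hU hS contDiffOn_const hf (BdN.const hU hS c) h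

lemma BdN.sin_cos (hU : IsOpen U) (hS : S ⊆ U) (hf : ContDiffOn ℝ ∞ f U) (h : BdN S m f) :
    BdN S m (fun p => Real.sin (f p)) ∧ BdN S m (fun p => Real.cos (f p)) := by
  have hs : ContDiffOn ℝ ∞ (fun p => Real.sin (f p)) U := Real.contDiff_sin.comp_contDiffOn hf
  have hc : ContDiffOn ℝ ∞ (fun p => Real.cos (f p)) U := Real.contDiff_cos.comp_contDiffOn hf
  have bs : ∃ C, ∀ p ∈ S, |Real.sin (f p)| ≤ C := ⟨1, fun p _ => Real.abs_sin_le_one _⟩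
  have bc : ∃ C, ∀ p ∈ S, |Real.cos (f p)| ≤ C := ⟨1, fun p _ => Real.abs_cos_le_one _⟩
  induction m with
  | zero => exact ⟨bs, bc⟩
  | succ m ih =>
    have hd (p) (hp : p ∈ U) := hf.differentiableAt_of_isOpen hU hp
    obtain ⟨i₁, i₂⟩ := ih h.of_succ
    refine ⟨⟨bs, ?_⟩, bc, ?_⟩
    · exact BdN.congr hU hS (fun p hp => (dd_comp (Real.hasDerivAt_sin _) (hd p hp)).symm)
        (BdN.mul hU hS hc (hf.dd hU eN) i₂ h.2)
    · refine BdN.congr hU hS (fun p hp => ?_)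
        (BdN.const_mul hU hS (-1) (hs.mul (hf.dd hU eN))
          (BdN.mul hU hS hs (hf.dd hU eN) i₁ h.2))
      rw [dd_comp (Real.hasDerivAt_cos _) (hd p hp)]
      ring

lemma bdN_rho (hU : IsOpen U) (hpos : ∀ p ∈ U, 0 < p.2) (hS : S ⊆ U)
    (hb : ∃ C, ∀ p ∈ S, |rho p| ≤ C) : BdN S m rho := by
  induction m with
  | zero => exact hb
  | succ m ih =>
    have hr := contDiffOn_rho hpos
    refine ⟨hb, BdN.congr hU hS (fun p hp => ?_)
      (BdN.const_mul hU hS (1 / 4) (hr.mul (hr.mul hr))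
        (BdN.mul hU hS hr (hr.mul hr) ih (BdN.mul hU hS hr hr ih ih)))⟩
    rw [dd_rho (hpos p hp)]
    norm_num [eN, pow_three]

/-- A function whose outgoing derivative is `O(r ^ (-3/2))` varies by `O(r ^ (-1/2))`
along outgoing null lines. -/
lemma abs_sub_le_of_transport {a b v₀ C : ℝ} (hpos : ∀ p ∈ U, 0 < p.2)
    (hU : IsOpen U) (hS : strip a b v₀ ⊆ U) (hf : ContDiffOn ℝ ∞ f U)
    (hC : ∀ p ∈ strip a b v₀, |dd eL f p| ≤ C * rho p ^ 3) {u v v' : ℝ} (hu : u ∈ Icc a b)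
    (hv : v₀ ≤ v) (hvv : v ≤ v') :
    |f (nul u v') - f (nul u v)| ≤ 4 * C * (rho (nul u v) - rho (nul u v')) := by
  have hmem : ∀ x ∈ Ici v₀, nul u x ∈ strip a b v₀ := fun x hx => nul_mem_strip.2 ⟨hu, hx⟩
  have hdf : ∀ x ∈ Ici v₀, HasDerivAt (fun x => f (nul u x)) (dd eL f (nul u x)) x :=
    fun x hx => hasDerivAt_along (hf.differentiableAt_of_isOpen hU (hS (hmem x hx)))
      (hasDerivAt_nul_snd u x)
  have hdr : ∀ x ∈ Ici v₀, HasDerivAt (fun x => 4 * C * rho (nul u x))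
      (-(C * rho (nul u x) ^ 3)) x := by
    intro x hx
    have hx' := hS (hmem x hx)
    have := (hasDerivAt_along ((contDiffOn_rho hpos).differentiableAt_of_isOpen hU hx')
      (hasDerivAt_nul_snd u x)).const_mul (4 * C)
    rw [dd_rho (hpos _ hx')] at this
    refine this.congr_deriv ?_
    norm_num [eL]
    ring
  have h1 : AntitoneOn (fun x => f (nul u x) + 4 * C * rho (nul u x)) (Ici v₀) := by
    refine antitoneOn_of_deriv_nonpos (convex_Ici v₀)
      (fun x hx => ((hdf x hx).add (hdr x hx)).continuousAt.continuousWithinAt)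
      (fun x hx => ((hdf x (interior_subset hx)).add
        (hdr x (interior_subset hx))).differentiableAt.differentiableWithinAt) fun x hx => ?_
    have hx := interior_subset hx
    have := ((hdf x hx).add (hdr x hx)).deriv
    erw [this]
    have := abs_le.1 (hC _ (hmem x hx))
    linarith
  have h2 : MonotoneOn (fun x => f (nul u x) - 4 * C * rho (nul u x)) (Ici v₀) := by
    refine monotoneOn_of_deriv_nonneg (convex_Ici v₀)
      (fun x hx => ((hdf x hx).sub (hdr x hx)).continuousAt.continuousWithinAt)
      (fun x hx => ((hdf x (interior_subset hx)).sub
        (hdr x (interior_subset hx))).differentiableAt.differentiableWithinAt) fun x hx => ?_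
    have hx := interior_subset hx
    have := ((hdf x hx).sub (hdr x hx)).deriv
    erw [this]
    have := abs_le.1 (hC _ (hmem x hx))
    linarith
  have i1 := h1 (mem_Ici.2 hv) (mem_Ici.2 (hv.trans hvv)) hvv
  have i2 := h2 (mem_Ici.2 hv) (mem_Ici.2 (hv.trans hvv)) hvv
  simp only at i1 i2
  rw [abs_le]
  constructor <;> linarith

lemma rho_le_of_mem_strip {a b v₀ : ℝ} (h : b < v₀) {p : ℝ × ℝ} (hp : p ∈ strip a b v₀) :
    0 < p.2 ∧ |rho p| ≤ (√((v₀ - b) / 2))⁻¹ := by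
  have h1 : (v₀ - b) / 2 ≤ p.2 := by
    have := hp.1.2; have := hp.2; linarith
  have h2 : 0 < (v₀ - b) / 2 := by linarith
  refine ⟨h2.trans_le h1, ?_⟩
  rw [abs_of_pos (rho_pos (h2.trans_le h1)), rho]
  gcongr

lemma bounded_of_transport {a b v₀ : ℝ} (hab : b < v₀) (hpos : ∀ p ∈ U, 0 < p.2)
    (hU : IsOpen U) (hS : strip a b v₀ ⊆ U) (hf : ContDiffOn ℝ ∞ f U)
    (hC : ∃ C, ∀ p ∈ strip a b v₀, |dd eL f p| ≤ C * rho p ^ 3) :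
    ∃ C, ∀ p ∈ strip a b v₀, |f p| ≤ C := by
  obtain ⟨C, hC⟩ := hC
  have hcont : ContinuousOn (fun u => f (nul u v₀)) (Icc a b) := fun u hu =>
    (hasDerivAt_along (γ := fun u => nul u v₀) (hf.differentiableAt_of_isOpen hU
      (hS (nul_mem_strip.2 ⟨hu, le_rfl⟩)))
      (hasDerivAt_nul_fst u v₀)).continuousAt.continuousWithinAt
  obtain ⟨B, hB⟩ := isCompact_Icc.exists_bound_of_continuousOn hcont
  refine ⟨B + 4 * |C| * (√((v₀ - b) / 2))⁻¹, fun p hp => ?_⟩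
  have hp' : nul (p.1 - p.2) (p.1 + p.2) = p := nul_self _ _
  have h1 := abs_sub_le_of_transport hpos hU hS hf hC hp.1 le_rfl hp.2
  have h2 := hB _ hp.1
  rw [hp'] at h1
  have h0 := nul_mem_strip.2 ⟨hp.1, le_refl v₀⟩
  have h3 := rho_le_of_mem_strip hab h0
  have h4 := rho_pos (rho_le_of_mem_strip hab hp).1
  have h5 := rho_pos h3.1
  have h6 : 0 ≤ rho (nul (p.1 - p.2) v₀) - rho p := by
    by_contra hneg
    have hle := abs_sub_le_of_transport (f := fun _ => (0 : ℝ)) (C := 1) hpos hU hS contDiffOn_const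
      (fun q hq => by
        have := rho_pos (rho_le_of_mem_strip hab hq).1
        simp only [dd, fderiv_fun_const]
        simp
        positivity) hp.1 le_rfl hp.2
    rw [hp'] at hle
    simp at hle
    linarith
  rw [abs_of_pos h5] at h3
  have h7 : 4 * C * (rho (nul (p.1 - p.2) v₀) - rho p) ≤ 4 * |C| * (√((v₀ - b) / 2))⁻¹ := by
    have : C ≤ |C| := le_abs_self C
    calc 4 * C * (rho (nul (p.1 - p.2) v₀) - rho p)
        ≤ 4 * |C| * (rho (nul (p.1 - p.2) v₀) - rho p) := by gcongr
      _ ≤ 4 * |C| * (√((v₀ - b) / 2))⁻¹ := by gcongr; linarith [h3.2]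
  rw [Real.norm_eq_abs] at h2
  have := abs_sub_abs_le_abs_sub (f p) (f (nul (p.1 - p.2) v₀))
  linarith

lemma dd_eL_dd_eN_of_transport {Y : ℝ × ℝ → ℝ} (hpos : ∀ p ∈ U, 0 < p.2) (hU : IsOpen U)
    (hf : ContDiffOn ℝ ∞ f U) (hY : ContDiffOn ℝ ∞ Y U)
    (h : ∀ p ∈ U, dd eL f p = rho p ^ 3 * Y p) :
    ∀ p ∈ U, dd eL (dd eN f) p = rho p ^ 3 * (dd eN Y p + 3 / 4 * (rho p * (rho p * Y p))) := by
  intro p hp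
  have hr := contDiffOn_rho hpos
  have hr3 : ContDiffOn ℝ ∞ (fun p => rho p ^ 3) U := hr.pow 3
  rw [dd_comm hf hU hp, dd_congr hU hp h, dd_mul (hr3.differentiableAt_of_isOpen hU hp)
    (hY.differentiableAt_of_isOpen hU hp), dd_comp (F := fun x => x ^ 3) (hasDerivAt_pow 3 _)
    (hr.differentiableAt_of_isOpen hU hp), dd_rho (hpos p hp), eN]
  norm_num
  ring

lemma BdN.of_transport {a b v₀ : ℝ} (hab : b < v₀) (hpos : ∀ p ∈ U, 0 < p.2)
    (hU : IsOpen U) (hS : strip a b v₀ ⊆ U) {Y : ℝ × ℝ → ℝ}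
    (hf : ContDiffOn ℝ ∞ f U) (hY : ContDiffOn ℝ ∞ Y U)
    (h : ∀ p ∈ U, dd eL f p = rho p ^ 3 * Y p) (hYb : BdN (strip a b v₀) m Y) :
    BdN (strip a b v₀) m f := by
  have hr := contDiffOn_rho hpos
  have hbr {m} : BdN (strip a b v₀) m rho :=
    bdN_rho hU hpos hS ⟨_, fun p hp => (rho_le_of_mem_strip hab hp).2⟩
  have hb : ∃ C, ∀ p ∈ strip a b v₀, |f p| ≤ C := by
    refine bounded_of_transport hab hpos hU hS hf ?_
    obtain ⟨C, hC⟩ := hYb.bounded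
    refine ⟨C, fun p hp => ?_⟩
    have h0 := rho_pos (hpos p (hS hp))
    rw [h p (hS hp), abs_mul, abs_of_pos (pow_pos h0 3), mul_comm]
    exact mul_le_mul_of_nonneg_right (hC p hp) (pow_pos h0 3).le
  induction m generalizing f Y with
  | zero => exact hb
  | succ m ih =>
    have hY2 : ContDiffOn ℝ ∞ (fun p => rho p * (rho p * Y p)) U :=
      hr.mul (hr.mul hY)
    have hYN : ContDiffOn ℝ ∞ (fun p => dd eN Y p + 3 / 4 * (rho p * (rho p * Y p))) U :=
      (hY.dd hU eN).add (contDiffOn_const.mul hY2)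
    have hYNb : BdN (strip a b v₀) m
        (fun p => dd eN Y p + 3 / 4 * (rho p * (rho p * Y p))) :=
      BdN.add hU hS (hY.dd hU eN) (contDiffOn_const.mul hY2) hYb.2
        (BdN.const_mul hU hS _ hY2 (BdN.mul hU hS hr (hr.mul hY) hbr
          (BdN.mul hU hS hr hY hbr hYb.of_succ)))
    have hN := dd_eL_dd_eN_of_transport hpos hU hf hY h
    refine ⟨hb, ih (hf.dd hU eN) hYN hN hYNb ?_⟩
    refine bounded_of_transport hab hpos hU hS (hf.dd hU eN) ?_
    obtain ⟨C, hC⟩ := hYNb.bounded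
    refine ⟨C, fun p hp => ?_⟩
    have h0 := rho_pos (hpos p (hS hp))
    rw [hN p (hS hp), abs_mul, abs_of_pos (pow_pos h0 3), mul_comm]
    exact mul_le_mul_of_nonneg_right (hC p hp) (pow_pos h0 3).le

end Transport

/-! ### Radiation fields -/

/-- `w` solves `w_tt - w_rr - w_r / r + V'(w) / (2 r²) = 0` on `U`, a convex open set of positive
radii which contains all outgoing strips starting at positive times. -/
structure IsWave (V V' : ℝ → ℝ) (U : Set (ℝ × ℝ)) (w : ℝ × ℝ → ℝ) : Prop where
  isOpen : IsOpen U
  convex : Convex ℝ U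
  pos : ∀ p ∈ U, 0 < p.2
  strip_subset : ∀ a b v₀, b < v₀ → -a < v₀ → strip a b v₀ ⊆ U
  contDiff_V : ContDiff ℝ ∞ V
  contDiff_V' : ContDiff ℝ ∞ V'
  hasDerivAt_V : ∀ x, HasDerivAt V (V' x) x
  V_nonneg : ∀ x, 0 ≤ V x
  V_le : ∀ x, V x ≤ x ^ 2
  smooth : ContDiffOn ℝ ∞ w U
  eq : ∀ p ∈ U, dd eT (dd eT w) p - dd eR (dd eR w) p - dd eR w p / p.2
      + V' (w p) / (2 * p.2 ^ 2) = 0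
  bdN_V' : ∀ S m, S ⊆ U → BdN S m w → BdN S m (fun p => V' (w p))

/-- `f` is bounded on outgoing strips. -/
def StripBdd (f : ℝ × ℝ → ℝ) : Prop :=
  ∀ a b v₀, b < v₀ → -a < v₀ → ∃ C, ∀ p ∈ strip a b v₀, |f p| ≤ C

/-- `f` converges to `G` along outgoing null lines, at rate `r ^ (-1/2)` on outgoing strips. -/
def RadLim (f : ℝ × ℝ → ℝ) (G : ℝ → ℝ) : Prop :=
  ∀ a b v₀, b < v₀ → -a < v₀ → ∃ C, ∀ p ∈ strip a b v₀, |f p - G (p.1 - p.2)| ≤ C * rho p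

lemma nul_sub (u v : ℝ) : (nul u v).1 - (nul u v).2 = u := by simp only [nul]; ring

lemma tendsto_rho_nul (u : ℝ) : Tendsto (fun v => rho (nul u v)) atTop (𝓝 0) := by
  refine tendsto_inv_atTop_zero.comp (Real.tendsto_sqrt_atTop.comp ?_)
  exact (tendsto_atTop_add_const_right atTop (-u) tendsto_id).atTop_div_const two_pos

lemma rho_nul_le {u b v : ℝ} (hub : u ≤ b) (hv : b < v) : rho (nul u v) ≤ rho (nul b v) := by
  have : 0 < (v - b) / 2 := by linarith
  simp only [rho, nul]
  gcongr

lemma RadLim.tendstoUniformlyOn {f : ℝ × ℝ → ℝ} {G : ℝ → ℝ} (h : RadLim f G) (a b : ℝ) :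
    TendstoUniformlyOn (fun v u => f (nul u v)) G atTop (Icc a b) := by
  obtain ⟨C, hC⟩ := h a b (max b (-a) + 1) (by linarith [le_max_left b (-a)])
    (by linarith [le_max_right b (-a)])
  rw [Metric.tendstoUniformlyOn_iff]
  intro ε hε
  have h1 : Tendsto (fun v => |C| * rho (nul b v)) atTop (𝓝 0) := by
    simpa using (tendsto_rho_nul b).const_mul |C|
  filter_upwards [h1.eventually (gt_mem_nhds hε), eventually_ge_atTop (max b (-a) + 1)]
    with v hv1 hv2 u hu
  have h2 := hC _ (nul_mem_strip.2 ⟨hu, hv2⟩)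
  have hbv : b < v := by linarith [le_max_left b (-a)]
  rw [nul_sub] at h2
  rw [dist_comm, Real.dist_eq]
  calc |f (nul u v) - G u| ≤ C * rho (nul u v) := h2
    _ ≤ |C| * rho (nul b v) := by
      have : 0 ≤ rho (nul u v) := by unfold rho; positivity
      gcongr
      · exact le_abs_self C
      · exact rho_nul_le hu.2 hbv
    _ < ε := hv1

lemma RadLim.tendsto {f : ℝ × ℝ → ℝ} {G : ℝ → ℝ} (h : RadLim f G) (u : ℝ) :
    Tendsto (fun v => f (nul u v)) atTop (𝓝 (G u)) :=
  (h.tendstoUniformlyOn u u).tendsto_at ⟨le_rfl, le_rfl⟩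

lemma contDiff_of_hasDerivAt_seq {G : ℕ → ℝ → ℝ} (h : ∀ j u, HasDerivAt (G j) (G (j + 1) u) u)
    (j : ℕ) : ContDiff ℝ ∞ (G j) := by
  rw [contDiff_infty]
  intro n
  induction n generalizing j with
  | zero =>
    exact contDiff_zero.2 (continuous_iff_continuousAt.2 fun u => (h j u).continuousAt)
  | succ n ih =>
    have : deriv (G j) = G (j + 1) := funext fun u => (h j u).deriv
    push_cast
    rw [contDiff_succ_iff_deriv, this]
    exact ⟨fun u => (h j u).differentiableAt, by simp, ih (j + 1)⟩

section Radiation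

variable {V V' : ℝ → ℝ} {U : Set (ℝ × ℝ)} {w : ℝ × ℝ → ℝ}

lemma IsWave.exists_potential (h : IsWave V V' U w) : ∃ P, IsPotential V w U P :=
  exists_isPotential h.isOpen h.convex h.pos h.contDiff_V h.hasDerivAt_V h.smooth h.eq

lemma IsWave.nul_mem (h : IsWave V V' U w) {u v : ℝ} (h1 : u < v) (h2 : -u < v) : nul u v ∈ U :=
  h.strip_subset u u v h1 h2 (nul_mem_strip.2 ⟨⟨le_rfl, le_rfl⟩, le_rfl⟩)

lemma IsWave.exists_radLim (h : IsWave V V' U w) {f Y : ℝ × ℝ → ℝ} (hf : ContDiffOn ℝ ∞ f U)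
    (hfY : ∀ p ∈ U, dd eL f p = rho p ^ 3 * Y p) (hY : StripBdd Y) : ∃ G, RadLim f G := by
  have key : ∀ a b v₀, b < v₀ → -a < v₀ → ∃ C, 0 ≤ C ∧ ∀ u ∈ Icc a b, ∀ v v', v₀ ≤ v → v ≤ v' →
      |f (nul u v') - f (nul u v)| ≤ C * rho (nul u v) := by
    intro a b v₀ hb ha
    obtain ⟨C, hC⟩ := hY a b v₀ hb ha
    have hS := h.strip_subset a b v₀ hb ha
    refine ⟨4 * |C|, by positivity, fun u hu v v' hv hvv => ?_⟩
    have hb' : ∀ p ∈ strip a b v₀, |dd eL f p| ≤ |C| * rho p ^ 3 := by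
      intro p hp
      have h0 := pow_pos (rho_pos (h.pos p (hS hp))) 3
      rw [hfY p (hS hp), abs_mul, abs_of_pos h0, mul_comm]
      exact mul_le_mul_of_nonneg_right ((hC p hp).trans (le_abs_self C)) h0.le
    refine (abs_sub_le_of_transport h.pos h.isOpen hS hf hb' hu hv hvv).trans ?_
    have := rho_pos (h.pos _ (hS (nul_mem_strip.2 ⟨hu, hv.trans hvv⟩)))
    gcongr
    linarith
  have lim : ∀ u, ∃ G, Tendsto (fun v => f (nul u v)) atTop (𝓝 G) := by
    intro u
    obtain ⟨C, hC0, hC⟩ := key u u (|u| + 1) (by linarith [le_abs_self u])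
      (by linarith [neg_abs_le u])
    refine cauchySeq_tendsto_of_complete (Metric.cauchySeq_iff'.2 fun ε hε => ?_)
    have h1 : Tendsto (fun v => C * rho (nul u v)) atTop (𝓝 0) := by
      simpa using (tendsto_rho_nul u).const_mul C
    obtain ⟨N, hN1, hN2⟩ := ((h1.eventually (gt_mem_nhds hε)).and
      (eventually_ge_atTop (|u| + 1))).exists
    exact ⟨N, fun v hv => (hC u ⟨le_rfl, le_rfl⟩ N v hN2 hv).trans_lt hN1⟩
  choose G hG using lim
  refine ⟨G, fun a b v₀ hb ha => ?_⟩
  obtain ⟨C, hC0, hC⟩ := key a b v₀ hb ha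
  refine ⟨C, fun p hp => ?_⟩
  have hp' : nul (p.1 - p.2) (p.1 + p.2) = p := nul_self _ _
  have h1 : Tendsto (fun v => |f (nul (p.1 - p.2) v) - f p|) atTop
      (𝓝 |G (p.1 - p.2) - f p|) := ((hG _).sub_const _).abs
  rw [abs_sub_comm]
  refine le_of_tendsto h1 ?_
  filter_upwards [eventually_ge_atTop (p.1 + p.2)] with v hv
  have := hC _ hp.1 _ v hp.2 hv
  rwa [hp'] at this

lemma IsWave.dd_eN_sqrt_mul (h : IsWave V V' U w) {p : ℝ × ℝ} (hp : p ∈ U) :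
    dd eN (fun p => √p.2 * w p) p = √p.2 * dd eN w p - 1 / 4 * (rho p * w p) := by
  have h0 := h.pos p hp
  rw [dd_mul (differentiableAt_snd.sqrt h0.ne') (h.smooth.differentiableAt_of_isOpen h.isOpen hp),
    dd_sqrt_snd h0]
  norm_num [eN]
  ring

lemma IsWave.contDiffOn_sqrt_mul (h : IsWave V V' U w) :
    ContDiffOn ℝ ∞ (fun p => √p.2 * w p) U :=
  (contDiffOn_sqrt_snd h.pos).mul h.smooth

lemma IsWave.dd_eL_dd_eN_sqrt_mul (h : IsWave V V' U w) {p : ℝ × ℝ} (hp : p ∈ U) :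
    dd eL (dd eN (fun p => √p.2 * w p)) p =
      rho p ^ 3 * (1 / 16 * w p + -(1 / 8) * V' (w p)) := by
  have h0 := h.pos p hp
  have hU := h.isOpen
  have hw := h.smooth
  have ds : DifferentiableAt ℝ (fun q : ℝ × ℝ => √q.2) p := differentiableAt_snd.sqrt h0.ne'
  have dr := (contDiffOn_rho h.pos).differentiableAt_of_isOpen hU hp
  have dw := hw.differentiableAt_of_isOpen hU hp
  have dN := (hw.dd hU eN).differentiableAt_of_isOpen hU hp
  have dT := (hw.dd hU eT).differentiableAt_of_isOpen hU hp
  have dR := (hw.dd hU eR).differentiableAt_of_isOpen hU hp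
  have d1 : DifferentiableAt ℝ (fun q : ℝ × ℝ => √q.2 * dd eN w q) p := ds.mul dN
  have d2 : DifferentiableAt ℝ (fun q : ℝ × ℝ => rho q * w q) p := dr.mul dw
  have d3 : DifferentiableAt ℝ (fun q : ℝ × ℝ => 1 / 4 * (rho q * w q)) p := d2.const_mul _
  rw [dd_congr hU hp fun q hq => h.dd_eN_sqrt_mul hq,
    dd_sub d1 d3, dd_mul ds dN, dd_const_mul _ d2, dd_mul dr dw, dd_sqrt_snd h0, dd_rho h0]
  have e1 : dd eL (dd eN w) p = (dd eT (dd eT w) p - dd eR (dd eR w) p) / 4 := by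
    have e2 : dd eL (dd eN w) p = dd eL (fun q => 1 / 2 * (dd eT w q - dd eR w q)) p :=
      dd_congr hU hp fun q _ => by rw [dd_eN]; ring
    have d4 : DifferentiableAt ℝ (fun q => dd eT w q - dd eR w q) p := dT.sub dR
    rw [e2, dd_const_mul _ d4, dd_sub dT dR, dd_eL, dd_eL, dd_comm hw hU hp (v := eR)]
    ring
  have e3 : dd eT (dd eT w) p - dd eR (dd eR w) p
      = dd eR w p / p.2 - V' (w p) / (2 * p.2 ^ 2) := by linarith [h.eq p hp]
  rw [e1, e3, dd_eN, dd_eL]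
  have h2 : p.2⁻¹ = rho p ^ 2 := (rho_sq h0).symm
  have h3 : √p.2 * rho p = 1 := mul_inv_cancel₀ (Real.sqrt_pos.2 h0).ne'
  have h4 : dd eR w p / p.2 - V' (w p) / (2 * p.2 ^ 2)
      = rho p ^ 2 * dd eR w p - rho p ^ 4 * V' (w p) / 2 := by
    rw [show rho p ^ 4 = (rho p ^ 2) ^ 2 by ring, ← h2]
    field_simp
  rw [h4]
  have h5 : (eL).2 = 1 / 2 := rfl
  rw [h5]
  linear_combination (rho p * dd eR w p / 4 - rho p ^ 3 * V' (w p) / 8) * h3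

/-- Bounded waves have all incoming derivatives bounded on outgoing strips. -/
lemma IsWave.bdN (h : IsWave V V' U w) {a b v₀ : ℝ} (hb : b < v₀) (ha : -a < v₀)
    (hw : ∃ C, ∀ p ∈ strip a b v₀, |w p| ≤ C) (m : ℕ) : BdN (strip a b v₀) m w := by
  have hU := h.isOpen
  have hS := h.strip_subset a b v₀ hb ha
  have hr := contDiffOn_rho h.pos
  have hX := h.contDiffOn_sqrt_mul.dd hU eN
  have hV : ContDiffOn ℝ ∞ (fun p => V' (w p)) U := h.contDiff_V'.comp_contDiffOn h.smooth
  induction m with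
  | zero => exact hw
  | succ m ih =>
    have hbr : BdN (strip a b v₀) m rho :=
      bdN_rho hU h.pos hS ⟨_, fun p hp => (rho_le_of_mem_strip hb hp).2⟩
    have hYb : BdN (strip a b v₀) m (fun p => 1 / 16 * w p + -(1 / 8) * V' (w p)) :=
      BdN.add hU hS (contDiffOn_const.mul h.smooth) (contDiffOn_const.mul hV)
        (BdN.const_mul hU hS _ h.smooth ih) (BdN.const_mul hU hS _ hV (h.bdN_V' _ m hS ih))
    have hXb := BdN.of_transport hb h.pos hU hS hX
      ((contDiffOn_const.mul h.smooth).add (contDiffOn_const.mul hV))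
      (fun p hp => h.dd_eL_dd_eN_sqrt_mul hp) hYb
    refine ⟨hw, BdN.congr hU hS (fun p hp => ?_) (BdN.mul hU hS hr
      (hX.add (contDiffOn_const.mul (hr.mul h.smooth))) hbr (BdN.add hU hS hX
        (contDiffOn_const.mul (hr.mul h.smooth)) hXb
        (BdN.const_mul hU hS (1 / 4) (hr.mul h.smooth) (BdN.mul hU hS hr h.smooth hbr ih))))⟩
    have h3 : √p.2 * rho p = 1 := mul_inv_cancel₀ (Real.sqrt_pos.2 (h.pos p hp)).ne'
    simp only [h.dd_eN_sqrt_mul hp]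
    linear_combination dd eN w p * h3

lemma IsWave.iterate (h : IsWave V V' U w) (hw : StripBdd w) (j : ℕ) :
    ContDiffOn ℝ ∞ ((dd eN)^[j + 1] (fun p => √p.2 * w p)) U ∧
    ∃ Y : ℝ × ℝ → ℝ, ContDiffOn ℝ ∞ Y U ∧
      (∀ a b v₀, b < v₀ → -a < v₀ → ∀ m, BdN (strip a b v₀) m Y) ∧
      ∀ p ∈ U, dd eL ((dd eN)^[j + 1] (fun p => √p.2 * w p)) p = rho p ^ 3 * Y p := by
  have hU := h.isOpen
  have hV : ContDiffOn ℝ ∞ (fun p => V' (w p)) U := h.contDiff_V'.comp_contDiffOn h.smooth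
  have hr := contDiffOn_rho h.pos
  induction j with
  | zero =>
    refine ⟨h.contDiffOn_sqrt_mul.dd hU eN, fun p => 1 / 16 * w p + -(1 / 8) * V' (w p),
      (contDiffOn_const.mul h.smooth).add (contDiffOn_const.mul hV), fun a b v₀ hb ha m => ?_,
      fun p hp => h.dd_eL_dd_eN_sqrt_mul hp⟩
    have hS := h.strip_subset a b v₀ hb ha
    have ih := h.bdN hb ha (hw a b v₀ hb ha) m
    exact BdN.add hU hS (contDiffOn_const.mul h.smooth) (contDiffOn_const.mul hV)
        (BdN.const_mul hU hS _ h.smooth ih) (BdN.const_mul hU hS _ hV (h.bdN_V' _ m hS ih))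
  | succ j ih =>
    obtain ⟨hs, Y, hY, hYb, hYe⟩ := ih
    rw [Function.iterate_succ', Function.comp_apply]
    have hY2 : ContDiffOn ℝ ∞ (fun p => rho p * (rho p * Y p)) U := hr.mul (hr.mul hY)
    refine ⟨hs.dd hU eN, fun p => dd eN Y p + 3 / 4 * (rho p * (rho p * Y p)),
      (hY.dd hU eN).add (contDiffOn_const.mul hY2), fun a b v₀ hb ha m => ?_,
      dd_eL_dd_eN_of_transport h.pos hU hs hY hYe⟩
    have hS := h.strip_subset a b v₀ hb ha
    have hbr : BdN (strip a b v₀) m rho :=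
      bdN_rho hU h.pos hS ⟨_, fun p hp => (rho_le_of_mem_strip hb hp).2⟩
    exact BdN.add hU hS (hY.dd hU eN) (contDiffOn_const.mul hY2) (hYb a b v₀ hb ha (m + 1)).2
      (BdN.const_mul hU hS _ hY2 (BdN.mul hU hS hr (hr.mul hY) hbr
        (BdN.mul hU hS hr hY hbr (hYb a b v₀ hb ha m))))

/-- A wave which is bounded on outgoing strips has a smooth radiation field. -/
theorem IsWave.exists_radiation (h : IsWave V V' U w) (hw : StripBdd w) :
    ∃ g : ℝ → ℝ, ContDiff ℝ ∞ g ∧ RadLim (fun p => √p.2 * dd eN w p) g := by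
  have hU := h.isOpen
  have hlim : ∀ j, ∃ G, RadLim ((dd eN)^[j + 1] (fun p => √p.2 * w p)) G := by
    intro j
    obtain ⟨hs, Y, hY, hYb, hYe⟩ := h.iterate hw j
    exact h.exists_radLim hs hYe fun a b v₀ hb ha => (hYb a b v₀ hb ha 0).bounded
  choose G hG using hlim
  refine ⟨G 0, contDiff_of_hasDerivAt_seq (G := G) (fun j u => ?_) 0, ?_⟩
  · have hsub : Ioo (u - 1) (u + 1) ⊆ Icc (u - 1) (u + 1) := Ioo_subset_Icc_self
    refine hasDerivAt_of_tendstoUniformlyOn (l := atTop) (isOpen_Ioo (a := u - 1) (b := u + 1))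
      (((hG (j + 1)).tendstoUniformlyOn (u - 1) (u + 1)).mono hsub)
      ?_ (fun x _ => (hG j).tendsto x) ⟨by linarith, by linarith⟩
    filter_upwards [eventually_gt_atTop (max (u + 1) (-(u - 1)))] with v hv x hx
    have hm : nul x v ∈ U := h.nul_mem (by linarith [le_max_left (u + 1) (-(u - 1)), hx.2])
      (by linarith [le_max_right (u + 1) (-(u - 1)), hx.1])
    rw [Function.iterate_succ' (dd eN) (j + 1), Function.comp_apply]
    exact hasDerivAt_along (γ := fun x => nul x v)
      ((h.iterate hw j).1.differentiableAt_of_isOpen hU hm) (hasDerivAt_nul_fst x v)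
  · intro a b v₀ hb ha
    obtain ⟨C, hC⟩ := hG 0 a b v₀ hb ha
    obtain ⟨B, hB⟩ := hw a b v₀ hb ha
    refine ⟨C + B / 4, fun p hp => ?_⟩
    have hpU := h.strip_subset a b v₀ hb ha hp
    have h1 := hC p hp
    have h2 := hB p hp
    have h3 := rho_pos (h.pos p hpU)
    simp only [Function.iterate_succ', Function.iterate_zero, Function.comp_apply, id,
      h.dd_eN_sqrt_mul hpU] at h1
    have h4 : |1 / 4 * (rho p * w p)| ≤ B / 4 * rho p := by
      rw [abs_mul, abs_mul, abs_of_pos h3]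
      norm_num
      nlinarith
    calc |√p.2 * dd eN w p - G 0 (p.1 - p.2)|
        = |(√p.2 * dd eN w p - 1 / 4 * (rho p * w p) - G 0 (p.1 - p.2))
            + 1 / 4 * (rho p * w p)| := by ring_nf
      _ ≤ C * rho p + B / 4 * rho p := (abs_add_le _ _).trans (add_le_add h1 h4)
      _ = (C + B / 4) * rho p := by ring

end Radiation

/-! ### Energy in windows around the light cone -/

lemma StripBdd.mul {f g : ℝ × ℝ → ℝ} (hf : StripBdd f) (hg : StripBdd g) :
    StripBdd (fun p => f p * g p) := by
  intro a b v₀ hb ha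
  obtain ⟨C₁, h₁⟩ := hf a b v₀ hb ha
  obtain ⟨C₂, h₂⟩ := hg a b v₀ hb ha
  refine ⟨C₁ * C₂, fun p hp => ?_⟩
  rw [abs_mul]
  exact mul_le_mul (h₁ p hp) (h₂ p hp) (abs_nonneg _) ((abs_nonneg _).trans (h₁ p hp))

lemma StripBdd.add {f g : ℝ × ℝ → ℝ} (hf : StripBdd f) (hg : StripBdd g) :
    StripBdd (fun p => f p + g p) := by
  intro a b v₀ hb ha
  obtain ⟨C₁, h₁⟩ := hf a b v₀ hb ha
  obtain ⟨C₂, h₂⟩ := hg a b v₀ hb ha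
  exact ⟨C₁ + C₂, fun p hp => (abs_add_le _ _).trans (add_le_add (h₁ p hp) (h₂ p hp))⟩

lemma StripBdd.sub {f g : ℝ × ℝ → ℝ} (hf : StripBdd f) (hg : StripBdd g) :
    StripBdd (fun p => f p - g p) := by
  intro a b v₀ hb ha
  obtain ⟨C₁, h₁⟩ := hf a b v₀ hb ha
  obtain ⟨C₂, h₂⟩ := hg a b v₀ hb ha
  exact ⟨C₁ + C₂, fun p hp => (abs_sub _ _).trans (add_le_add (h₁ p hp) (h₂ p hp))⟩

lemma stripBdd_const (c : ℝ) : StripBdd (fun _ => c) := fun _ _ _ _ _ => ⟨|c|, fun _ _ => le_rfl⟩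

lemma stripBdd_rho : StripBdd rho := fun _ _ _ hb _ =>
  ⟨_, fun _ hp => (rho_le_of_mem_strip hb hp).2⟩

lemma StripBdd.of_abs_le {f g : ℝ × ℝ → ℝ} (hg : StripBdd g)
    (h : ∀ p : ℝ × ℝ, 0 < p.2 → |f p| ≤ |g p|) : StripBdd f := by
  intro a b v₀ hb ha
  obtain ⟨C, hC⟩ := hg a b v₀ hb ha
  exact ⟨C, fun p hp => (h p (rho_le_of_mem_strip hb hp).1).trans (hC p hp)⟩

lemma RadLim.stripBdd {f : ℝ × ℝ → ℝ} {G : ℝ → ℝ} (h : RadLim f G) (hG : Continuous G) :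
    StripBdd f := by
  intro a b v₀ hb ha
  obtain ⟨C, hC⟩ := h a b v₀ hb ha
  obtain ⟨K, hK⟩ := stripBdd_rho a b v₀ hb ha
  obtain ⟨B, hB⟩ := (isCompact_Icc (a := a) (b := b)).exists_bound_of_continuousOn hG.continuousOn
  refine ⟨|C| * K + B, fun p hp => ?_⟩
  have h1 : C * rho p ≤ |C| * K := by
    have : |rho p| ≤ K := hK p hp
    calc C * rho p ≤ |C * rho p| := le_abs_self _
      _ = |C| * |rho p| := abs_mul _ _
      _ ≤ |C| * K := by gcongr
  have h2 := hB _ hp.1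
  rw [Real.norm_eq_abs] at h2
  have h3 := hC p hp
  have := abs_add_le (f p - G (p.1 - p.2)) (G (p.1 - p.2))
  rw [sub_add_cancel] at this
  linarith

lemma tendsto_nul_of_stripBdd_mul_rho {f : ℝ × ℝ → ℝ} (hf : StripBdd f) (u : ℝ) :
    Tendsto (fun v => f (nul u v) * rho (nul u v)) atTop (𝓝 0) := by
  obtain ⟨C, hC⟩ := hf u u (|u| + 1) (by linarith [le_abs_self u]) (by linarith [neg_abs_le u])
  have h1 : Tendsto (fun v => C * rho (nul u v)) atTop (𝓝 0) := by
    simpa using (tendsto_rho_nul u).const_mul C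
  refine squeeze_zero_norm' ?_ h1
  filter_upwards [eventually_ge_atTop (|u| + 1)] with v hv
  have h0 : 0 ≤ rho (nul u v) := by unfold rho; positivity
  rw [norm_mul, Real.norm_eq_abs, Real.norm_eq_abs, abs_of_nonneg h0]
  exact mul_le_mul_of_nonneg_right (hC _ (nul_mem_strip.2 ⟨⟨le_rfl, le_rfl⟩, hv⟩)) h0

section Window

variable {V V' : ℝ → ℝ} {U : Set (ℝ × ℝ)} {w : ℝ × ℝ → ℝ} {a b : ℝ}

lemma pair_eq_nul (T u : ℝ) : (T, T - u) = nul u (2 * T - u) := by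
  simp only [nul, Prod.mk.injEq]; constructor <;> ring

lemma IsWave.tendsto_window (h : IsWave V V' U w) (hab : a ≤ b) {F : ℝ × ℝ → ℝ} {G : ℝ → ℝ}
    (hF : ContinuousOn F U) (hb : StripBdd F)
    (hlim : ∀ u, Tendsto (fun v => F (nul u v)) atTop (𝓝 (G u))) :
    Tendsto (fun T => ∫ r in (T - b)..(T - a), F (T, r)) atTop (𝓝 (∫ u in a..b, G u)) := by
  have h1 (T : ℝ) : ∫ r in (T - b)..(T - a), F (T, r) = ∫ u in a..b, F (nul u (2 * T - u)) := by
    rw [← intervalIntegral.integral_comp_sub_left (fun r => F (T, r)) T]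
    simp only [pair_eq_nul]
  simp only [h1]
  obtain ⟨C, hC⟩ := hb a b (max b (-a) + 1) (by linarith [le_max_left b (-a)])
    (by linarith [le_max_right b (-a)])
  have hS := h.strip_subset a b (max b (-a) + 1) (by linarith [le_max_left b (-a)])
    (by linarith [le_max_right b (-a)])
  have hm : ∀ᶠ T : ℝ in atTop, ∀ u ∈ Icc a b, nul u (2 * T - u) ∈ strip a b (max b (-a) + 1) := by
    filter_upwards [eventually_ge_atTop ((b + max b (-a) + 1) / 2)] with T hT u hu
    exact nul_mem_strip.2 ⟨hu, by linarith [hu.2]⟩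
  refine intervalIntegral.tendsto_integral_filter_of_dominated_convergence (fun _ => C) ?_ ?_
    intervalIntegrable_const ?_
  · filter_upwards [hm] with T hT
    refine ContinuousOn.aestronglyMeasurable ?_ measurableSet_uIoc
    rw [uIoc_of_le hab]
    refine hF.comp (by unfold nul; fun_prop) fun u hu => hS (hT u (Ioc_subset_Icc_self hu))
  · filter_upwards [hm] with T hT
    refine ae_of_all _ fun u hu => ?_
    rw [uIoc_of_le hab] at hu
    exact hC _ (hT u (Ioc_subset_Icc_self hu))
  · refine ae_of_all _ fun u _ => (hlim u).comp ?_
    exact tendsto_atTop_add_const_right atTop (-u) (tendsto_id.const_mul_atTop two_pos)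

lemma IsWave.tendsto_incoming (h : IsWave V V' U w) (hab : a ≤ b) {F : ℝ × ℝ → ℝ} {G : ℝ → ℝ}
    (hF : ContinuousOn F U) (hb : StripBdd F)
    (hlim : ∀ u, Tendsto (fun v => F (nul u v)) atTop (𝓝 (G u))) :
    Tendsto (fun v => ∫ u in a..b, F (nul u v)) atTop (𝓝 (∫ u in a..b, G u)) := by
  obtain ⟨C, hC⟩ := hb a b (max b (-a) + 1) (by linarith [le_max_left b (-a)])
    (by linarith [le_max_right b (-a)])
  have hS := h.strip_subset a b (max b (-a) + 1) (by linarith [le_max_left b (-a)])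
    (by linarith [le_max_right b (-a)])
  have hm : ∀ᶠ v : ℝ in atTop, ∀ u ∈ Icc a b, nul u v ∈ strip a b (max b (-a) + 1) := by
    filter_upwards [eventually_ge_atTop (max b (-a) + 1)] with v hv u hu
    exact nul_mem_strip.2 ⟨hu, hv⟩
  refine intervalIntegral.tendsto_integral_filter_of_dominated_convergence (fun _ => C) ?_ ?_
    intervalIntegrable_const ?_
  · filter_upwards [hm] with v hv
    refine ContinuousOn.aestronglyMeasurable ?_ measurableSet_uIoc
    rw [uIoc_of_le hab]
    refine hF.comp (by unfold nul; fun_prop) fun u hu => hS (hv u (Ioc_subset_Icc_self hu))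
  · filter_upwards [hm] with v hv
    refine ae_of_all _ fun u hu => ?_
    rw [uIoc_of_le hab] at hu
    exact hC _ (hv u (Ioc_subset_Icc_self hu))
  · exact ae_of_all _ fun u _ => hlim u

lemma V_div_le (h : IsWave V V' U w) {p : ℝ × ℝ} (hp : 0 < p.2) :
    |V (w p) / p.2| ≤ |w p * w p * (rho p * rho p)| := by
  have h1 := h.V_le (w p)
  have h2 := h.V_nonneg (w p)
  rw [← pow_two (rho p), rho_sq hp, abs_of_nonneg (by positivity), ← pow_two, div_eq_mul_inv,
    abs_of_nonneg (by positivity)]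
  gcongr

lemma IsWave.stripBdd_V (h : IsWave V V' U w) (hw : StripBdd w) :
    StripBdd (fun p => V (w p) / p.2) :=
  ((hw.mul hw).mul (stripBdd_rho.mul stripBdd_rho)).of_abs_le fun _ hp => V_div_le h hp

lemma IsWave.tendsto_V (h : IsWave V V' U w) (hw : StripBdd w) (u : ℝ) :
    Tendsto (fun v => V (w (nul u v)) / (nul u v).2) atTop (𝓝 0) := by
  have h1 := (tendsto_nul_of_stripBdd_mul_rho ((hw.mul hw).mul stripBdd_rho) u).abs
  rw [abs_zero] at h1
  refine squeeze_zero_norm' ?_ h1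
  filter_upwards [eventually_gt_atTop u] with v hv
  have h0 : 0 < (nul u v).2 := by simp only [nul]; linarith
  refine (V_div_le h h0).trans_eq ?_
  ring_nf

lemma IsWave.continuousOn_V (h : IsWave V V' U w) : ContinuousOn (fun p => V (w p) / p.2) U :=
  (h.contDiff_V.continuous.comp_continuousOn h.smooth.continuousOn).div continuousOn_snd
    fun p hp => (h.pos p hp).ne'

lemma IsWave.continuousOn_sqrt_dd (h : IsWave V V' U w) (v : ℝ × ℝ) :
    ContinuousOn (fun p => √p.2 * dd v w p) U :=
  (contDiffOn_sqrt_snd h.pos).continuousOn.mul (h.smooth.dd h.isOpen v).continuousOn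

variable {P : ℝ × ℝ → ℝ} {g : ℝ → ℝ}

/-- The energy flux through incoming null segments converges to the `L²` norm of the
radiation field. -/
lemma IsWave.tendsto_flux (h : IsWave V V' U w) (hw : StripBdd w) (hP : IsPotential V w U P)
    (hg : Continuous g) (hrad : RadLim (fun p => √p.2 * dd eN w p) g) (hab : a ≤ b) :
    Tendsto (fun v => P (nul a v) - P (nul b v)) atTop (𝓝 (2 * ∫ u in a..b, g u ^ 2)) := by
  set f : ℝ × ℝ → ℝ := fun p => √p.2 * dd eN w p with hf
  set F : ℝ × ℝ → ℝ := fun p => 2 * (f p * f p) + 1 / 2 * (V (w p) / p.2) with hF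
  have hfb := hrad.stripBdd hg
  have hfc := h.continuousOn_sqrt_dd eN
  have hFc : ContinuousOn F U :=
    ((hfc.mul hfc).const_mul 2).add (h.continuousOn_V.const_mul (1 / 2))
  have hFb : StripBdd F :=
    ((stripBdd_const 2).mul (hfb.mul hfb)).add ((stripBdd_const (1 / 2)).mul (h.stripBdd_V hw))
  have hlim : ∀ u, Tendsto (fun v => F (nul u v)) atTop (𝓝 (2 * g u ^ 2)) := by
    intro u
    have := (((hrad.tendsto u).mul (hrad.tendsto u)).const_mul 2).add
      ((h.tendsto_V hw u).const_mul (1 / 2))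
    simpa [F, pow_two] using this
  have key := h.tendsto_incoming hab hFc hFb hlim
  rw [intervalIntegral.integral_const_mul] at key
  refine key.congr' ?_
  filter_upwards [eventually_gt_atTop (max b (-a))] with v hv
  have hm : ∀ u ∈ Icc a b, nul u v ∈ U := fun u hu =>
    h.nul_mem (by linarith [hu.2, le_max_left b (-a)]) (by linarith [hu.1, le_max_right b (-a)])
  have hd : ∀ u ∈ uIcc a b, HasDerivAt (fun u => -P (nul u v)) (F (nul u v)) u := by
    intro u hu
    rw [uIcc_of_le hab] at hu
    have h0 := h.pos _ (hm u hu)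
    have := (hasDerivAt_along (γ := fun u => nul u v) (hP.differentiableAt (hm u hu))
      (hasDerivAt_nul_fst u v)).neg
    refine this.congr_deriv ?_
    rw [hP.eN_eq (hm u hu) h0]
    simp only [F, f]
    rw [show √(nul u v).2 * dd eN w (nul u v) * (√(nul u v).2 * dd eN w (nul u v))
      = (√(nul u v).2 * √(nul u v).2) * dd eN w (nul u v) ^ 2 by ring, Real.mul_self_sqrt h0.le]
    field_simp
  have hi : IntervalIntegrable (fun u => F (nul u v)) volume a b := by
    refine ContinuousOn.intervalIntegrable ?_
    rw [uIcc_of_le hab]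
    exact hFc.comp (by unfold nul; fun_prop) hm
  rw [intervalIntegral.integral_eq_sub_of_hasDerivAt hd hi]
  ring

/-- The energy in windows around the light cone is carried by the radiation field. -/
theorem IsWave.tendsto_window_energy (h : IsWave V V' U w) (hw : StripBdd w)
    (hP : IsPotential V w U P) (hg : Continuous g)
    (hrad : RadLim (fun p => √p.2 * dd eN w p) g) (hab : a ≤ b)
    (hbdd : ∃ B, ∀ᶠ v in atTop, P (nul a v) ≤ B) :
    Tendsto (fun T => ∫ r in (T - b)..(T - a), enD V w (T, r)) atTop
      (𝓝 (2 * ∫ u in a..b, g u ^ 2)) := by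
  have hflux := h.tendsto_flux hw hP hg hrad hab
  have hlim : ∃ L, Tendsto (fun v => P (nul a v)) atTop (𝓝 L) := by
    obtain ⟨B, hB⟩ := hbdd
    obtain ⟨v₁, hv₁⟩ := eventually_atTop.1 hB
    set v₀ := max v₁ (|a| + 1)
    have hmono : Monotone (fun v => P (nul a (max v v₀))) := by
      intro x y hxy
      refine hP.le_outgoing h.pos h.V_nonneg (max_le_max_right v₀ hxy) fun v hv => ?_
      have : |a| + 1 ≤ v := (le_max_right v₁ _).trans ((le_max_right x v₀).trans hv.1)
      exact h.nul_mem (by linarith [le_abs_self a]) (by linarith [neg_abs_le a])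
    refine ⟨_, (tendsto_atTop_ciSup hmono ⟨B, ?_⟩).congr' ?_⟩
    · rintro _ ⟨v, rfl⟩
      exact hv₁ _ ((le_max_left v₁ _).trans (le_max_right v v₀))
    · filter_upwards [eventually_ge_atTop v₀] with v hv
      rw [max_eq_left hv]
  obtain ⟨L, hL⟩ := hlim
  have hLb : Tendsto (fun v => P (nul b v)) atTop (𝓝 (L - 2 * ∫ u in a..b, g u ^ 2)) := by
    simpa using hL.sub hflux
  have t1 (c : ℝ) : Tendsto (fun T : ℝ => 2 * T - c) atTop atTop :=
    tendsto_atTop_add_const_right atTop (-c) (tendsto_id.const_mul_atTop two_pos)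
  have := (hL.comp (t1 a)).sub (hLb.comp (t1 b))
  rw [sub_sub_cancel] at this
  refine this.congr' ?_
  filter_upwards [eventually_gt_atTop (max b (b - a))] with T hT
  rw [hP.integral_eq h.isOpen h.pos h.contDiff_V h.smooth (by linarith), pair_eq_nul, pair_eq_nul]
  · rfl
  · intro r hr
    have h1 : T - (T - r) = r := by ring
    have hb := le_max_left b (b - a)
    have hba := le_max_right b (b - a)
    rw [← h1, pair_eq_nul]
    exact h.nul_mem (by linarith [hr.1]) (by linarith [hr.1, hr.2])

lemma IsWave.tendsto_window_incoming (h : IsWave V V' U w) (hg : Continuous g)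
    (hrad : RadLim (fun p => √p.2 * dd eN w p) g) (hab : a ≤ b) :
    Tendsto (fun T => ∫ r in (T - b)..(T - a), 2 * r * dd eN w (T, r) ^ 2) atTop
      (𝓝 (2 * ∫ u in a..b, g u ^ 2)) := by
  have hfb := hrad.stripBdd hg
  have hfc := h.continuousOn_sqrt_dd eN
  have := h.tendsto_window hab ((hfc.mul hfc).const_mul 2) ((stripBdd_const 2).mul (hfb.mul hfb))
    fun u => ((hrad.tendsto u).mul (hrad.tendsto u)).const_mul 2
  simp only [← pow_two, intervalIntegral.integral_const_mul] at this
  refine this.congr' ?_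
  filter_upwards [eventually_gt_atTop b] with T hT
  rw [← intervalIntegral.integral_const_mul]
  refine intervalIntegral.integral_congr fun r hr => ?_
  rw [uIcc_of_le (by linarith)] at hr
  have h0 : √r * √r = r := Real.mul_self_sqrt (by linarith [hr.1])
  simp only [Pi.pow_apply]
  linear_combination 2 * dd eN w (T, r) ^ 2 * h0

/-- The outgoing derivative carries no energy in windows around the light cone. -/
theorem IsWave.tendsto_window_outgoing (h : IsWave V V' U w) (hw : StripBdd w)
    (hP : IsPotential V w U P) (hg : Continuous g)
    (hrad : RadLim (fun p => √p.2 * dd eN w p) g) (hab : a ≤ b)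
    (hbdd : ∃ B, ∀ᶠ v in atTop, P (nul a v) ≤ B) :
    Tendsto (fun T => ∫ r in (T - b)..(T - a), 2 * r * dd eL w (T, r) ^ 2) atTop (𝓝 0) := by
  have h1 := (h.tendsto_window_energy hw hP hg hrad hab hbdd).sub
    (h.tendsto_window_incoming hg hrad hab)
  have h2 := h.tendsto_window hab h.continuousOn_V (h.stripBdd_V hw) (h.tendsto_V hw)
  have h3 := h1.sub h2
  simp only [sub_self, intervalIntegral.integral_zero] at h3
  refine h3.congr' ?_
  filter_upwards [eventually_gt_atTop (max b (b - a))] with T hT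
  have hbT := (le_max_left b (b - a)).trans_lt hT
  have hbaT := (le_max_right b (b - a)).trans_lt hT
  have hle : T - b ≤ T - a := by linarith
  have hm : ∀ r ∈ Icc (T - b) (T - a), (T, r) ∈ U := by
    intro r hr
    rw [← sub_sub_cancel T r, pair_eq_nul]
    exact h.nul_mem (by linarith [hr.1]) (by linarith [hr.1, hr.2])
  have hc {F : ℝ × ℝ → ℝ} (hF : ContinuousOn F U) :
      IntervalIntegrable (fun r => F (T, r)) volume (T - b) (T - a) := by
    refine ContinuousOn.intervalIntegrable ?_
    rw [uIcc_of_le hle]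
    exact hF.comp (by fun_prop) hm
  have hN : IntervalIntegrable (fun r => 2 * r * dd eN w (T, r) ^ 2) volume (T - b) (T - a) :=
    hc (F := fun p => 2 * p.2 * dd eN w p ^ 2)
      ((continuousOn_const.mul continuousOn_snd).mul ((h.smooth.dd h.isOpen eN).continuousOn.pow 2))
  have hE := hc (contDiffOn_enD h.isOpen h.pos h.contDiff_V h.smooth).continuousOn
  rw [← intervalIntegral.integral_sub hE hN, ← intervalIntegral.integral_sub (hE.sub hN)
    (hc h.continuousOn_V)]
  refine intervalIntegral.integral_congr fun r hr => ?_
  rw [uIcc_of_le hle] at hr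
  have h0 : (0 : ℝ) < r := h.pos _ (hm r hr)
  simp only [enD_eq_null (w := w) (V := V) (p := (T, r)) h0]
  ring

end Window

/-! ### Wave maps of degree one -/

/-- The quadrant of positive times and positive radii. -/
def quadrant : Set (ℝ × ℝ) := Ioi 0 ×ˢ Ioi 0

/-- The self-interaction of wave maps. -/
def sinSq (x : ℝ) : ℝ := Real.sin x ^ 2

/-- `w + π` is a wave map of degree one and energy `E`. -/
structure IsDegreeOne (w : ℝ × ℝ → ℝ) (E : ℝ) : Prop where
  isWave : IsWave sinSq (fun x => Real.sin (2 * x)) quadrant w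
  integrableOn : ∀ t, 0 < t → IntegrableOn (fun r => enD sinSq w (t, r)) (Ioi 0)
  energy_eq : ∀ t, 0 < t → ∫ r in Ioi (0 : ℝ), enD sinSq w (t, r) = E
  tendsto_zero : ∀ t, 0 < t → Tendsto (fun r => w (t, r)) (𝓝[>] 0) (𝓝 (-π))
  tendsto_atTop : ∀ t, 0 < t → Tendsto (fun r => w (t, r)) atTop (𝓝 0)

lemma strip_subset_quadrant {a b v₀ : ℝ} (hb : b < v₀) (ha : -a < v₀) :
    strip a b v₀ ⊆ quadrant := by
  rintro p ⟨⟨h1, h2⟩, h3⟩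
  constructor
  · change 0 < p.1; linarith
  · change 0 < p.2; linarith

lemma hasDerivAt_sinSq (x : ℝ) : HasDerivAt sinSq (Real.sin (2 * x)) x := by
  have := (Real.hasDerivAt_sin x).pow 2
  refine this.congr_deriv ?_
  rw [Real.sin_two_mul]
  norm_num

lemma isWave_of_isWaveMap {ψ : ℝ → ℝ → ℝ} (hwm : IsWaveMap ψ) :
    IsWave sinSq (fun x => Real.sin (2 * x)) quadrant (fun p => ψ p.1 p.2 - π) := by
  have hU : IsOpen quadrant := isOpen_Ioi.prod isOpen_Ioi
  have hψ : ContDiffOn ℝ ∞ (fun p : ℝ × ℝ => ψ p.1 p.2) quadrant :=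
    hwm.1.mono (prod_mono Ioi_subset_Ici_self Subset.rfl)
  have hw : ContDiffOn ℝ ∞ (fun p : ℝ × ℝ => ψ p.1 p.2 - π) quadrant := hψ.sub contDiffOn_const
  set w : ℝ × ℝ → ℝ := fun p => ψ p.1 p.2 - π with hwdef
  have hT : ∀ p ∈ quadrant, pT ψ p.1 p.2 = dd eT w p := fun p hp => by
    have := (hasDerivAt_time (t := p.1) (r := p.2)
      (hw.differentiableAt_of_isOpen hU hp)).add_const π
    simp only [hwdef, sub_add_cancel] at this
    exact this.deriv
  have hR : ∀ p ∈ quadrant, pR ψ p.1 p.2 = dd eR w p := fun p hp => by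
    have := (hasDerivAt_radial (t := p.1) (r := p.2)
      (hw.differentiableAt_of_isOpen hU hp)).add_const π
    simp only [hwdef, sub_add_cancel] at this
    exact this.deriv
  refine ⟨hU, (convex_Ioi _).prod (convex_Ioi _), fun p hp => hp.2,
    fun a b v₀ hb ha => strip_subset_quadrant hb ha, Real.contDiff_sin.pow 2,
    Real.contDiff_sin.comp (contDiff_const.mul contDiff_id), hasDerivAt_sinSq,
    fun x => sq_nonneg _, fun x => ?_, hw, fun p hp => ?_, fun S m hS hb => ?_⟩
  · rw [sinSq, ← sq_abs, ← sq_abs x]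
    have := Real.abs_sin_le_abs (x := x)
    gcongr
  · have h2 : deriv (fun s => pT ψ s p.2) p.1 = dd eT (dd eT w) p := by
      have h := (hasDerivAt_time (t := p.1) (r := p.2)
        ((hw.dd hU eT).differentiableAt_of_isOpen hU hp)).deriv
      rw [← h]
      refine Filter.EventuallyEq.deriv_eq ?_
      filter_upwards [isOpen_Ioi.mem_nhds (show p.1 ∈ Ioi (0 : ℝ) from hp.1)] with s hs
      exact hT (s, p.2) ⟨hs, hp.2⟩
    have h3 : deriv (fun ρ => pR ψ p.1 ρ) p.2 = dd eR (dd eR w) p := by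
      have h := (hasDerivAt_radial (t := p.1) (r := p.2)
        ((hw.dd hU eR).differentiableAt_of_isOpen hU hp)).deriv
      rw [← h]
      refine Filter.EventuallyEq.deriv_eq ?_
      filter_upwards [isOpen_Ioi.mem_nhds (show p.2 ∈ Ioi (0 : ℝ) from hp.2)] with s hs
      exact hR (p.1, s) ⟨hp.1, hs⟩
    have h := hwm.2 p.1 p.2 (le_of_lt hp.1) hp.2
    rw [h2, h3, hR p hp] at h
    have h4 : Real.sin (2 * w p) = Real.sin (2 * ψ p.1 p.2) := by
      rw [← Real.sin_sub_two_pi (2 * ψ p.1 p.2)]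
      congr 1
      simp only [hwdef]
      ring
    rw [h4]
    linarith [h, show 1 / p.2 * dd eR w p = dd eR w p / p.2 by ring]
  · exact (BdN.sin_cos hU hS (contDiffOn_const.mul hw) (BdN.const_mul hU hS 2 hw hb)).1

lemma eDen_eq_enD {ψ : ℝ → ℝ → ℝ} (hwm : IsWaveMap ψ) {t r : ℝ} (ht : 0 < t) (hr : 0 < r) :
    pT ψ t r = dd eT (fun p => ψ p.1 p.2 - π) (t, r) ∧
    pR ψ t r = dd eR (fun p => ψ p.1 p.2 - π) (t, r) ∧
    eDen ψ t r = enD sinSq (fun p => ψ p.1 p.2 - π) (t, r) := by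
  have h := isWave_of_isWaveMap hwm
  have hd := h.smooth.differentiableAt_of_isOpen h.isOpen (p := (t, r)) ⟨ht, hr⟩
  have h1 : pT ψ t r = dd eT (fun p => ψ p.1 p.2 - π) (t, r) := by
    have := (hasDerivAt_time hd).add_const π
    simp only [sub_add_cancel] at this
    exact this.deriv
  have h2 : pR ψ t r = dd eR (fun p => ψ p.1 p.2 - π) (t, r) := by
    have := (hasDerivAt_radial hd).add_const π
    simp only [sub_add_cancel] at this
    exact this.deriv
  refine ⟨h1, h2, ?_⟩
  rw [eDen, enD, h1, h2, sinSq, Real.sin_sub_pi, neg_sq]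

lemma isDegreeOne_of_isWaveMap {ψ : ℝ → ℝ → ℝ} (hwm : IsWaveMap ψ) (hfe : FiniteEnergy ψ)
    (hcons : EnergyConserved ψ) (hbc : DegreeOneBC ψ) :
    IsDegreeOne (fun p => ψ p.1 p.2 - π) (totE ψ 0) where
  isWave := isWave_of_isWaveMap hwm
  integrableOn t ht := (hfe t ht.le).congr_fun (fun _ hr => (eDen_eq_enD hwm ht hr).2.2)
    measurableSet_Ioi
  energy_eq t ht := by
    rw [← hcons t ht.le, totE]
    exact setIntegral_congr_fun measurableSet_Ioi fun _ hr => (eDen_eq_enD hwm ht hr).2.2.symm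
  tendsto_zero t ht := by simpa using (hbc t ht.le).1.sub_const π
  tendsto_atTop t ht := by simpa using (hbc t ht.le).2.sub_const π

section DegreeOne

variable {w : ℝ × ℝ → ℝ} {E : ℝ}

lemma IsDegreeOne.enD_nonneg (h : IsDegreeOne w E) {t r : ℝ} (hr : 0 < r) :
    0 ≤ enD sinSq w (t, r) :=
  _root_.enD_nonneg h.isWave.V_nonneg (p := (t, r)) hr.le

lemma IsDegreeOne.hasDerivAt_radial (h : IsDegreeOne w E) {t r : ℝ} (ht : 0 < t) (hr : 0 < r) :
    HasDerivAt (fun r => w (t, r)) (dd eR w (t, r)) r :=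
  _root_.hasDerivAt_radial
    (h.isWave.smooth.differentiableAt_of_isOpen h.isWave.isOpen (p := (t, r)) ⟨ht, hr⟩)

lemma IsDegreeOne.continuousOn_enD (h : IsDegreeOne w E) {t : ℝ} (ht : 0 < t) :
    ContinuousOn (fun r => enD sinSq w (t, r)) (Ioi 0) :=
  (contDiffOn_enD h.isWave.isOpen h.isWave.pos h.isWave.contDiff_V
    h.isWave.smooth).continuousOn.comp (by fun_prop) fun _ hr => ⟨ht, hr⟩

lemma IsDegreeOne.setIntegral_mono (h : IsDegreeOne w E) {t : ℝ} (ht : 0 < t) {S T : Set ℝ}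
    (hST : S ⊆ T) (hT : T ⊆ Ioi 0) (hTm : MeasurableSet T) :
    ∫ r in S, enD sinSq w (t, r) ≤ ∫ r in T, enD sinSq w (t, r) := by
  refine MeasureTheory.setIntegral_mono_set ((h.integrableOn t ht).mono_set hT) ?_
    (ae_of_all _ hST)
  exact (ae_restrict_iff' hTm).2 (ae_of_all _ fun r hr => h.enD_nonneg (hT hr))

lemma IsDegreeOne.intervalIntegral_le (h : IsDegreeOne w E) {t r₁ r₂ : ℝ} (ht : 0 < t)
    {T : Set ℝ} (h12 : r₁ ≤ r₂) (hST : Ioc r₁ r₂ ⊆ T) (hT : T ⊆ Ioi 0) (hTm : MeasurableSet T) :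
    ∫ r in r₁..r₂, enD sinSq w (t, r) ≤ ∫ r in T, enD sinSq w (t, r) := by
  rw [intervalIntegral.integral_of_le h12]
  exact h.setIntegral_mono ht hST hT hTm

lemma abs_sub_le_integral {f f' e : ℝ → ℝ} {a b : ℝ} (hab : a ≤ b)
    (hf : ∀ x ∈ Icc a b, HasDerivAt f (f' x) x) (he : ContinuousOn e (Icc a b))
    (hle : ∀ x ∈ Icc a b, |f' x| ≤ e x) : |f b - f a| ≤ ∫ x in a..b, e x := by
  refine norm_sub_le_integral_of_norm_deriv_le_of_le hab
    (fun x hx => (hf x hx).continuousAt.continuousWithinAt)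
    (fun x hx => (hf x (Ioo_subset_Icc_self hx)).differentiableAt.differentiableWithinAt)
    (ae_of_all _ fun x hx => ?_) ?_
  · rw [(hf x (Ioo_subset_Icc_self hx)).deriv]
    exact hle x (Ioo_subset_Icc_self hx)
  · refine ContinuousOn.intervalIntegrable ?_
    rwa [uIcc_of_le hab]

/-- The energy controls the variation of `cos w`. -/
lemma IsDegreeOne.abs_cos_sub_le (h : IsDegreeOne w E) {t r₁ r₂ : ℝ} (ht : 0 < t) (hr : 0 < r₁)
    (h12 : r₁ ≤ r₂) :
    |Real.cos (w (t, r₂)) - Real.cos (w (t, r₁))| ≤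
      1 / 2 * ∫ r in r₁..r₂, enD sinSq w (t, r) := by
  rw [← intervalIntegral.integral_const_mul]
  refine abs_sub_le_integral (f := fun r => Real.cos (w (t, r))) h12
    (fun r hr' => (h.hasDerivAt_radial ht (hr.trans_le hr'.1)).cos)
    (((h.continuousOn_enD ht).mono fun r hr' => hr.trans_le hr'.1).const_mul (1 / 2))
    fun r hr' => ?_
  have h0 : 0 < r := hr.trans_le hr'.1
  have e : enD sinSq w (t, r) = dd eT w (t, r) ^ 2 * r + (r * dd eR w (t, r) ^ 2
      + Real.sin (w (t, r)) ^ 2 / r) := by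
    simp only [enD, sinSq]; field_simp; ring
  rw [e, abs_mul, abs_neg]
  have h1 : 0 ≤ dd eT w (t, r) ^ 2 * r := by positivity
  have h2 : 2 * (|Real.sin (w (t, r))| * |dd eR w (t, r)|)
      ≤ r * dd eR w (t, r) ^ 2 + Real.sin (w (t, r)) ^ 2 / r := by
    have h3 := sq_nonneg (r * |dd eR w (t, r)| - |Real.sin (w (t, r))|)
    rw [← sq_abs (dd eR w (t, r)), ← sq_abs (Real.sin (w (t, r)))]
    have h4 : r * |dd eR w (t, r)| ^ 2 + |Real.sin (w (t, r))| ^ 2 / r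
      = (r ^ 2 * |dd eR w (t, r)| ^ 2 + |Real.sin (w (t, r))| ^ 2) / r := by field_simp
    rw [h4, le_div_iff₀ h0]
    linarith
  linarith

/-- The energy controls the variation of `w` at large radii. -/
lemma IsDegreeOne.abs_sub_le (h : IsDegreeOne w E) {t r₁ r₂ : ℝ} (ht : 0 < t) (hr : 0 < r₁)
    (h12 : r₁ ≤ r₂) : |w (t, r₂) - w (t, r₁)| ≤ (E + (r₂ - r₁)) / (2 * √r₁) := by
  have hs := Real.sqrt_pos.2 hr
  have hss := Real.mul_self_sqrt hr.le
  have hc := (h.continuousOn_enD ht).mono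
    (show Icc r₁ r₂ ⊆ Ioi 0 from fun r hr' => hr.trans_le hr'.1)
  have h1 := abs_sub_le_integral (f := fun r => w (t, r))
    (e := fun r => (1 / (2 * √r₁)) * (enD sinSq w (t, r) + 1)) h12
    (fun r hr' => h.hasDerivAt_radial ht (hr.trans_le hr'.1))
    ((hc.add continuousOn_const).const_mul _) fun r hr' => by
      have h0 : 0 < r := hr.trans_le hr'.1
      have e : r * dd eR w (t, r) ^ 2 ≤ enD sinSq w (t, r) := by
        have : enD sinSq w (t, r) = dd eT w (t, r) ^ 2 * r + r * dd eR w (t, r) ^ 2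
          + Real.sin (w (t, r)) ^ 2 / r := by simp only [enD, sinSq]; field_simp
        rw [this]
        have h1 : 0 ≤ dd eT w (t, r) ^ 2 * r := by positivity
        have h2 : 0 ≤ Real.sin (w (t, r)) ^ 2 / r := by positivity
        linarith
      rw [one_div_mul_eq_div, le_div_iff₀ (by positivity)]
      have h3 := sq_nonneg (√r₁ * |dd eR w (t, r)| - 1)
      have h4 : r₁ * dd eR w (t, r) ^ 2 ≤ r * dd eR w (t, r) ^ 2 := by
        gcongr
        exact hr'.1
      have h5 : (√r₁ * |dd eR w (t, r)|) ^ 2 = r₁ * dd eR w (t, r) ^ 2 := by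
        rw [mul_pow, sq_abs, Real.sq_sqrt hr.le]
      nlinarith
  refine h1.trans ?_
  have hi : IntervalIntegrable (fun r => enD sinSq w (t, r)) volume r₁ r₂ := by
    refine ContinuousOn.intervalIntegrable ?_
    rwa [uIcc_of_le h12]
  rw [intervalIntegral.integral_const_mul, intervalIntegral.integral_add hi (by simp),
    one_div_mul_eq_div]
  have h2 := h.intervalIntegral_le ht h12 (T := Ioi 0) (fun r hr' => hr.trans hr'.1) Subset.rfl
    measurableSet_Ioi
  rw [h.energy_eq t ht] at h2
  gcongr
  simp

/-- The energy outside of an outgoing light cone is nonincreasing. -/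
lemma IsDegreeOne.exterior_le (h : IsDegreeOne w E) {s t R : ℝ} (hs : 0 < s) (hst : s ≤ t)
    (hR : 0 < s + R) :
    ∫ r in Ioi (t + R), enD sinSq w (t, r) ≤ ∫ r in Ioi (s + R), enD sinSq w (s, r) := by
  obtain ⟨P, hP⟩ := h.isWave.exists_potential
  have hW := h.isWave
  have ht := hs.trans_le hst
  have hlim := intervalIntegral_tendsto_integral_Ioi (t + R)
    ((h.integrableOn t ht).mono_set (Ioi_subset_Ioi (by linarith : (0 : ℝ) ≤ t + R))) tendsto_id
  refine le_of_tendsto hlim ?_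
  filter_upwards [eventually_ge_atTop (t + R)] with r₂ hr₂
  have hle : s + R ≤ r₂ + t - s := by linarith
  have h1 := h.intervalIntegral_le hs hle (T := Ioi (s + R)) (fun r hr => hr.1)
    (Ioi_subset_Ioi hR.le) measurableSet_Ioi
  refine le_trans ?_ h1
  rw [id, hP.integral_eq hW.isOpen hW.pos hW.contDiff_V hW.smooth hr₂
    fun r hr => ⟨ht, show 0 < r by linarith [hr.1]⟩,
    hP.integral_eq hW.isOpen hW.pos hW.contDiff_V hW.smooth hle
    fun r hr => ⟨hs, show 0 < r by linarith [hr.1]⟩]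
  have h2 : P (s, s + R) ≤ P (t, t + R) := by
    rw [← nul_self s, ← nul_self t, show t - (t + R) = s - (s + R) by ring]
    refine hP.le_outgoing hW.pos hW.V_nonneg (by linarith) fun v hv => ?_
    exact ⟨show 0 < (v + _) / 2 by linarith [hv.1], show 0 < (v - _) / 2 by linarith [hv.1]⟩
  have h3 : P (t, r₂) ≤ P (s, r₂ + t - s) := by
    rw [← nul_self t r₂, ← nul_self s (r₂ + t - s), show s + (r₂ + t - s) = t + r₂ by ring]
    refine hP.le_incoming hW.pos hW.V_nonneg (by linarith) fun u hu => ?_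
    exact ⟨show 0 < (_ + u) / 2 by linarith [hu.1], show 0 < (_ - u) / 2 by linarith [hu.2]⟩
  linarith

lemma IsDegreeOne.tendsto_exterior (h : IsDegreeOne w E) {s : ℝ} (hs : 0 < s) :
    Tendsto (fun R => ∫ r in Ioi (s + R), enD sinSq w (s, r)) atTop (𝓝 0) := by
  have h0 := h.integrableOn s hs
  have hlim := (intervalIntegral_tendsto_integral_Ioi 0 h0
    (tendsto_atTop_add_const_left atTop s tendsto_id)).const_sub
    (∫ r in Ioi (0 : ℝ), enD sinSq w (s, r))
  rw [sub_self] at hlim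
  refine hlim.congr' ?_
  filter_upwards [eventually_ge_atTop 0] with R hR
  have hsR : 0 ≤ s + R := by linarith
  simp only [id]
  rw [intervalIntegral.integral_of_le hsR, ← Ioc_union_Ioi_eq_Ioi hsR,
    setIntegral_union (Ioc_disjoint_Ioi le_rfl) measurableSet_Ioi
      (h0.mono_set Ioc_subset_Ioi_self) (h0.mono_set (Ioi_subset_Ioi hsR))]
  ring

lemma IsDegreeOne.one_sub_cos_le (h : IsDegreeOne w E) {t r : ℝ} (ht : 0 < t) (hr : 0 < r) :
    1 - Real.cos (w (t, r)) ≤ 1 / 2 * ∫ r in Ioi r, enD sinSq w (t, r) := by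
  have h1 : Tendsto (fun r₂ => Real.cos (w (t, r₂)) - Real.cos (w (t, r))) atTop
      (𝓝 (1 - Real.cos (w (t, r)))) := by
    simpa using ((Real.continuous_cos.tendsto 0).comp (h.tendsto_atTop t ht)).sub_const
      (Real.cos (w (t, r)))
  refine le_of_tendsto h1 ?_
  filter_upwards [eventually_ge_atTop r] with r₂ hr₂
  have h2 := h.intervalIntegral_le ht hr₂ (T := Ioi r) Ioc_subset_Ioi_self
    (Ioi_subset_Ioi hr.le) measurableSet_Ioi
  have := (le_abs_self _).trans (h.abs_cos_sub_le ht hr hr₂)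
  linarith

lemma IsDegreeOne.one_add_cos_le (h : IsDegreeOne w E) {t r : ℝ} (ht : 0 < t) (hr : 0 < r) :
    1 + Real.cos (w (t, r)) ≤ 1 / 2 * ∫ r in Ioc 0 r, enD sinSq w (t, r) := by
  have h1 : Tendsto (fun r₁ => Real.cos (w (t, r)) - Real.cos (w (t, r₁))) (𝓝[>] 0)
      (𝓝 (1 + Real.cos (w (t, r)))) := by
    have := ((Real.continuous_cos.tendsto (-π)).comp (h.tendsto_zero t ht)).const_sub
      (Real.cos (w (t, r)))
    simpa [add_comm] using this
  refine le_of_tendsto h1 ?_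
  filter_upwards [Ioc_mem_nhdsGT hr] with r₁ hr₁
  have h2 := h.intervalIntegral_le ht hr₁.2 (T := Ioc 0 r) (Ioc_subset_Ioc_left hr₁.1.le)
    Ioc_subset_Ioi_self measurableSet_Ioc
  have := (le_abs_self _).trans (h.abs_cos_sub_le ht hr₁.1 hr₁.2)
  linarith

/-- Small exterior energy keeps `w` close to its value `0` at infinity. -/
lemma IsDegreeOne.abs_lt_pi_div_two (h : IsDegreeOne w E) {t r : ℝ} (ht : 0 < t) (hr : 0 < r)
    (hE : ∫ r in Ioi r, enD sinSq w (t, r) < 2) : |w (t, r)| < π / 2 := by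
  have hcos : ∀ x ∈ Ici r, 0 < Real.cos (w (t, x)) := by
    intro x hx
    have h1 := h.one_sub_cos_le ht (hr.trans_le hx)
    have h2 := h.setIntegral_mono ht (S := Ioi x) (T := Ioi r) (Ioi_subset_Ioi hx)
      (Ioi_subset_Ioi hr.le) measurableSet_Ioi
    linarith
  by_contra hcon
  rw [not_lt] at hcon
  have hlim : Tendsto (fun x => |w (t, x)|) atTop (𝓝 0) := by
    simpa using (h.tendsto_atTop t ht).abs
  obtain ⟨x, hx1, hx2⟩ := ((hlim.eventually (gt_mem_nhds (show (0 : ℝ) < π / 2 by positivity))).and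
    (eventually_ge_atTop r)).exists
  have hc : ContinuousOn (fun x => |w (t, x)|) (Icc r x) := fun y hy =>
    (h.hasDerivAt_radial ht (hr.trans_le hy.1)).continuousAt.abs.continuousWithinAt
  obtain ⟨y, hy, hy'⟩ := intermediate_value_Icc' hx2 hc ⟨hx1.le, hcon⟩
  have := hcos y hy.1
  rw [← Real.cos_abs] at this
  simp only at hy'
  rw [hy', Real.cos_pi_div_two] at this
  exact this.false

lemma IsDegreeOne.sq_le (h : IsDegreeOne w E) {t r : ℝ} (ht : 0 < t) (hr : 0 < r)
    (hE : ∫ r in Ioi r, enD sinSq w (t, r) < 2) :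
    w (t, r) ^ 2 ≤ π ^ 2 / 4 * sinSq (w (t, r)) := by
  have h1 := (h.abs_lt_pi_div_two ht hr hE).le
  have h2 := Real.mul_abs_le_abs_sin h1
  have h3 : |w (t, r)| ≤ π / 2 * |Real.sin (w (t, r))| := by
    rw [div_mul_eq_mul_div, div_le_iff₀ Real.pi_pos] at h2
    linarith
  rw [sinSq, ← sq_abs, ← sq_abs (Real.sin _)]
  calc |w (t, r)| ^ 2 ≤ (π / 2 * |Real.sin (w (t, r))|) ^ 2 := by gcongr
    _ = π ^ 2 / 4 * |Real.sin (w (t, r))| ^ 2 := by ring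

lemma IsDegreeOne.sq_le_exterior (h : IsDegreeOne w E) {t r : ℝ} (ht : 0 < t) (hr : 0 < r)
    (hE : ∫ r in Ioi r, enD sinSq w (t, r) < 2) :
    w (t, r) ^ 2 ≤ π ^ 2 / 4 * ∫ r in Ioi r, enD sinSq w (t, r) := by
  have h1 := (h.abs_lt_pi_div_two ht hr hE).le
  have h2 := Real.cos_le_one_sub_mul_cos_sq (h1.trans (by linarith [Real.pi_pos]))
  have h3 := h.one_sub_cos_le ht hr
  have h4 : 2 / π ^ 2 * w (t, r) ^ 2 ≤ 1 / 2 * ∫ r in Ioi r, enD sinSq w (t, r) := by linarith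
  rw [div_mul_eq_mul_div, div_le_iff₀ (by positivity)] at h4
  linarith

lemma IsDegreeOne.stripBdd (h : IsDegreeOne w E) : StripBdd w := by
  intro a b v₀ hb ha
  set s := (a + v₀) / 2 with hs_def
  have hs : 0 < s := by simp only [hs_def]; linarith
  obtain ⟨R, hR1, hR2⟩ := (((h.tendsto_exterior hs).eventually (gt_mem_nhds two_pos)).and
    (eventually_ge_atTop (max 0 (-a)))).exists
  have hR0 := (le_max_left 0 (-a)).trans hR2
  have hRa := (le_max_right 0 (-a)).trans hR2
  have hpos : 0 < (v₀ - b) / 2 := by linarith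
  refine ⟨π / 2 + (E + (b + R)) / (2 * √((v₀ - b) / 2)), fun p hp => ?_⟩
  obtain ⟨⟨h1, h2⟩, h3⟩ := hp
  have hsp : s ≤ p.1 := by simp only [hs_def]; linarith
  have ht := hs.trans_le hsp
  have hr : (v₀ - b) / 2 ≤ p.2 := by linarith
  have hE0 : 0 ≤ E := by
    rw [← h.energy_eq _ ht]
    exact setIntegral_nonneg measurableSet_Ioi fun r hr => h.enD_nonneg hr
  have e1 := h.abs_sub_le ht (hpos.trans_le hr) (show p.2 ≤ p.1 + R by linarith)
  have e2 := h.abs_lt_pi_div_two ht (r := p.1 + R) (by linarith)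
    ((h.exterior_le hs hsp (by linarith)).trans_lt hR1)
  have e3 : (E + (p.1 + R - p.2)) / (2 * √p.2) ≤ (E + (b + R)) / (2 * √((v₀ - b) / 2)) := by
    have : 0 < √((v₀ - b) / 2) := Real.sqrt_pos.2 hpos
    have hbR : 0 ≤ b + R := by linarith
    gcongr ?_ / (2 * √?_)
    linarith
  have e4 := abs_sub_abs_le_abs_sub (w (p.1, p.2)) (w (p.1, p.1 + R))
  rw [abs_sub_comm] at e4
  simp only [Prod.mk.eta] at e1 e4
  linarith

/-- `w` vanishes asymptotically along outgoing light cones. -/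
lemma IsDegreeOne.tendsto_cone (h : IsDegreeOne w E) (b : ℝ) :
    Tendsto (fun t => w (t, t - b)) atTop (𝓝 0) := by
  rw [Metric.tendsto_nhds]
  intro ε hε
  have h1 : Tendsto (fun R => π ^ 2 / 4 * ∫ r in Ioi (1 + R), enD sinSq w (1, r)) atTop (𝓝 0) := by
    simpa using (h.tendsto_exterior one_pos).const_mul (π ^ 2 / 4)
  obtain ⟨R, ⟨hR1, hR2⟩, hR3⟩ := (((h.tendsto_exterior one_pos).eventually
    (gt_mem_nhds two_pos)).and (h1.eventually (gt_mem_nhds (show 0 < (ε / 2) ^ 2 by positivity)))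
    |>.and (eventually_ge_atTop (max 0 (-b)))).exists
  have hR0 := (le_max_left 0 (-b)).trans hR3
  have hRb := (le_max_right 0 (-b)).trans hR3
  have h2 : Tendsto (fun t : ℝ => (E + (b + R)) / (2 * √(t - b))) atTop (𝓝 0) :=
    Tendsto.div_atTop tendsto_const_nhds ((Real.tendsto_sqrt_atTop.comp
      (tendsto_atTop_add_const_right atTop (-b) tendsto_id)).const_mul_atTop two_pos)
  filter_upwards [h2.eventually (gt_mem_nhds (half_pos hε)), eventually_ge_atTop 1,
    eventually_gt_atTop b] with t ht1 ht2 ht3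
  have ht : 0 < t := by linarith
  have hx := h.exterior_le one_pos ht2 (R := R) (by linarith)
  have e1 := h.abs_sub_le ht (r₁ := t - b) (r₂ := t + R) (by linarith) (by linarith)
  rw [show t + R - (t - b) = b + R by ring] at e1
  have e2 := h.sq_le_exterior ht (r := t + R) (by linarith) (hx.trans_lt hR1)
  have e3 : |w (t, t + R)| < ε / 2 := by
    refine abs_lt_of_sq_lt_sq (e2.trans_lt (lt_of_le_of_lt ?_ hR2)) (by positivity)
    gcongr
  have e4 := abs_sub_abs_le_abs_sub (w (t, t - b)) (w (t, t + R))
  rw [abs_sub_comm] at e4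
  rw [dist_zero_right, Real.norm_eq_abs]
  linarith

lemma IsDegreeOne.potential_bdd (h : IsDegreeOne w E) {P : ℝ × ℝ → ℝ}
    (hP : IsPotential sinSq w quadrant P) (a : ℝ) : ∃ B, ∀ᶠ v in atTop, P (nul a v) ≤ B := by
  have hW := h.isWave
  refine ⟨P (1, 1) + E, ?_⟩
  filter_upwards [eventually_ge_atTop (2 - a), eventually_ge_atTop 2, eventually_gt_atTop a]
    with v h1 h2 h3
  have e1 : P (nul a v) ≤ P (nul (2 - v) v) := by
    refine hP.le_incoming hW.pos hW.V_nonneg (by linarith) fun u hu => ?_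
    exact ⟨show 0 < (v + u) / 2 by linarith [hu.1], show 0 < (v - u) / 2 by linarith [hu.2]⟩
  have e2 : nul (2 - v) v = (1, v - 1) := by simp only [nul, Prod.mk.injEq]; constructor <;> ring
  have hle : 1 ≤ v - 1 := by linarith
  have e3 := hP.integral_eq hW.isOpen hW.pos hW.contDiff_V hW.smooth hle (t := 1)
    fun r hr => ⟨show (0 : ℝ) < 1 from one_pos, show 0 < r by linarith [hr.1]⟩
  have e4 := h.intervalIntegral_le one_pos hle (T := Ioi 0)
    (fun r hr => lt_trans one_pos hr.1) Subset.rfl measurableSet_Ioi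
  rw [h.energy_eq 1 one_pos] at e4
  rw [e2] at e1
  linarith

/-- The radiation field carries at most the energy in excess of the ground state energy. -/
theorem IsDegreeOne.integral_sq_le (h : IsDegreeOne w E) {g : ℝ → ℝ} (hg : Continuous g)
    (hrad : RadLim (fun p => √p.2 * dd eN w p) g) {a b : ℝ} (hab : a ≤ b) :
    2 * ∫ u in a..b, g u ^ 2 ≤ E - 4 := by
  obtain ⟨P, hP⟩ := h.isWave.exists_potential
  have h1 := h.isWave.tendsto_window_energy h.stripBdd hP hg hrad hab (h.potential_bdd hP a)
  have h2 : Tendsto (fun t => 2 * (1 + Real.cos (w (t, t - b)))) atTop (𝓝 4) := by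
    have := (((Real.continuous_cos.tendsto 0).comp (h.tendsto_cone b)).const_add 1).const_mul 2
    rw [Real.cos_zero] at this
    norm_num at this
    exact this
  have h3 := h1.add h2
  have h4 : 2 * (∫ u in a..b, g u ^ 2) + 4 ≤ E := by
    refine le_of_tendsto h3 ?_
    filter_upwards [eventually_gt_atTop (max 0 b)] with t ht
    have ht0 := (le_max_left 0 b).trans_lt ht
    have htb := (le_max_right 0 b).trans_lt ht
    have e1 := h.one_add_cos_le ht0 (r := t - b) (by linarith)
    have hle : t - b ≤ t - a := by linarith
    have e2 := h.intervalIntegral_le ht0 hle (T := Ioi (t - b)) Ioc_subset_Ioi_self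
      (Ioi_subset_Ioi (by linarith)) measurableSet_Ioi
    have h0 := h.integrableOn t ht0
    have htb' : 0 ≤ t - b := by linarith
    have e3 := h.energy_eq t ht0
    rw [← Ioc_union_Ioi_eq_Ioi htb', setIntegral_union (Ioc_disjoint_Ioi le_rfl) measurableSet_Ioi
      (h0.mono_set Ioc_subset_Ioi_self) (h0.mono_set (Ioi_subset_Ioi htb'))] at e3
    linarith
  linarith

end DegreeOne

/-- A continuous function with bounded `L²` norms on bounded intervals is square integrable. -/
lemma integrable_sq_of_interval_le {g : ℝ → ℝ} (hg : Continuous g) {K : ℝ}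
    (h : ∀ a b, a ≤ b → 2 * ∫ u in a..b, g u ^ 2 ≤ K) :
    Integrable (fun u => g u ^ 2) ∧ 2 * ∫ u, g u ^ 2 ≤ K := by
  have hc : Continuous fun u => g u ^ 2 := hg.pow 2
  have hn : Tendsto (fun n : ℕ => -(n : ℝ)) atTop atBot :=
    tendsto_neg_atTop_atBot.comp tendsto_natCast_atTop_atTop
  have hle (n : ℕ) : -(n : ℝ) ≤ n := by linarith [n.cast_nonneg (α := ℝ)]
  have hi : Integrable (fun u => g u ^ 2) := by
    refine integrable_of_intervalIntegral_norm_bounded (K / 2) (l := atTop)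
      (a := fun n : ℕ => -(n : ℝ)) (b := fun n : ℕ => (n : ℝ)) (fun n => ?_) hn
      tendsto_natCast_atTop_atTop (Eventually.of_forall fun n => ?_)
    · exact hc.integrableOn_Ioc
    · have := h _ _ (hle n)
      simp only [norm_pow, Real.norm_eq_abs, sq_abs]
      linarith
  refine ⟨hi, ?_⟩
  have := (intervalIntegral_tendsto_integral hi hn tendsto_natCast_atTop_atTop).const_mul 2
  exact le_of_tendsto this (Eventually.of_forall fun n => h _ _ (hle n))

/-! ### Smooth parametric integrals and plane waves -/

section Parametric

variable {E : Type} [NormedAddCommGroup E] [NormedSpace ℝ E] [ProperSpace E]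

lemma hasFDerivAt_parametric {G : Type} [NormedAddCommGroup G] [NormedSpace ℝ G]
    {F : E × ℝ → G} (hF : ContDiff ℝ 1 F) (a b : ℝ) (x : E) :
    HasFDerivAt (fun x => ∫ s in a..b, F (x, s))
      (∫ s in a..b, (fderiv ℝ F (x, s)).comp (ContinuousLinearMap.inl ℝ E ℝ)) x := by
  have hF' : Continuous fun p : E × ℝ => (fderiv ℝ F p).comp (ContinuousLinearMap.inl ℝ E ℝ) :=
    (hF.continuous_fderiv one_ne_zero).clm_comp continuous_const
  obtain ⟨C, hC⟩ :=
    ((isCompact_closedBall x 1).prod (isCompact_uIcc (a := a) (b := b))).exists_bound_of_continuousOn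
    hF'.continuousOn
  refine intervalIntegral.hasFDerivAt_integral_of_dominated_of_fderiv_le (bound := fun _ => C)
    (F' := fun x s => (fderiv ℝ F (x, s)).comp (ContinuousLinearMap.inl ℝ E ℝ))
    (Metric.closedBall_mem_nhds x one_pos) ?_ ?_ ?_ ?_ (by simp) ?_
  · exact Eventually.of_forall fun y =>
      (hF.continuous.comp (Continuous.prodMk_right y)).aestronglyMeasurable
  · exact (hF.continuous.comp (Continuous.prodMk_right x)).intervalIntegrable _ _
  · exact (hF'.comp (Continuous.prodMk_right x)).aestronglyMeasurable
  · exact ae_of_all _ fun s hs y hy => hC (y, s) ⟨hy, uIoc_subset_uIcc hs⟩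
  · refine ae_of_all _ fun s _ y _ => ?_
    exact ((hF.differentiable one_ne_zero) (y, s)).hasFDerivAt.comp y
      (hasFDerivAt_prodMk_left y s)

lemma contDiff_parametric_nat (n : ℕ) : ∀ {G : Type} [NormedAddCommGroup G] [NormedSpace ℝ G]
    {F : E × ℝ → G}, ContDiff ℝ n F → ∀ a b : ℝ,
    ContDiff ℝ n fun x => ∫ s in a..b, F (x, s) := by
  induction n with
  | zero =>
    intro G _ _ F hF a b
    have hc := contDiff_zero.1 hF
    exact contDiff_zero.2
      (intervalIntegral.continuous_parametric_intervalIntegral_of_continuous'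
        (f := fun x s => F (x, s)) hc a b)
  | succ n ih =>
    intro G _ _ F hF a b
    have h1 : ContDiff ℝ 1 F := hF.of_le (by exact_mod_cast Nat.le_add_left 1 n)
    have h2 := fun x => hasFDerivAt_parametric h1 a b x
    rw [show ((n + 1 : ℕ) : WithTop ℕ∞) = (n : WithTop ℕ∞) + 1 by norm_cast] at hF ⊢
    refine (contDiff_succ_iff_hasFDerivAt).2 ⟨_, ?_, h2⟩
    exact ih (F := fun p => (fderiv ℝ F p).comp (ContinuousLinearMap.inl ℝ E ℝ))
      ((hF.fderiv_right le_rfl).clm_comp contDiff_const) a b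

lemma contDiff_parametric {F : E × ℝ → ℝ} (hF : ContDiff ℝ ∞ F) (a b : ℝ) :
    ContDiff ℝ ∞ fun x => ∫ s in a..b, F (x, s) :=
  contDiff_infty.2 fun n => contDiff_parametric_nat n (hF.of_le (by exact_mod_cast le_top)) a b

end Parametric

lemma dd_parametric {F : (ℝ × ℝ) × ℝ → ℝ} (hF : ContDiff ℝ ∞ F) (a b : ℝ) (v p : ℝ × ℝ) :
    dd v (fun p => ∫ s in a..b, F (p, s)) p = ∫ s in a..b, dd v (fun q => F (q, s)) p := by
  have h1 : ContDiff ℝ 1 F := hF.of_le (by simp)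
  have hF' : Continuous fun p : (ℝ × ℝ) × ℝ =>
      (fderiv ℝ F p).comp (ContinuousLinearMap.inl ℝ (ℝ × ℝ) ℝ) :=
    (h1.continuous_fderiv one_ne_zero).clm_comp continuous_const
  rw [dd, (hasFDerivAt_parametric h1 a b p).fderiv, ContinuousLinearMap.intervalIntegral_apply
    (φ := fun s => (fderiv ℝ F (p, s)).comp (ContinuousLinearMap.inl ℝ (ℝ × ℝ) ℝ))
    ((hF'.comp (Continuous.prodMk_right p)).intervalIntegrable _ _)]
  refine intervalIntegral.integral_congr fun s _ => ?_
  have := HasFDerivAt.comp (f := fun q : ℝ × ℝ => (q, s)) p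
    ((h1.differentiable one_ne_zero) (p, s)).hasFDerivAt (hasFDerivAt_prodMk_left p s)
  simp only [dd]
  erw [this.fderiv]

/-- Superposition of plane waves with profile `h` and angular weight `k`. -/
def planeWave (k h : ℝ → ℝ) (p : ℝ × ℝ) : ℝ :=
  ∫ θ in (0 : ℝ)..π, h (p.1 - p.2 * Real.cos θ) * k θ

section PlaneWave

variable {k h h' : ℝ → ℝ}

lemma contDiff_planeWave_integrand (hh : ContDiff ℝ ∞ h) (hk : ContDiff ℝ ∞ k) :
    ContDiff ℝ ∞ fun q : (ℝ × ℝ) × ℝ => h (q.1.1 - q.1.2 * Real.cos q.2) * k q.2 := by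
  have := Real.contDiff_cos (n := ∞)
  fun_prop

lemma contDiff_planeWave (hh : ContDiff ℝ ∞ h) (hk : ContDiff ℝ ∞ k) :
    ContDiff ℝ ∞ (planeWave k h) :=
  contDiff_parametric (contDiff_planeWave_integrand hh hk) 0 π

lemma dd_planeWave (hh : ContDiff ℝ ∞ h) (hk : ContDiff ℝ ∞ k) (hd : ∀ x, HasDerivAt h (h' x) x)
    (v : ℝ × ℝ) :
    dd v (planeWave k h) = planeWave (fun θ => (v.1 - v.2 * Real.cos θ) * k θ) h' := by
  funext p
  refine (dd_parametric (contDiff_planeWave_integrand hh hk) 0 π v p).trans ?_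
  refine intervalIntegral.integral_congr fun θ _ => ?_
  have h1 : HasFDerivAt (fun q : ℝ × ℝ => q.1 - q.2 * Real.cos θ)
      (ContinuousLinearMap.fst ℝ ℝ ℝ - Real.cos θ • ContinuousLinearMap.snd ℝ ℝ ℝ) p := by
    refine (hasFDerivAt_fst.sub (hasFDerivAt_snd.mul_const (Real.cos θ)))
  have h2 := ((hd (p.1 - p.2 * Real.cos θ)).comp_hasFDerivAt p h1).mul_const (k θ)
  simp only [dd]
  erw [h2.fderiv]
  simp
  ring

lemma hasDerivAt_planeWave_profile (hd : ∀ x, HasDerivAt h (h' x) x) (p : ℝ × ℝ) (θ : ℝ) :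
    HasDerivAt (fun θ => h (p.1 - p.2 * Real.cos θ))
      (h' (p.1 - p.2 * Real.cos θ) * (p.2 * Real.sin θ)) θ := by
  have h1 : HasDerivAt (fun θ => p.1 - p.2 * Real.cos θ) (p.2 * Real.sin θ) θ := by
    simpa using ((Real.hasDerivAt_cos θ).const_mul p.2).const_sub p.1
  exact (hd _).comp θ h1

/-- Integration by parts in the angular variable. -/
lemma planeWave_by_parts (hh' : Continuous h') (hd : ∀ x, HasDerivAt h (h' x) x)
    {k' : ℝ → ℝ} (hk' : Continuous k') (hk : ∀ x, HasDerivAt k (k' x) x)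
    (h0 : k 0 = 0) (hπ : k π = 0) (p : ℝ × ℝ) :
    planeWave k' h p = -(p.2 * planeWave (fun θ => Real.sin θ * k θ) h' p) := by
  have := intervalIntegral.integral_mul_deriv_eq_deriv_mul (a := 0) (b := π)
    (fun θ _ => hasDerivAt_planeWave_profile hd p θ) (fun θ _ => hk θ)
    (Continuous.intervalIntegrable (by fun_prop) _ _) (hk'.intervalIntegrable _ _)
  rw [h0, hπ] at this
  simp only [planeWave]
  rw [this, ← intervalIntegral.integral_const_mul]
  simp only [mul_zero, sub_zero, zero_sub]
  congr 2
  funext θ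
  ring

lemma continuous_planeWave_integrand (hh : Continuous h) (hk : Continuous k) (p : ℝ × ℝ) :
    Continuous fun θ => h (p.1 - p.2 * Real.cos θ) * k θ := by
  fun_prop

lemma planeWave_sub {k₁ k₂ : ℝ → ℝ} (hh : Continuous h) (h₁ : Continuous k₁) (h₂ : Continuous k₂)
    (p : ℝ × ℝ) : planeWave (fun θ => k₁ θ - k₂ θ) h p = planeWave k₁ h p - planeWave k₂ h p := by
  simp only [planeWave, mul_sub]
  exact intervalIntegral.integral_sub
    ((continuous_planeWave_integrand hh h₁ p).intervalIntegrable _ _)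
    ((continuous_planeWave_integrand hh h₂ p).intervalIntegrable _ _)

end PlaneWave

section LinearWave

variable {F f : ℝ → ℝ}

/-- The solution of the linear equation generated by the profile `F`. -/
def linWave (F : ℝ → ℝ) : ℝ × ℝ → ℝ := planeWave Real.cos F

lemma contDiff_linWave (hF : ContDiff ℝ ∞ F) : ContDiff ℝ ∞ (linWave F) :=
  contDiff_planeWave hF Real.contDiff_cos

lemma dd_linWave (hF : ContDiff ℝ ∞ F) (hd : ∀ x, HasDerivAt F (f x) x) (v : ℝ × ℝ) :
    dd v (linWave F) = planeWave (fun θ => (v.1 - v.2 * Real.cos θ) * Real.cos θ) f :=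
  dd_planeWave hF Real.contDiff_cos hd v

lemma linWave_eq (hf : Continuous f) (hd : ∀ x, HasDerivAt F (f x) x) (p : ℝ × ℝ) :
    linWave F p = -(p.2 * planeWave (fun θ => Real.sin θ * Real.sin θ) f p) :=
  planeWave_by_parts hf hd Real.continuous_cos Real.hasDerivAt_sin Real.sin_zero Real.sin_pi p

lemma linWave_equation (hF : ContDiff ℝ ∞ F) (hd : ∀ x, HasDerivAt F (f x) x) {p : ℝ × ℝ}
    (hp : 0 < p.2) :
    dd eT (dd eT (linWave F)) p - dd eR (dd eR (linWave F)) p - dd eR (linWave F) p / p.2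
      + 2 * linWave F p / (2 * p.2 ^ 2) = 0 := by
  have hf : ContDiff ℝ ∞ f := by
    have := (contDiff_infty_iff_deriv.1 hF).2
    rwa [show deriv F = f from funext fun x => (hd x).deriv] at this
  have hd' : ∀ x, HasDerivAt f (deriv f x) x := fun x =>
    (hf.differentiable (by simp) x).hasDerivAt
  have hc' : Continuous (deriv f) := ((contDiff_infty_iff_deriv.1 hf).2).continuous
  have hcos := Real.contDiff_cos (n := ∞)
  have hbp := planeWave_by_parts (h := f) (k := fun θ => Real.sin θ * Real.cos θ)
    (k' := fun θ => Real.cos θ * Real.cos θ - Real.sin θ * Real.sin θ) hc' hd' (by fun_prop)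
    (fun x => ((Real.hasDerivAt_sin x).mul (Real.hasDerivAt_cos x)).congr_deriv (by ring))
    (by simp) (by simp) p
  rw [planeWave_sub hf.continuous (by fun_prop) (by fun_prop)] at hbp
  have hR : dd eR (linWave F) p = -planeWave (fun θ => Real.cos θ * Real.cos θ) f p := by
    rw [dd_linWave hF hd]
    simp only [planeWave, ← intervalIntegral.integral_neg]
    congr 1; funext θ
    simp only [eR]; ring
  have h2 : dd eT (dd eT (linWave F)) p - dd eR (dd eR (linWave F)) p =
      planeWave (fun θ => Real.sin θ * (Real.sin θ * Real.cos θ)) (deriv f) p := by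
    rw [dd_linWave hF hd, dd_linWave hF hd, dd_planeWave hf (by fun_prop) hd',
      dd_planeWave hf (by fun_prop) hd', ← planeWave_sub hc' (by fun_prop) (by fun_prop)]
    congr 1; funext θ
    simp only [eR, eT]
    linear_combination -(Real.cos θ) * Real.sin_sq_add_cos_sq θ
  rw [h2, hR, linWave_eq hf.continuous hd]
  have : p.2 ≠ 0 := hp.ne'
  generalize planeWave (fun θ => Real.sin θ * (Real.sin θ * Real.cos θ)) (deriv f) p = X at hbp ⊢
  generalize planeWave (fun θ => Real.sin θ * Real.sin θ) f p = Y at hbp ⊢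
  generalize planeWave (fun θ => Real.cos θ * Real.cos θ) f p = Z at hbp ⊢
  field_simp
  linear_combination hbp

lemma isWave_linWave (hF : ContDiff ℝ ∞ F) (hd : ∀ x, HasDerivAt F (f x) x) :
    IsWave (fun x => x ^ 2) (fun x => 2 * x) (univ ×ˢ Ioi 0) (linWave F) where
  isOpen := isOpen_univ.prod isOpen_Ioi
  convex := convex_univ.prod (convex_Ioi _)
  pos _ hp := hp.2
  strip_subset a b v₀ hb ha := (strip_subset_quadrant hb ha).trans
    (prod_mono (subset_univ _) Subset.rfl)
  contDiff_V := contDiff_id.pow 2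
  contDiff_V' := contDiff_const.mul contDiff_id
  hasDerivAt_V x := by simpa using hasDerivAt_pow 2 x
  V_nonneg x := sq_nonneg x
  V_le x := le_rfl
  smooth := (contDiff_linWave hF).contDiffOn
  eq _ hp := linWave_equation hF hd hp.2
  bdN_V' _ _ hS hb := BdN.const_mul (isOpen_univ.prod isOpen_Ioi) hS 2
    (contDiff_linWave hF).contDiffOn hb

end LinearWave


/-! ### Convolution with tail kernels -/

/-- Smooth kernels supported in `[1, ∞)` with homogeneous tails. -/
structure IsTailKernel (κ : ℝ → ℝ) : Prop where
  contDiff : ContDiff ℝ ∞ κ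
  eq_zero : ∀ s < 1, κ s = 0
  tail : ∃ c α : ℝ, 1 ≤ α ∧ ∀ s > 2, κ s = c * s ^ (-α)

/-- A square integrable weight dominating all tail kernels. -/
def tailWeight (s : ℝ) : ℝ := (√(1 + s ^ 2))⁻¹

lemma continuous_tailWeight : Continuous tailWeight :=
  Continuous.inv₀ (by fun_prop) fun s => (Real.sqrt_pos.2 (by positivity)).ne'

lemma tailWeight_nonneg (s : ℝ) : 0 ≤ tailWeight s := by
  rw [tailWeight]; positivity

lemma tailWeight_sq (s : ℝ) : tailWeight s ^ 2 = (1 + s ^ 2)⁻¹ := by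
  rw [tailWeight, inv_pow, Real.sq_sqrt (by positivity)]

lemma tailWeight_le {s x : ℝ} (h : |s - x| ≤ 1) : tailWeight s ≤ 2 * tailWeight x := by
  have hs : 0 < √(1 + s ^ 2) := Real.sqrt_pos.2 (by positivity)
  have hx : 0 < √(1 + x ^ 2) := Real.sqrt_pos.2 (by positivity)
  rw [tailWeight, tailWeight, ← div_eq_mul_inv, inv_eq_one_div, div_le_div_iff₀ hs hx, one_mul,
    show (2 : ℝ) = √(2 ^ 2) by rw [Real.sqrt_sq two_pos.le], ← Real.sqrt_mul (by norm_num)]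
  refine Real.sqrt_le_sqrt ?_
  have := abs_le.1 h
  nlinarith [sq_nonneg (s + (s - x))]

lemma IsTailKernel.deriv {κ : ℝ → ℝ} (h : IsTailKernel κ) : IsTailKernel (deriv κ) := by
  obtain ⟨c, α, hα, hκ⟩ := h.tail
  refine ⟨(contDiff_infty_iff_deriv.1 h.contDiff).2, fun s hs => ?_,
    c * -α, α + 1, by linarith, fun s hs => ?_⟩
  · have : κ =ᶠ[𝓝 s] fun _ => 0 := by
      filter_upwards [isOpen_Iio.mem_nhds hs] with x hx using h.eq_zero x hx
    rw [this.deriv_eq, deriv_const]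
  · have : κ =ᶠ[𝓝 s] fun s => c * s ^ (-α) := by
      filter_upwards [isOpen_Ioi.mem_nhds hs] with x hx using hκ x hx
    rw [this.deriv_eq, ((Real.hasDerivAt_rpow_const (p := -α)
      (Or.inl (show s ≠ 0 by intro h; linarith))).const_mul c).deriv]
    ring_nf

lemma IsTailKernel.exists_bound {κ : ℝ → ℝ} (h : IsTailKernel κ) :
    ∃ C, 0 ≤ C ∧ ∀ s, |κ s| ≤ C * tailWeight s := by
  obtain ⟨c, α, hα, hκ⟩ := h.tail
  obtain ⟨M, hM⟩ := (isCompact_Icc (a := (1 : ℝ)) (b := 2)).exists_bound_of_continuousOn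
    h.contDiff.continuous.continuousOn
  have hM0 : 0 ≤ M := (norm_nonneg _).trans (hM 1 (by norm_num))
  refine ⟨3 * M + 2 * |c|, by positivity, fun s => ?_⟩
  have hw := tailWeight_nonneg s
  have hsq : 0 < √(1 + s ^ 2) := Real.sqrt_pos.2 (by positivity)
  rcases lt_or_ge s 1 with h1 | h1
  · rw [h.eq_zero s h1, abs_zero]; positivity
  rcases le_or_gt s 2 with h2 | h2
  · have h3 : 1 ≤ 3 * tailWeight s := by
      rw [tailWeight, ← div_eq_mul_inv, le_div_iff₀ hsq, one_mul]
      refine Real.sqrt_le_iff.2 ⟨by norm_num, by nlinarith⟩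
    have h4 := hM s ⟨h1, h2⟩
    rw [Real.norm_eq_abs] at h4
    nlinarith [abs_nonneg c, mul_nonneg (abs_nonneg c) hw]
  · rw [hκ s h2, abs_mul, abs_of_nonneg (Real.rpow_nonneg (by linarith) _)]
    have h3 : s ^ (-α) ≤ 2 * tailWeight s := by
      calc s ^ (-α) ≤ s ^ (-1 : ℝ) := Real.rpow_le_rpow_of_exponent_le h1 (by linarith)
        _ = s⁻¹ := Real.rpow_neg_one s
        _ ≤ 2 * tailWeight s := by
          rw [tailWeight, ← div_eq_mul_inv, inv_eq_one_div, div_le_div_iff₀ (by linarith) hsq,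
            one_mul]
          refine Real.sqrt_le_iff.2 ⟨by linarith, by nlinarith⟩
    calc |c| * s ^ (-α) ≤ |c| * (2 * tailWeight s) := by gcongr
      _ ≤ (3 * M + 2 * |c|) * tailWeight s := by nlinarith [mul_nonneg hM0 hw]

/-- Correlation of `g` with the kernel `κ`. -/
def tailConv (κ g : ℝ → ℝ) (u : ℝ) : ℝ := ∫ w, g w * κ (w - u)

section TailConv

variable {κ g : ℝ → ℝ}

lemma abs_mul_tailWeight_le (x s : ℝ) :
    |x| * tailWeight s ≤ (x ^ 2 + (1 + s ^ 2)⁻¹) / 2 := by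
  rw [← tailWeight_sq, ← sq_abs x]
  linarith [two_mul_le_add_sq |x| (tailWeight s)]

lemma integrable_abs_mul_tailWeight (hg : Continuous g) (hi : Integrable fun u => g u ^ 2)
    (u : ℝ) : Integrable fun w => |g w| * tailWeight (w - u) := by
  have h1 : Integrable fun w : ℝ => (g w ^ 2 + (1 + (w - u) ^ 2)⁻¹) / 2 :=
    (hi.add (integrable_inv_one_add_sq.comp_sub_right u)).div_const 2
  refine h1.mono' (hg.abs.mul (continuous_tailWeight.comp (by fun_prop))).aestronglyMeasurable
    (ae_of_all _ fun w => ?_)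
  rw [Real.norm_of_nonneg (mul_nonneg (abs_nonneg _) (tailWeight_nonneg _))]
  exact abs_mul_tailWeight_le _ _

lemma integral_abs_mul_tailWeight_le (hg : Continuous g) (hi : Integrable fun u => g u ^ 2)
    (u : ℝ) : ∫ w, |g w| * tailWeight (w - u) ≤ ((∫ w, g w ^ 2) + π) / 2 := by
  have h2 := integrable_inv_one_add_sq.comp_sub_right u
  refine (integral_mono (integrable_abs_mul_tailWeight hg hi u) ((hi.add h2).div_const 2)
    fun w => abs_mul_tailWeight_le _ _).trans_eq ?_
  simp only [Pi.add_apply]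
  rw [integral_div, integral_add hi h2, integral_sub_right_eq_self (fun x : ℝ => (1 + x ^ 2)⁻¹),
    integral_univ_inv_one_add_sq]

lemma IsTailKernel.norm_le {C : ℝ} (hC : ∀ s, |κ s| ≤ C * tailWeight s) (x s : ℝ) :
    ‖x * κ s‖ ≤ C * (|x| * tailWeight s) := by
  rw [norm_mul, Real.norm_eq_abs, Real.norm_eq_abs]
  calc |x| * |κ s| ≤ |x| * (C * tailWeight s) := by gcongr; exact hC s
    _ = _ := by ring

lemma IsTailKernel.integrable (h : IsTailKernel κ) (hg : Continuous g)
    (hi : Integrable fun u => g u ^ 2) (u : ℝ) : Integrable fun w => g w * κ (w - u) := by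
  obtain ⟨C, -, hC⟩ := h.exists_bound
  refine ((integrable_abs_mul_tailWeight hg hi u).const_mul C).mono' ?_
    (ae_of_all _ fun w => IsTailKernel.norm_le hC _ _)
  exact (hg.mul (h.contDiff.continuous.comp (by fun_prop))).aestronglyMeasurable

lemma IsTailKernel.exists_tailConv_bound (h : IsTailKernel κ) :
    ∃ C, 0 ≤ C ∧ ∀ g : ℝ → ℝ, Continuous g → Integrable (fun u => g u ^ 2) →
      ∀ u, |tailConv κ g u| ≤ C * ((∫ w, g w ^ 2) + π) := by
  obtain ⟨C, hC0, hC⟩ := h.exists_bound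
  refine ⟨C / 2, by positivity, fun g hg hi u => ?_⟩
  have h1 := norm_integral_le_of_norm_le ((integrable_abs_mul_tailWeight hg hi u).const_mul C)
    (ae_of_all _ fun w => IsTailKernel.norm_le hC (g w) (w - u))
  rw [integral_const_mul, Real.norm_eq_abs] at h1
  have h2 := integral_abs_mul_tailWeight_le hg hi u
  rw [tailConv]
  nlinarith

lemma IsTailKernel.hasDerivAt_tailConv (h : IsTailKernel κ) (hg : Continuous g)
    (hi : Integrable fun u => g u ^ 2) (u : ℝ) :
    HasDerivAt (tailConv κ g) (-tailConv (_root_.deriv κ) g u) u := by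
  obtain ⟨C, hC0, hC⟩ := h.deriv.exists_bound
  have hκ' := h.deriv.contDiff.continuous
  have := (hasDerivAt_integral_of_dominated_loc_of_deriv_le (μ := volume)
    (F := fun u w => g w * κ (w - u)) (F' := fun u w => -(g w * _root_.deriv κ (w - u)))
    (bound := fun w => C * 2 * (|g w| * tailWeight (w - u))) (x₀ := u)
    (Metric.closedBall_mem_nhds u one_pos) (Eventually.of_forall fun x => ?_)
    (h.integrable hg hi u) ?_ (ae_of_all _ fun w x hx => ?_)
    ((integrable_abs_mul_tailWeight hg hi u).const_mul _) (ae_of_all _ fun w x _ => ?_)).2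
  · rw [integral_neg] at this
    exact this
  · exact (h.integrable hg hi x).aestronglyMeasurable
  · exact (h.deriv.integrable hg hi u).neg.aestronglyMeasurable
  · rw [norm_neg]
    refine (IsTailKernel.norm_le hC _ _).trans ?_
    have h1 : tailWeight (w - x) ≤ 2 * tailWeight (w - u) := by
      refine tailWeight_le ?_
      rw [Metric.mem_closedBall, Real.dist_eq, abs_sub_comm] at hx
      rwa [show w - x - (w - u) = u - x by ring]
    calc C * (|g w| * tailWeight (w - x)) ≤ C * (|g w| * (2 * tailWeight (w - u))) := by gcongr
      _ = _ := by ring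
  · have h1 : HasDerivAt κ (_root_.deriv κ (w - x)) (w - x) :=
      (h.contDiff.differentiable (by simp) _).hasDerivAt
    exact ((h1.comp x ((hasDerivAt_id x).const_sub w)).const_mul (g w)).congr_deriv (by simp)

lemma IsTailKernel.contDiff_tailConv (h : IsTailKernel κ) (hg : Continuous g)
    (hi : Integrable fun u => g u ^ 2) : ContDiff ℝ ∞ (tailConv κ g) := by
  refine contDiff_infty.2 fun n => ?_
  induction n generalizing κ with
  | zero =>
    exact contDiff_zero.2 (continuous_iff_continuousAt.2 fun u =>
      (h.hasDerivAt_tailConv hg hi u).continuousAt)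
  | succ n ih =>
    rw [show ((n + 1 : ℕ) : WithTop ℕ∞) = (n : WithTop ℕ∞) + 1 by norm_cast]
    refine contDiff_succ_iff_deriv.2 ⟨fun u => (h.hasDerivAt_tailConv hg hi u).differentiableAt,
      by simp, ?_⟩
    rw [show _root_.deriv (tailConv κ g) = fun u => -tailConv (_root_.deriv κ) g u from
      funext fun u => (h.hasDerivAt_tailConv hg hi u).deriv]
    exact (ih h.deriv).neg

end TailConv

/-! ### The half-order derivative -/

/-- A smooth transition from `0` on `(-∞, 1]` to `1` on `[2, ∞)`. -/
def cutS (s : ℝ) : ℝ := Real.smoothTransition (s - 1)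

lemma contDiff_cutS : ContDiff ℝ ∞ cutS :=
  Real.smoothTransition.contDiff.comp (contDiff_id.sub contDiff_const)

lemma cutS_of_le {s : ℝ} (h : s ≤ 1) : cutS s = 0 :=
  Real.smoothTransition.zero_of_nonpos (by linarith)

lemma cutS_of_ge {s : ℝ} (h : 2 ≤ s) : cutS s = 1 :=
  Real.smoothTransition.one_of_one_le (by linarith)

/-- The kernel `(2 * s)^(-1/2)`, cut off near the origin. -/
def farKer (s : ℝ) : ℝ := cutS s * (√(2 * s))⁻¹

lemma farKer_of_le {s : ℝ} (h : s ≤ 1) : farKer s = 0 := by rw [farKer, cutS_of_le h, zero_mul]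

lemma contDiff_farKer : ContDiff ℝ ∞ farKer := by
  refine contDiff_iff_contDiffAt.2 fun s => ?_
  rcases lt_or_ge s 1 with h | h
  · refine contDiffAt_const (c := (0 : ℝ)).congr_of_eventuallyEq ?_
    filter_upwards [isOpen_Iio.mem_nhds h] with x hx using farKer_of_le (le_of_lt hx)
  · have h2 : 2 * s ≠ 0 := by linarith
    refine contDiff_cutS.contDiffAt.mul (ContDiffAt.inv ?_ (Real.sqrt_ne_zero'.2 (by linarith)))
    exact (contDiffAt_const.mul contDiffAt_id).sqrt h2

lemma isTailKernel_deriv_farKer : IsTailKernel (deriv farKer) := by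
  refine ⟨(contDiff_infty_iff_deriv.1 contDiff_farKer).2, fun s hs => ?_,
    (√2)⁻¹ * -(1 / 2), 3 / 2, by norm_num, fun s hs => ?_⟩
  · have : farKer =ᶠ[𝓝 s] fun _ => 0 := by
      filter_upwards [isOpen_Iio.mem_nhds hs] with x hx using farKer_of_le (le_of_lt hx)
    rw [this.deriv_eq, deriv_const]
  · have : farKer =ᶠ[𝓝 s] fun s => (√2)⁻¹ * s ^ (-(1 / 2) : ℝ) := by
      filter_upwards [isOpen_Ioi.mem_nhds hs] with x hx
      have hx0 : 0 ≤ x := by linarith [show 2 < x from hx]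
      rw [farKer, cutS_of_ge (le_of_lt hx), one_mul, Real.sqrt_mul two_pos.le, mul_inv,
        Real.rpow_neg hx0, ← Real.sqrt_eq_rpow]
    rw [this.deriv_eq, ((Real.hasDerivAt_rpow_const (p := -(1 / 2))
      (Or.inl (show s ≠ 0 by intro h; linarith))).const_mul _).deriv]
    norm_num
    ring

/-- Integration against `y ↦ u + y ^ 2 / 2`, which is half-order integration up to a constant. -/
def halfInt (h : ℝ → ℝ) (u : ℝ) : ℝ := ∫ y in Ioi (0 : ℝ), h (u + y ^ 2 / 2)

/-- The part of the half-order derivative of `g` depending only on nearby values of `g`. -/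
def nearHalf (g : ℝ → ℝ) (u : ℝ) : ℝ :=
  ∫ y in (0 : ℝ)..2, deriv g (u + y ^ 2 / 2) * (1 - cutS (y ^ 2 / 2))

/-- The half-order derivative inverting `halfInt`. -/
def halfDer (g : ℝ → ℝ) (u : ℝ) : ℝ :=
  -(2 / π) * (nearHalf g u - tailConv (deriv farKer) g u)

section HalfDer

variable {g h : ℝ → ℝ} {b : ℝ}

lemma contDiff_nearHalf (hg : ContDiff ℝ ∞ g) : ContDiff ℝ ∞ (nearHalf g) := by
  refine contDiff_parametric (E := ℝ)
    (F := fun q => deriv g (q.1 + q.2 ^ 2 / 2) * (1 - cutS (q.2 ^ 2 / 2))) ?_ 0 2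
  have h1 := (contDiff_infty_iff_deriv.1 hg).2
  have h2 := contDiff_cutS
  fun_prop

lemma contDiff_halfDer (hg : ContDiff ℝ ∞ g) (hi : Integrable fun u => g u ^ 2) :
    ContDiff ℝ ∞ (halfDer g) :=
  contDiff_const.mul ((contDiff_nearHalf hg).sub
    (isTailKernel_deriv_farKer.contDiff_tailConv hg.continuous hi))

lemma halfInt_eq (hh : ∀ x ≥ b, h x = 0) {u L : ℝ} (hL : 0 ≤ L) (hb : b ≤ u + L ^ 2 / 2) :
    halfInt h u = ∫ y in (0 : ℝ)..L, h (u + y ^ 2 / 2) := by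
  rw [intervalIntegral.integral_of_le hL, halfInt]
  refine setIntegral_eq_of_subset_of_forall_sdiff_eq_zero measurableSet_Ioi Ioc_subset_Ioi_self
    fun y hy => hh _ ?_
  have : L < y := not_le.1 fun hle => hy.2 ⟨hy.1, hle⟩
  nlinarith

lemma halfInt_eq_zero (hh : ∀ x ≥ b, h x = 0) {u : ℝ} (hu : b ≤ u) : halfInt h u = 0 := by
  rw [halfInt_eq hh le_rfl (by simpa using hu), intervalIntegral.integral_same]

lemma deriv_eq_zero_of_ge (hg : ContDiff ℝ ∞ g) (hb : ∀ x ≥ b, g x = 0) :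
    ∀ x ≥ b, deriv g x = 0 := by
  have h1 : ∀ x > b, deriv g x = 0 := fun x hx => by
    have : g =ᶠ[𝓝 x] fun _ => 0 := by
      filter_upwards [isOpen_Ioi.mem_nhds hx] with y hy using hb y (le_of_lt hy)
    rw [this.deriv_eq, deriv_const]
  intro x hx
  have hc : Continuous (deriv g) := (contDiff_infty_iff_deriv.1 hg).2.continuous
  have h2 : x ∈ closure (Ioi b) := by rwa [closure_Ioi]
  exact (isClosed_singleton.preimage hc).closure_subset_iff.2 (fun y hy => h1 y hy) h2

/-- On functions vanishing near infinity, the half-order derivative has a simple formula. -/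
lemma halfDer_eq (hg : ContDiff ℝ ∞ g) (hb : ∀ x ≥ b, g x = 0) (u : ℝ) :
    halfDer g u = -(2 / π) * halfInt (deriv g) u := by
  have hg' : Continuous (deriv g) := (contDiff_infty_iff_deriv.1 hg).2.continuous
  have hS := contDiff_cutS.continuous
  have hk := contDiff_farKer.continuous
  have hκ := isTailKernel_deriv_farKer.contDiff.continuous
  set L := max 2 (|b - u| + 1) with hLdef
  have hL2 : 2 ≤ L := le_max_left _ _
  have hL1 : |b - u| + 1 ≤ L := le_max_right _ _
  have hbL : b ≤ u + L ^ 2 / 2 := by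
    have := le_abs_self (b - u)
    nlinarith
  rw [halfDer, halfInt_eq (deriv_eq_zero_of_ge hg hb) (by linarith) hbL]
  congr 1
  have e1 : ∫ y in (0 : ℝ)..L, deriv g (u + y ^ 2 / 2) =
      (∫ y in (0 : ℝ)..L, deriv g (u + y ^ 2 / 2) * (1 - cutS (y ^ 2 / 2)))
      + ∫ y in (0 : ℝ)..L, deriv g (u + y ^ 2 / 2) * cutS (y ^ 2 / 2) := by
    rw [← intervalIntegral.integral_add (Continuous.intervalIntegrable (by fun_prop) _ _)
      (Continuous.intervalIntegrable (by fun_prop) _ _)]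
    congr 1; funext y; ring
  have e2 : ∫ y in (0 : ℝ)..L, deriv g (u + y ^ 2 / 2) * (1 - cutS (y ^ 2 / 2)) =
      nearHalf g u := by
    rw [nearHalf, ← intervalIntegral.integral_add_adjacent_intervals (b := 2)
      (Continuous.intervalIntegrable (by fun_prop) _ _)
      (Continuous.intervalIntegrable (by fun_prop) _ _), add_eq_left]
    refine intervalIntegral.integral_zero_ae (ae_of_all _ fun y hy => ?_)
    rw [uIoc_of_le hL2] at hy
    rw [cutS_of_ge (by nlinarith [hy.1]), sub_self, mul_zero]
  have e3 : ∫ y in (0 : ℝ)..L, deriv g (u + y ^ 2 / 2) * cutS (y ^ 2 / 2) =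
      ∫ s in (0 : ℝ)..L ^ 2 / 2, deriv g (u + s) * farKer s := by
    have := intervalIntegral.integral_comp_mul_deriv (a := 0) (b := L)
      (f := fun y : ℝ => y ^ 2 / 2) (f' := fun y => y) (g := fun s => deriv g (u + s) * farKer s)
      (fun y _ => ((hasDerivAt_pow 2 y).div_const 2).congr_deriv (by simp))
      continuousOn_id (by fun_prop)
    rw [show (0 : ℝ) ^ 2 / 2 = 0 by norm_num] at this
    rw [← this]
    refine intervalIntegral.integral_congr fun y hy => ?_
    rw [uIcc_of_le (by linarith)] at hy
    rcases hy.1.eq_or_lt with h0 | h0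
    · simp [← h0, cutS_of_le (show (0 : ℝ) ≤ 1 by norm_num)]
    · simp only [Function.comp, farKer]
      rw [show 2 * (y ^ 2 / 2) = y ^ 2 by ring, Real.sqrt_sq h0.le]
      field_simp
  have e4 : ∫ s in (0 : ℝ)..L ^ 2 / 2, deriv g (u + s) * farKer s =
      -tailConv (deriv farKer) g u := by
    have := intervalIntegral.integral_mul_deriv_eq_deriv_mul (a := 0) (b := L ^ 2 / 2)
      (u := farKer) (v := fun s => g (u + s)) (u' := deriv farKer) (v' := fun s => deriv g (u + s))
      (fun s _ => (contDiff_farKer.differentiable (by simp) s).hasDerivAt)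
      (fun s _ => ((hg.differentiable (by simp) (u + s)).hasDerivAt.comp_const_add u s))
      (hκ.intervalIntegrable _ _) (Continuous.intervalIntegrable (by fun_prop) _ _)
    simp only [mul_comm (deriv g _)]
    rw [this, hb _ hbL, farKer_of_le (show (0 : ℝ) ≤ 1 by norm_num), mul_zero, zero_mul, sub_zero,
      zero_sub, tailConv, ← integral_add_right_eq_self _ u,
      intervalIntegral.integral_of_le (by positivity)]
    congr 1
    rw [← setIntegral_eq_integral_of_forall_compl_eq_zero (s := Ioc 0 (L ^ 2 / 2))
      (f := fun s => g (s + u) * deriv farKer (s + u - u)) fun s hs => ?_]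
    · refine setIntegral_congr_fun measurableSet_Ioc fun s _ => ?_
      rw [add_sub_cancel_right, add_comm s u, mul_comm]
    · rcases le_or_gt s 0 with h0 | h0
      · rw [add_sub_cancel_right, isTailKernel_deriv_farKer.eq_zero s (by linarith), mul_zero]
      · have : L ^ 2 / 2 < s := not_le.1 fun hle => hs ⟨h0, hle⟩
        rw [hb _ (by linarith), zero_mul]
  rw [e1, e2, e3, e4, sub_eq_add_neg]

/-- Iterating `halfInt` gives a multiple of the antiderivative. -/
lemma halfInt_halfInt (hg : ContDiff ℝ ∞ g) (hb : ∀ x ≥ b, g x = 0) (u : ℝ) :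
    halfInt (halfInt (deriv g)) u = -(π / 2) * g u := by
  have hg' : Continuous (deriv g) := (contDiff_infty_iff_deriv.1 hg).2.continuous
  have hb' := deriv_eq_zero_of_ge hg hb
  set H : ℝ × ℝ → ℝ := fun p => deriv g (u + p.1 ^ 2 / 2 + p.2 ^ 2 / 2) with hH
  have hHc : Continuous H := by fun_prop
  have hsupp : HasCompactSupport H := by
    refine HasCompactSupport.intro (isCompact_closedBall (0 : ℝ × ℝ) (2 * |b - u| + 1))
      fun p hp => hb' _ ?_
    rw [Metric.mem_closedBall, dist_zero_right, not_le, Prod.norm_def, lt_max_iff,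
      Real.norm_eq_abs, Real.norm_eq_abs] at hp
    have h0 := abs_nonneg (b - u)
    have h1 := le_abs_self (b - u)
    rcases hp with hp | hp
    · nlinarith [sq_abs p.1, sq_nonneg p.2]
    · nlinarith [sq_abs p.2, sq_nonneg p.1]
  have e1 : ∫ p, H p = 4 * halfInt (halfInt (deriv g)) u := by
    rw [Measure.volume_eq_prod, integral_prod _ (hHc.integrable_of_hasCompactSupport hsupp)]
    have h1 : ∀ x : ℝ, ∫ y, H (x, y) = 2 * halfInt (deriv g) (u + |x| ^ 2 / 2) := fun x => by
      have := integral_comp_abs (f := fun y => deriv g (u + x ^ 2 / 2 + y ^ 2 / 2))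
      simp only [sq_abs] at this ⊢
      exact this
    simp only [h1]
    rw [integral_comp_abs (f := fun x => 2 * halfInt (deriv g) (u + x ^ 2 / 2)),
      integral_const_mul, halfInt]
    ring
  have e2 : ∫ p, H p = -(2 * π) * g u := by
    have h1 : ∫ r in Ioi (0 : ℝ), r * deriv g (u + r ^ 2 / 2) = 0 - g u := by
      have hz : ∀ r ∈ Ioi (|b - u| + 1), g (u + r ^ 2 / 2) = 0 := fun r hr => hb _ <| by
        have := le_abs_self (b - u)
        have := abs_nonneg (b - u)
        have hr' : |b - u| + 1 < r := hr
        nlinarith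
      have hd : ∀ r ∈ Ici (0 : ℝ), HasDerivAt (fun r => g (u + r ^ 2 / 2))
          (r * deriv g (u + r ^ 2 / 2)) r := fun r _ => by
        have h2 : HasDerivAt (fun r : ℝ => u + r ^ 2 / 2) r r :=
          (((hasDerivAt_pow 2 r).div_const 2).const_add u).congr_deriv (by simp)
        exact ((hg.differentiable (by simp) _).hasDerivAt.comp r h2).congr_deriv (by ring)
      have := integral_Ioi_of_hasDerivAt_of_tendsto' hd ?_
        (tendsto_const_nhds.congr' (eventually_gt_atTop _ |>.mono fun r hr => (hz r hr).symm))
      · simpa using this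
      · have hc : Continuous fun r : ℝ => r * deriv g (u + r ^ 2 / 2) := by fun_prop
        refine (hc.integrableOn_Icc (a := 0) (b := |b - u| + 1)).of_forall_sdiff_eq_zero
          measurableSet_Ioi fun r hr => ?_
        have hr' : |b - u| + 1 < r := not_le.1 fun hle => hr.2 ⟨le_of_lt hr.1, hle⟩
        have := le_abs_self (b - u)
        have := abs_nonneg (b - u)
        rw [hb' _ (by nlinarith), mul_zero]
    rw [← integral_comp_polarCoord_symm, polarCoord_target, Measure.volume_eq_prod]
    have h2 := setIntegral_prod_mul (μ := volume) (ν := volume)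
      (fun r : ℝ => r * deriv g (u + r ^ 2 / 2)) (fun _ : ℝ => (1 : ℝ)) (Ioi 0) (Ioo (-π) π)
    rw [h1] at h2
    simp only [mul_one, integral_const, MeasurableSet.univ, measureReal_restrict_apply,
      univ_inter, smul_eq_mul] at h2
    rw [Real.volume_real_Ioo_of_le (by linarith [Real.pi_pos])] at h2
    convert h2 using 1
    · congr 1
      funext p
      simp only [polarCoord_symm_apply, smul_eq_mul, hH]
      congr 2
      linear_combination (p.1 ^ 2 / 2) * Real.cos_sq_add_sin_sq p.2
    · ring
  linarith

/-- The half-order derivative inverts `halfInt`. -/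
lemma halfInt_halfDer (hg : ContDiff ℝ ∞ g) (hb : ∀ x ≥ b, g x = 0) (u : ℝ) :
    halfInt (halfDer g) u = g u := by
  rw [show halfDer g = fun u => -(2 / π) * halfInt (deriv g) u from
    funext (halfDer_eq hg hb), halfInt, integral_const_mul]
  have := halfInt_halfInt hg hb u
  rw [halfInt] at this
  rw [this]
  field_simp

lemma halfDer_eq_zero (hg : ContDiff ℝ ∞ g) (hb : ∀ x ≥ b, g x = 0) {u : ℝ} (hu : b ≤ u) :
    halfDer g u = 0 := by
  rw [halfDer_eq hg hb, halfInt_eq_zero (deriv_eq_zero_of_ge hg hb) hu, mul_zero]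

end HalfDer

/-! ### Linear waves with prescribed radiation -/

/-- The linear wave with radiation field `g`. -/
def radWave (g : ℝ → ℝ) : ℝ × ℝ → ℝ := linWave fun u => ∫ x in (0 : ℝ)..u, halfDer g x

section RadWave

variable {g : ℝ → ℝ} {b : ℝ}

lemma hasDerivAt_integral_halfDer (hg : ContDiff ℝ ∞ g) (hi : Integrable fun u => g u ^ 2) (x : ℝ) :
    HasDerivAt (fun u => ∫ x in (0 : ℝ)..u, halfDer g x) (halfDer g x) x :=
  (contDiff_halfDer hg hi).continuous.integral_hasStrictDerivAt 0 x |>.hasDerivAt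

lemma contDiff_integral_halfDer (hg : ContDiff ℝ ∞ g) (hi : Integrable fun u => g u ^ 2) :
    ContDiff ℝ ∞ fun u => ∫ x in (0 : ℝ)..u, halfDer g x := by
  refine contDiff_infty_iff_deriv.2
    ⟨fun x => (hasDerivAt_integral_halfDer hg hi x).differentiableAt, ?_⟩
  rw [show deriv (fun u => ∫ x in (0 : ℝ)..u, halfDer g x) = halfDer g from
    funext fun x => (hasDerivAt_integral_halfDer hg hi x).deriv]
  exact contDiff_halfDer hg hi

lemma isWave_radWave (hg : ContDiff ℝ ∞ g) (hi : Integrable fun u => g u ^ 2) :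
    IsWave (fun x => x ^ 2) (fun x => 2 * x) (univ ×ˢ Ioi 0) (radWave g) :=
  isWave_linWave (contDiff_integral_halfDer hg hi) (hasDerivAt_integral_halfDer hg hi)

lemma contDiff_radWave (hg : ContDiff ℝ ∞ g) (hi : Integrable fun u => g u ^ 2) :
    ContDiff ℝ ∞ (radWave g) :=
  contDiff_linWave (contDiff_integral_halfDer hg hi)

lemma dd_radWave (hg : ContDiff ℝ ∞ g) (hi : Integrable fun u => g u ^ 2) (v : ℝ × ℝ) :
    dd v (radWave g) =
      planeWave (fun θ => (v.1 - v.2 * Real.cos θ) * Real.cos θ) (halfDer g) :=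
  dd_linWave (contDiff_integral_halfDer hg hi) (hasDerivAt_integral_halfDer hg hi) v

lemma radWave_eq (hg : ContDiff ℝ ∞ g) (hi : Integrable fun u => g u ^ 2) (p : ℝ × ℝ) :
    radWave g p =
      -(p.2 * planeWave (fun θ => Real.sin θ * Real.sin θ) (halfDer g) p) :=
  linWave_eq (contDiff_halfDer hg hi).continuous (hasDerivAt_integral_halfDer hg hi) p

lemma continuous_dd_radWave (hg : ContDiff ℝ ∞ g) (hi : Integrable fun u => g u ^ 2) (v : ℝ × ℝ) :
    Continuous (dd v (radWave g)) := by
  rw [dd_radWave hg hi]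
  exact (contDiff_planeWave (contDiff_halfDer hg hi)
    ((contDiff_const.sub (contDiff_const.mul Real.contDiff_cos)).mul Real.contDiff_cos)).continuous

lemma enD_radWave (hg : ContDiff ℝ ∞ g) (hi : Integrable fun u => g u ^ 2) (p : ℝ × ℝ) :
    enD (fun x => x ^ 2) (radWave g) p = (dd eT (radWave g) p ^ 2 + dd eR (radWave g) p ^ 2
      + planeWave (fun θ => Real.sin θ * Real.sin θ) (halfDer g) p ^ 2) * p.2 := by
  rw [enD, radWave_eq hg hi]
  rcases eq_or_ne p.2 0 with h | h
  · simp [h]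
  · congr 2
    field_simp

lemma continuous_enD_radWave (hg : ContDiff ℝ ∞ g) (hi : Integrable fun u => g u ^ 2) :
    Continuous (enD (fun x => x ^ 2) (radWave g)) := by
  rw [show enD (fun x => x ^ 2) (radWave g) = _ from funext (enD_radWave hg hi)]
  have h1 := continuous_dd_radWave hg hi eT
  have h2 := continuous_dd_radWave hg hi eR
  have h3 := (contDiff_planeWave (contDiff_halfDer hg hi)
    (Real.contDiff_sin.mul Real.contDiff_sin)).continuous
  fun_prop

/-! #### Compactly supported radiation -/

lemma planeWave_eq_zero {k h : ℝ → ℝ} (hh : ∀ x ≥ b, h x = 0) {p : ℝ × ℝ} (hp : b ≤ p.1 - p.2)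
    (h0 : 0 ≤ p.2) : planeWave k h p = 0 := by
  refine intervalIntegral.integral_zero_ae (ae_of_all _ fun θ _ => ?_)
  rw [hh _ (by nlinarith [Real.cos_le_one θ]), zero_mul]

lemma radWave_eq_zero (hg : ContDiff ℝ ∞ g) (hi : Integrable fun u => g u ^ 2)
    (hb : ∀ x ≥ b, g x = 0) {p : ℝ × ℝ} (hp : b ≤ p.1 - p.2) (h0 : 0 ≤ p.2) :
    radWave g p = 0 := by
  rw [radWave_eq hg hi, planeWave_eq_zero (fun x hx => halfDer_eq_zero hg hb hx) hp h0]
  simp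

lemma dd_radWave_eq_zero (hg : ContDiff ℝ ∞ g) (hi : Integrable fun u => g u ^ 2)
    (hb : ∀ x ≥ b, g x = 0) (v : ℝ × ℝ) {p : ℝ × ℝ} (hp : b ≤ p.1 - p.2) (h0 : 0 ≤ p.2) :
    dd v (radWave g) p = 0 := by
  rw [dd_radWave hg hi, planeWave_eq_zero (fun x hx => halfDer_eq_zero hg hb hx) hp h0]

lemma exists_halfDer_bound (hg : ContDiff ℝ ∞ g) (hi : Integrable fun u => g u ^ 2)
    (hb : ∀ x ≥ b, g x = 0) (a : ℝ) : ∃ M, 0 ≤ M ∧ ∀ x ≥ a, |halfDer g x| ≤ M := by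
  obtain ⟨M, hM⟩ := (isCompact_Icc (a := a) (b := b)).exists_bound_of_continuousOn
    (contDiff_halfDer hg hi).continuous.continuousOn
  refine ⟨max M 0, le_max_right _ _, fun x hx => ?_⟩
  rcases le_total x b with h | h
  · exact (hM x ⟨hx, h⟩).trans (le_max_left _ _)
  · rw [halfDer_eq_zero hg hb h, abs_zero]
    exact le_max_right _ _

lemma stripBdd_radWave (hg : ContDiff ℝ ∞ g) (hi : Integrable fun u => g u ^ 2)
    (hb : ∀ x ≥ b, g x = 0) : StripBdd (radWave g) := by
  intro a c v₀ hc ha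
  obtain ⟨M, hM0, hM⟩ := exists_halfDer_bound hg hi hb a
  refine ⟨2 * M * |b - a| * π, fun p hp => ?_⟩
  have hp2 : 0 < p.2 := by
    obtain ⟨⟨h1, h2⟩, h3⟩ := hp
    linarith
  have hpa : a ≤ p.1 - p.2 := hp.1.1
  rw [radWave_eq hg hi, abs_neg, planeWave, ← intervalIntegral.integral_const_mul]
  have key := intervalIntegral.norm_integral_le_of_norm_le_const (a := 0) (b := π)
    (C := 2 * M * |b - a|)
    (f := fun θ => p.2 * (halfDer g (p.1 - p.2 * Real.cos θ) * (Real.sin θ * Real.sin θ)))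
    fun θ _ => ?_
  · rwa [sub_zero, abs_of_pos Real.pi_pos] at key
  · have hc1 := Real.cos_le_one θ
    have hc2 := Real.neg_one_le_cos θ
    rcases lt_or_ge (p.1 - p.2 * Real.cos θ) b with h | h
    · have h1 : p.2 * (1 - Real.cos θ) ≤ |b - a| := by
        refine le_trans ?_ (le_abs_self _)
        linarith
      have h2 := hM (p.1 - p.2 * Real.cos θ) (by nlinarith)
      have h3 : p.2 * (Real.sin θ * Real.sin θ) ≤ 2 * |b - a| := by
        have := Real.sin_sq_add_cos_sq θ
        nlinarith [mul_nonneg hp2.le (mul_self_nonneg (1 - Real.cos θ))]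
      have h4 : 0 ≤ p.2 * (Real.sin θ * Real.sin θ) := mul_nonneg hp2.le (mul_self_nonneg _)
      rw [mul_left_comm, norm_mul, Real.norm_eq_abs, Real.norm_of_nonneg h4]
      calc _ ≤ M * (2 * |b - a|) := by gcongr
        _ = _ := by ring
    · rw [halfDer_eq_zero hg hb h]
      simp only [zero_mul, mul_zero, norm_zero]
      positivity

lemma tendsto_mul_one_sub_cos (s : ℝ) :
    Tendsto (fun x : ℝ => x ^ 2 * (1 - Real.cos (s / x))) atTop (𝓝 (s ^ 2 / 2)) := by
  have h0 : Tendsto (fun x : ℝ => s ^ 4 * (5 / 96) * (x ^ 2)⁻¹) atTop (𝓝 0) := by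
    simpa using ((tendsto_pow_atTop two_ne_zero).inv_tendsto_atTop (α := ℝ)).const_mul
      (s ^ 4 * (5 / 96))
  refine tendsto_iff_norm_sub_tendsto_zero.2 (squeeze_zero' (Eventually.of_forall fun _ =>
    norm_nonneg _) ?_ h0)
  filter_upwards [eventually_ge_atTop (|s|), eventually_gt_atTop 0] with x hx hx0
  have h1 := Real.cos_bound (x := s / x) (by rwa [abs_div, abs_of_pos hx0, div_le_one hx0])
  rw [Real.norm_eq_abs, show x ^ 2 * (1 - Real.cos (s / x)) - s ^ 2 / 2 =
    -(x ^ 2 * (Real.cos (s / x) - (1 - (s / x) ^ 2 / 2))) by field_simp; ring, abs_neg, abs_mul,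
    abs_of_pos (by positivity : 0 < x ^ 2)]
  calc _ ≤ x ^ 2 * (|s / x| ^ 4 * (5 / 96)) := by gcongr
    _ = _ := by
      rw [Even.pow_abs (by decide)]
      field_simp

lemma tendsto_radWave (hg : ContDiff ℝ ∞ g) (hi : Integrable fun u => g u ^ 2)
    (hb : ∀ x ≥ b, g x = 0) (u : ℝ) :
    Tendsto (fun x : ℝ => x * dd eN (radWave g) (u + x ^ 2, x ^ 2)) atTop (𝓝 (g u)) := by
  have hf := (contDiff_halfDer hg hi).continuous
  obtain ⟨M, hM0, hM⟩ := exists_halfDer_bound hg hi hb u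
  set K := π * (|b - u| + 1) with hK
  have hK0 : 0 ≤ K := by positivity
  have hKb : |b - u| ≤ 2 / π ^ 2 * K ^ 2 := by
    rw [hK, mul_pow, ← mul_assoc, div_mul_cancel₀ _ (by positivity)]
    nlinarith [abs_nonneg (b - u)]
  have hKu : b ≤ u + K ^ 2 / 2 := by
    have h1 := le_abs_self (b - u)
    have h2 : 2 / π ^ 2 ≤ 1 / 2 := by
      rw [div_le_div_iff₀ (by positivity) two_pos]
      nlinarith [Real.two_le_pi]
    nlinarith [mul_le_mul_of_nonneg_right h2 (sq_nonneg K)]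
  have hlim : Tendsto (fun x : ℝ => ∫ s in (0 : ℝ)..K,
      halfDer g (u + x ^ 2 * (1 - Real.cos (s / x))) *
        ((1 + Real.cos (s / x)) / 2 * Real.cos (s / x))) atTop
      (𝓝 (∫ s in (0 : ℝ)..K, halfDer g (u + s ^ 2 / 2))) := by
    refine intervalIntegral.tendsto_integral_filter_of_dominated_convergence (fun _ => M)
      (Eventually.of_forall fun x => Continuous.aestronglyMeasurable (by fun_prop))
      (Eventually.of_forall fun x => ae_of_all _ fun s _ => ?_) (by simp)
      (ae_of_all _ fun s _ => ?_)
    · have h1 := hM (u + x ^ 2 * (1 - Real.cos (s / x)))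
        (by nlinarith [mul_nonneg (sq_nonneg x) (sub_nonneg.2 (Real.cos_le_one (s / x)))])
      have h2 : |(1 + Real.cos (s / x)) / 2 * Real.cos (s / x)| ≤ 1 := by
        have := Real.abs_cos_le_one (s / x)
        rw [abs_le] at this ⊢
        constructor <;> nlinarith
      rw [norm_mul, Real.norm_eq_abs, Real.norm_eq_abs, ← mul_one M]
      gcongr
    · have h1 : Tendsto (fun x : ℝ => Real.cos (s / x)) atTop (𝓝 1) := by
        have := (Real.continuous_cos.tendsto 0).comp
          ((tendsto_const_nhds (x := s)).div_atTop tendsto_id)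
        simpa [Function.comp_def] using this
      have h2 := (hf.tendsto (u + s ^ 2 / 2)).comp ((tendsto_mul_one_sub_cos s).const_add u)
      have h3 := h2.mul (((h1.const_add 1).div_const 2).mul h1)
      norm_num at h3
      exact h3
  rw [← halfInt_eq (fun x hx => halfDer_eq_zero hg hb hx) hK0 hKu, halfInt_halfDer hg hb] at hlim
  refine hlim.congr' ?_
  filter_upwards [eventually_ge_atTop (K / π), eventually_gt_atTop 0] with x hx hx0
  have hx' : K ≤ π * x := by rwa [div_le_iff₀' Real.pi_pos] at hx
  rw [dd_radWave hg hi, planeWave]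
  have h2 := intervalIntegral.integral_comp_div (a := 0) (b := π * x)
    (fun θ => halfDer g (u + x ^ 2 - x ^ 2 * Real.cos θ) *
      ((eN.1 - eN.2 * Real.cos θ) * Real.cos θ)) hx0.ne'
  rw [zero_div, mul_div_cancel_right₀ _ hx0.ne'] at h2
  rw [smul_eq_mul] at h2
  rw [← h2]
  have hc : ∀ θ, halfDer g (u + x ^ 2 - x ^ 2 * Real.cos θ) *
      ((eN.1 - eN.2 * Real.cos θ) * Real.cos θ) = halfDer g (u + x ^ 2 * (1 - Real.cos θ)) *
        ((1 + Real.cos θ) / 2 * Real.cos θ) := fun θ => by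
    rw [show u + x ^ 2 - x ^ 2 * Real.cos θ = u + x ^ 2 * (1 - Real.cos θ) by ring]
    simp only [eN]
    ring
  simp only [hc]
  rw [← intervalIntegral.integral_add_adjacent_intervals (a := 0) (b := K) (c := π * x)
      (Continuous.intervalIntegrable (by fun_prop) _ _)
      (Continuous.intervalIntegrable (by fun_prop) _ _), eq_comm, add_eq_left]
  refine intervalIntegral.integral_zero_ae (ae_of_all _ fun s hs => ?_)
  rw [uIoc_of_le hx'] at hs
  have hs0 : 0 ≤ s := hK0.trans hs.1.le
  have h3 : |s / x| ≤ π := by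
    rw [abs_of_nonneg (by positivity), div_le_iff₀ hx0]
    exact hs.2
  have h4 := Real.cos_le_one_sub_mul_cos_sq h3
  have h5 : 2 / π ^ 2 * K ^ 2 ≤ x ^ 2 * (1 - Real.cos (s / x)) := by
    calc 2 / π ^ 2 * K ^ 2 ≤ 2 / π ^ 2 * s ^ 2 := by gcongr; exact hs.1.le
      _ = x ^ 2 * (2 / π ^ 2 * (s / x) ^ 2) := by field_simp
      _ ≤ _ := by gcongr; linarith
  rw [halfDer_eq_zero hg hb (by linarith [le_abs_self (b - u)]), zero_mul]

/-- The radiation field of `radWave g` is `g`. -/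
lemma radLim_radWave (hg : ContDiff ℝ ∞ g) (hi : Integrable fun u => g u ^ 2)
    (hb : ∀ x ≥ b, g x = 0) : RadLim (fun p => √p.2 * dd eN (radWave g) p) g := by
  obtain ⟨h, -, hh⟩ := (isWave_radWave hg hi).exists_radiation (stripBdd_radWave hg hi hb)
  suffices h = g from this ▸ hh
  funext u
  refine tendsto_nhds_unique ?_ (tendsto_radWave hg hi hb u)
  have h1 : Tendsto (fun x : ℝ => u + 2 * x ^ 2) atTop atTop :=
    tendsto_atTop_add_const_left _ _ ((tendsto_pow_atTop two_ne_zero).const_mul_atTop two_pos)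
  refine ((hh.tendsto u).comp h1).congr' ?_
  filter_upwards [eventually_ge_atTop 0] with x hx
  simp only [Function.comp, nul]
  rw [show (u + 2 * x ^ 2 + u) / 2 = u + x ^ 2 by ring,
    show (u + 2 * x ^ 2 - u) / 2 = x ^ 2 by ring, Real.sqrt_sq hx]

end RadWave

/-! ### Energy of linear waves -/

section RadWaveEnergy

variable {g : ℝ → ℝ} {b : ℝ}

lemma interval_sq_le (hi : Integrable fun u => g u ^ 2) {x y : ℝ} (hxy : x ≤ y) :
    ∫ u in x..y, g u ^ 2 ≤ ∫ u, g u ^ 2 := by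
  rw [intervalIntegral.integral_of_le hxy]
  exact setIntegral_le_integral hi (ae_of_all _ fun u => sq_nonneg _)

/-- The potential is constant in the region not yet reached by the radiation. -/
lemma IsPotential.eq_of_radWave (hg : ContDiff ℝ ∞ g) (hi : Integrable fun u => g u ^ 2)
    (hb : ∀ x ≥ b, g x = 0) {P : ℝ × ℝ → ℝ}
    (hP : IsPotential (fun x => x ^ 2) (radWave g) (univ ×ˢ Ioi 0) P) {p q : ℝ × ℝ}
    (hp : b < p.1 - p.2 ∧ 0 < p.2) (hq : b < q.1 - q.2 ∧ 0 < q.2) : P p = P q := by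
  set S : Set (ℝ × ℝ) := {p | b < p.1 - p.2} ∩ {p | 0 < p.2} with hS
  have hSo : IsOpen S := (isOpen_lt continuous_const (by fun_prop)).inter
    (isOpen_lt continuous_const (by fun_prop))
  have hSc : Convex ℝ S := by
    have h1 : IsLinearMap ℝ fun p : ℝ × ℝ => p.1 - p.2 :=
      (LinearMap.fst ℝ ℝ ℝ - LinearMap.snd ℝ ℝ ℝ).isLinear
    have h2 : IsLinearMap ℝ fun p : ℝ × ℝ => p.2 := (LinearMap.snd ℝ ℝ ℝ).isLinear
    exact (convex_halfSpace_gt h1 b).inter (convex_halfSpace_gt h2 0)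
  have hd : ∀ x ∈ S, HasFDerivAt P (0 : ℝ × ℝ →L[ℝ] ℝ) x := fun x hx => by
    have h := hP x ⟨mem_univ _, hx.2⟩
    have h0 : b ≤ x.1 - x.2 := le_of_lt hx.1
    have h1 : (0 : ℝ) ≤ x.2 := le_of_lt hx.2
    rw [fluxD, enD, dd_radWave_eq_zero hg hi hb _ h0 h1, dd_radWave_eq_zero hg hi hb _ h0 h1,
      radWave_eq_zero hg hi hb h0 h1] at h
    simpa using h
  exact hSo.is_const_of_fderiv_eq_zero hSc.isPreconnected
    (fun x hx => (hd x hx).differentiableAt.differentiableWithinAt)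
    (fun x hx => (hd x hx).fderiv) hp hq

lemma IsPotential.radWave_bdd (hg : ContDiff ℝ ∞ g) (hi : Integrable fun u => g u ^ 2)
    (hb : ∀ x ≥ b, g x = 0) {P : ℝ × ℝ → ℝ}
    (hP : IsPotential (fun x => x ^ 2) (radWave g) (univ ×ˢ Ioi 0) P) (a : ℝ) :
    ∃ B, ∀ᶠ v in atTop, P (nul a v) ≤ B := by
  set c := max a (b + 1) with hc
  have h1 := (isWave_radWave hg hi).tendsto_flux (stripBdd_radWave hg hi hb) hP hg.continuous
    (radLim_radWave hg hi hb) (le_max_left a (b + 1))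
  refine ⟨P (nul c (c + 1)) + (2 * (∫ u in a..c, g u ^ 2) + 1), ?_⟩
  filter_upwards [h1.eventually (gt_mem_nhds (lt_add_one _)), eventually_gt_atTop c] with v hv hvc
  have h2 : P (nul c v) = P (nul c (c + 1)) := by
    have hbc : b < c := (lt_add_one b).trans_le (le_max_right _ _)
    refine hP.eq_of_radWave hg hi hb ⟨by rwa [nul_sub], ?_⟩ ⟨by rwa [nul_sub], ?_⟩
    · simp only [nul]; linarith
    · simp only [nul]; linarith
  linarith

lemma integral_enD_radWave_le_add (hg : ContDiff ℝ ∞ g) (hi : Integrable fun u => g u ^ 2)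
    (hb : ∀ x ≥ b, g x = 0) (t : ℝ) : ∃ C, ∀ ε R : ℝ, 0 < ε → ε ≤ 1 → ε ≤ R →
      ∫ r in ε..R, enD (fun x => x ^ 2) (radWave g) (t, r) ≤ 2 * (∫ u, g u ^ 2) + C * ε := by
  have hW := isWave_radWave hg hi
  obtain ⟨P, hP⟩ := hW.exists_potential
  set T := max t (b + 2) with hT
  have htT : t ≤ T := le_max_left _ _
  have hbT : b + 2 ≤ T := le_max_right _ _
  have h1 := continuous_dd_radWave hg hi eT
  have h2 := continuous_dd_radWave hg hi eR
  obtain ⟨C, hC⟩ := ((isCompact_Icc (a := t) (b := T)).prod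
    (isCompact_Icc (a := (0 : ℝ)) (b := 1))).exists_bound_of_continuousOn
    (f := fun p => 2 * (dd eT (radWave g) p * dd eR (radWave g) p))
    (Continuous.continuousOn (by fun_prop))
  refine ⟨C * (T - t), fun ε R hε hε1 hεR => ?_⟩
  have hR : 0 < R := hε.trans_le hεR
  rw [hP.integral_eq hW.isOpen hW.pos hW.contDiff_V hW.smooth hεR
    fun r hr => ⟨mem_univ _, hε.trans_le hr.1⟩]
  have e1 : ‖P (T, ε) - P (t, ε)‖ ≤ C * ε * (T - t) := by
    refine norm_image_sub_le_of_norm_deriv_le_segment' (f := fun s => P (s, ε))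
      (f' := fun s => fluxD (radWave g) (s, ε)) (fun s _ => ?_) (fun s hs => ?_) T ⟨htT, le_rfl⟩
    · have hm : (s, ε) ∈ (univ : Set ℝ) ×ˢ Ioi (0 : ℝ) := ⟨mem_univ _, hε⟩
      have := hasDerivAt_time (hP.differentiableAt hm)
      rw [hP.eT hm] at this
      exact this.hasDerivWithinAt
    · have := hC (s, ε) ⟨⟨hs.1, hs.2.le⟩, hε.le, hε1⟩
      rw [fluxD, show 2 * (s, ε).2 * dd eT (radWave g) (s, ε) * dd eR (radWave g) (s, ε) =
        2 * (dd eT (radWave g) (s, ε) * dd eR (radWave g) (s, ε)) * ε by ring, norm_mul,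
        Real.norm_of_nonneg hε.le]
      gcongr
  have e2 : P (t, R) - P (T, ε) ≤ 2 * ∫ u, g u ^ 2 := by
    have hle : t - R ≤ T - ε := by linarith
    have h3 := hW.tendsto_flux (stripBdd_radWave hg hi hb) hP hg.continuous
      (radLim_radWave hg hi hb) hle
    refine (ge_of_tendsto h3 ?_).trans
      (mul_le_mul_of_nonneg_left (interval_sq_le hi hle) two_pos.le)
    filter_upwards [eventually_gt_atTop (T - ε), eventually_ge_atTop (t + R)] with v hv1 hv2
    have h4 : P (t, R) ≤ P (nul (t - R) v) := by
      rw [← nul_self t R]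
      exact hP.le_outgoing hW.pos hW.V_nonneg hv2 fun v' hv' => ⟨mem_univ _, by
        simp only [nul, mem_Ioi]; linarith [hv'.1]⟩
    have h5 : P (T, ε) = P (nul (T - ε) v) :=
      hP.eq_of_radWave hg hi hb ⟨by simp only; linarith, hε⟩
        ⟨by rw [nul_sub]; linarith, by simp only [nul]; linarith⟩
    linarith
  have := (le_abs_self _).trans e1
  nlinarith

lemma integral_enD_radWave_le_of_eq_zero (hg : ContDiff ℝ ∞ g)
    (hi : Integrable fun u => g u ^ 2) (hb : ∀ x ≥ b, g x = 0) (t : ℝ) {R : ℝ} (hR : 0 < R) :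
    ∫ r in (0 : ℝ)..R, enD (fun x => x ^ 2) (radWave g) (t, r) ≤ 2 * ∫ u, g u ^ 2 := by
  obtain ⟨C, hC⟩ := integral_enD_radWave_le_add hg hi hb t
  have hc : Continuous fun r => enD (fun x => x ^ 2) (radWave g) (t, r) :=
    (continuous_enD_radWave hg hi).comp (Continuous.prodMk_right t)
  have h1 : Tendsto (fun ε => ∫ r in ε..R, enD (fun x => x ^ 2) (radWave g) (t, r)) (𝓝[>] 0)
      (𝓝 (∫ r in (0 : ℝ)..R, enD (fun x => x ^ 2) (radWave g) (t, r))) := by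
    have h2 : Continuous fun ε => ∫ r in ε..R, enD (fun x => x ^ 2) (radWave g) (t, r) := by
      simp only [intervalIntegral.integral_symm R]
      exact (intervalIntegral.continuous_primitive (fun _ _ => hc.intervalIntegrable _ _) R).neg
    exact (h2.tendsto 0).mono_left nhdsWithin_le_nhds
  have h2 : Tendsto (fun ε : ℝ => 2 * (∫ u, g u ^ 2) + C * ε) (𝓝[>] 0)
      (𝓝 (2 * (∫ u, g u ^ 2) + C * 0)) :=
    (Continuous.tendsto (by fun_prop) 0).mono_left nhdsWithin_le_nhds
  rw [mul_zero, add_zero] at h2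
  refine le_of_tendsto_of_tendsto h1 h2 ?_
  filter_upwards [Ioo_mem_nhdsGT (lt_min one_pos hR)] with ε hε
  exact hC ε R hε.1 (hε.2.le.trans (min_le_left _ _)) (hε.2.le.trans (min_le_right _ _))

/-! #### Truncation -/

/-- A smooth cutoff equal to `1` on `[-M, M]` and to `0` outside `[-M - 1, M + 1]`. -/
def truncS (M x : ℝ) : ℝ := Real.smoothTransition (M + 1 - x) * Real.smoothTransition (M + 1 + x)

lemma contDiff_truncS (M : ℝ) : ContDiff ℝ ∞ (truncS M) :=
  (Real.smoothTransition.contDiff.comp (contDiff_const.sub contDiff_id)).mul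
    (Real.smoothTransition.contDiff.comp (contDiff_const.add contDiff_id))

lemma truncS_eq_one {M x : ℝ} (h : |x| ≤ M) : truncS M x = 1 := by
  rw [abs_le] at h
  rw [truncS, Real.smoothTransition.one_of_one_le (by linarith),
    Real.smoothTransition.one_of_one_le (by linarith), one_mul]

lemma truncS_eq_zero {M x : ℝ} (h : M + 1 ≤ x) : truncS M x = 0 := by
  rw [truncS, Real.smoothTransition.zero_of_nonpos (by linarith), zero_mul]

lemma truncS_nonneg (M x : ℝ) : 0 ≤ truncS M x :=
  mul_nonneg (Real.smoothTransition.nonneg _) (Real.smoothTransition.nonneg _)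

lemma truncS_le_one (M x : ℝ) : truncS M x ≤ 1 :=
  mul_le_one₀ (Real.smoothTransition.le_one _) (Real.smoothTransition.nonneg _)
    (Real.smoothTransition.le_one _)

lemma truncS_mul_sq_le (g : ℝ → ℝ) (M x : ℝ) : (truncS M x * g x) ^ 2 ≤ g x ^ 2 := by
  rw [mul_pow]
  have := pow_le_one₀ (n := 2) (truncS_nonneg M x) (truncS_le_one M x)
  nlinarith [sq_nonneg (g x)]

lemma contDiff_truncS_mul (hg : ContDiff ℝ ∞ g) (M : ℝ) :
    ContDiff ℝ ∞ fun x => truncS M x * g x := (contDiff_truncS M).mul hg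

lemma integrable_truncS_mul (hg : ContDiff ℝ ∞ g) (hi : Integrable fun u => g u ^ 2) (M : ℝ) :
    Integrable fun x => (truncS M x * g x) ^ 2 := by
  refine hi.mono' (Continuous.aestronglyMeasurable ?_) (ae_of_all _ fun x => ?_)
  · exact (contDiff_truncS_mul hg M).continuous.pow 2
  · rw [Real.norm_of_nonneg (sq_nonneg _)]
    exact truncS_mul_sq_le g M x

lemma truncS_mul_eq_zero (g : ℝ → ℝ) (M : ℝ) : ∀ x ≥ M + 1, truncS M x * g x = 0 := fun x hx => by
  rw [truncS_eq_zero hx, zero_mul]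

lemma nearHalf_truncS {M u : ℝ} (h : |u| + 2 < M) :
    nearHalf (fun x => truncS M x * g x) u = nearHalf g u := by
  refine intervalIntegral.integral_congr fun y hy => ?_
  rw [uIcc_of_le two_pos.le] at hy
  congr 1
  refine Filter.EventuallyEq.deriv_eq ?_
  have h1 : |u + y ^ 2 / 2| < M := by
    have h2 : |y ^ 2 / 2| ≤ 2 := by
      rw [abs_of_nonneg (by positivity)]
      nlinarith [hy.1, hy.2]
    linarith [abs_add_le u (y ^ 2 / 2)]
  filter_upwards [(isOpen_lt continuous_abs continuous_const).mem_nhds h1] with x hx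
  rw [truncS_eq_one (le_of_lt hx), one_mul]

lemma tendsto_tailConv_truncS {κ : ℝ → ℝ} (hκ : IsTailKernel κ) (hg : ContDiff ℝ ∞ g)
    (hi : Integrable fun u => g u ^ 2) (u : ℝ) :
    Tendsto (fun M : ℝ => tailConv κ (fun x => truncS M x * g x) u) atTop (𝓝 (tailConv κ g u)) := by
  have hint := hκ.integrable hg.continuous hi u
  refine tendsto_integral_filter_of_dominated_convergence (fun w => ‖g w * κ (w - u)‖)
    (Eventually.of_forall fun M => ?_) (Eventually.of_forall fun M => ae_of_all _ fun w => ?_)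
    hint.norm (ae_of_all _ fun w => ?_)
  · exact (hκ.integrable (contDiff_truncS_mul hg M).continuous
      (integrable_truncS_mul hg hi M) u).aestronglyMeasurable
  · rw [mul_assoc, norm_mul, Real.norm_of_nonneg (truncS_nonneg M w)]
    exact mul_le_of_le_one_left (norm_nonneg _) (truncS_le_one M w)
  · refine tendsto_const_nhds.congr' ?_
    filter_upwards [eventually_ge_atTop |w|] with M hM
    rw [truncS_eq_one hM, one_mul]

lemma tendsto_halfDer_truncS (hg : ContDiff ℝ ∞ g) (hi : Integrable fun u => g u ^ 2) (u : ℝ) :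
    Tendsto (fun M : ℝ => halfDer (fun x => truncS M x * g x) u) atTop (𝓝 (halfDer g u)) := by
  refine Tendsto.const_mul _ (Tendsto.sub ?_
    (tendsto_tailConv_truncS isTailKernel_deriv_farKer hg hi u))
  refine tendsto_const_nhds.congr' ?_
  filter_upwards [eventually_gt_atTop (|u| + 2)] with M hM
  exact (nearHalf_truncS hM).symm

lemma exists_halfDer_truncS_bound (hg : ContDiff ℝ ∞ g) (hi : Integrable fun u => g u ^ 2) (K : ℝ) :
    ∃ C, ∀ᶠ M : ℝ in atTop, ∀ u, |u| ≤ K → |halfDer (fun x => truncS M x * g x) u| ≤ C := by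
  obtain ⟨A, hA⟩ := (isCompact_closedBall (0 : ℝ) K).exists_bound_of_continuousOn
    (contDiff_nearHalf hg).continuous.continuousOn
  obtain ⟨B, hB0, hB⟩ := isTailKernel_deriv_farKer.exists_tailConv_bound
  refine ⟨2 / π * (A + B * ((∫ w, g w ^ 2) + π)), ?_⟩
  filter_upwards [eventually_gt_atTop (K + 2)] with M hM u hu
  rw [halfDer, nearHalf_truncS (by linarith), abs_mul, abs_neg, abs_of_pos (by positivity)]
  gcongr
  refine (abs_sub _ _).trans (add_le_add (hA u (by simpa using hu)) ?_)
  refine (hB _ (contDiff_truncS_mul hg M).continuous (integrable_truncS_mul hg hi M) u).trans ?_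
  gcongr _ * (?_ + _)
  exact integral_mono (integrable_truncS_mul hg hi M) hi (truncS_mul_sq_le g M)

lemma abs_profile_arg_le (p : ℝ × ℝ) (θ : ℝ) : |p.1 - p.2 * Real.cos θ| ≤ |p.1| + |p.2| := by
  refine (abs_sub _ _).trans (add_le_add le_rfl ?_)
  rw [abs_mul]
  exact mul_le_of_le_one_right (abs_nonneg _) (Real.abs_cos_le_one θ)

lemma tendsto_planeWave_truncS (hg : ContDiff ℝ ∞ g) (hi : Integrable fun u => g u ^ 2)
    {k : ℝ → ℝ} (hk : Continuous k) (p : ℝ × ℝ) :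
    Tendsto (fun M : ℝ => planeWave k (halfDer fun x => truncS M x * g x) p) atTop
      (𝓝 (planeWave k (halfDer g) p)) := by
  obtain ⟨C, hC⟩ := exists_halfDer_truncS_bound hg hi (|p.1| + |p.2|)
  refine intervalIntegral.tendsto_integral_filter_of_dominated_convergence (fun θ => C * |k θ|)
    (Eventually.of_forall fun M => ?_) ?_ (Continuous.intervalIntegrable (by fun_prop) _ _)
    (ae_of_all _ fun θ _ => (tendsto_halfDer_truncS hg hi _).mul_const _)
  · exact (continuous_planeWave_integrand (contDiff_halfDer (contDiff_truncS_mul hg M)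
      (integrable_truncS_mul hg hi M)).continuous hk p).aestronglyMeasurable
  · filter_upwards [hC] with M hM
    refine ae_of_all _ fun θ _ => ?_
    rw [norm_mul, Real.norm_eq_abs, Real.norm_eq_abs]
    gcongr
    exact hM _ (abs_profile_arg_le p θ)

lemma exists_planeWave_truncS_bound (hg : ContDiff ℝ ∞ g) (hi : Integrable fun u => g u ^ 2)
    {k : ℝ → ℝ} (hk : ∀ θ, |k θ| ≤ 1) (t R : ℝ) :
    ∃ C, ∀ᶠ M : ℝ in atTop, ∀ r, |r| ≤ R →
      planeWave k (halfDer fun x => truncS M x * g x) (t, r) ^ 2 ≤ C := by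
  obtain ⟨C, hC⟩ := exists_halfDer_truncS_bound hg hi (|t| + R)
  refine ⟨(C * π) ^ 2, ?_⟩
  filter_upwards [hC] with M hM r hr
  rw [← sq_abs]
  have h1 := intervalIntegral.norm_integral_le_of_norm_le_const (a := 0) (b := π) (C := C)
    (f := fun θ => halfDer (fun x => truncS M x * g x) (t - r * Real.cos θ) * k θ) fun θ _ => by
      rw [norm_mul, Real.norm_eq_abs, Real.norm_eq_abs]
      have h2 := hM (t - r * Real.cos θ) ((abs_profile_arg_le (t, r) θ).trans (by simpa using hr))
      exact (mul_le_of_le_one_right (abs_nonneg _) (hk θ)).trans h2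
  rw [sub_zero, abs_of_pos Real.pi_pos] at h1
  exact pow_le_pow_left₀ (abs_nonneg _) h1 2

lemma integral_enD_radWave_le (hg : ContDiff ℝ ∞ g) (hi : Integrable fun u => g u ^ 2) (t : ℝ)
    {R : ℝ} (hR : 0 < R) :
    ∫ r in (0 : ℝ)..R, enD (fun x => x ^ 2) (radWave g) (t, r) ≤ 2 * ∫ u, g u ^ 2 := by
  have hgM := contDiff_truncS_mul hg
  have hiM := integrable_truncS_mul hg hi
  have hkT : ∀ θ, |(eT.1 - eT.2 * Real.cos θ) * Real.cos θ| ≤ 1 := fun θ => by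
    simpa [eT] using Real.abs_cos_le_one θ
  have hkR : ∀ θ, |(eR.1 - eR.2 * Real.cos θ) * Real.cos θ| ≤ 1 := fun θ => by
    simpa [eR, abs_mul_abs_self, ← pow_two] using Real.cos_sq_le_one θ
  have hkS : ∀ θ, |Real.sin θ * Real.sin θ| ≤ 1 := fun θ => by
    simpa [abs_mul_abs_self, ← pow_two] using Real.sin_sq_le_one θ
  obtain ⟨CT, hCT⟩ := exists_planeWave_truncS_bound hg hi hkT t R
  obtain ⟨CR, hCR⟩ := exists_planeWave_truncS_bound hg hi hkR t R
  obtain ⟨CS, hCS⟩ := exists_planeWave_truncS_bound hg hi hkS t R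
  have hlim : Tendsto (fun M : ℝ => ∫ r in (0 : ℝ)..R,
      enD (fun x => x ^ 2) (radWave fun x => truncS M x * g x) (t, r)) atTop
      (𝓝 (∫ r in (0 : ℝ)..R, enD (fun x => x ^ 2) (radWave g) (t, r))) := by
    refine intervalIntegral.tendsto_integral_filter_of_dominated_convergence
      (fun _ => (CT + CR + CS) * R) (Eventually.of_forall fun M => ?_) ?_ (by simp)
      (ae_of_all _ fun r _ => ?_)
    · exact ((continuous_enD_radWave (hgM M) (hiM M)).comp
        (Continuous.prodMk_right t)).aestronglyMeasurable
    · filter_upwards [hCT, hCR, hCS] with M h1 h2 h3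
      refine ae_of_all _ fun r hr => ?_
      rw [uIoc_of_le hR.le] at hr
      have hr' : |r| ≤ R := by rw [abs_of_pos hr.1]; exact hr.2
      rw [Real.norm_of_nonneg (enD_nonneg (fun x => sq_nonneg x) hr.1.le),
        enD_radWave (hgM M) (hiM M), dd_radWave (hgM M) (hiM M), dd_radWave (hgM M) (hiM M)]
      have h1 := h1 r hr'
      have h2 := h2 r hr'
      have h3 := h3 r hr'
      exact mul_le_mul (by linarith) hr.2 hr.1.le (by nlinarith [sq_nonneg (planeWave
        (fun θ => Real.sin θ * Real.sin θ) (halfDer fun x => truncS M x * g x) (t, r))])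
    · simp only [fun M => enD_radWave (hgM M) (hiM M), enD_radWave hg hi,
        fun M => dd_radWave (hgM M) (hiM M), dd_radWave hg hi]
      refine Tendsto.mul_const _ (((Tendsto.pow ?_ 2).add (Tendsto.pow ?_ 2)).add
        (Tendsto.pow ?_ 2)) <;> exact tendsto_planeWave_truncS hg hi (by fun_prop) _
  refine le_of_tendsto hlim (Eventually.of_forall fun M => ?_)
  refine (integral_enD_radWave_le_of_eq_zero (hgM M) (hiM M) (truncS_mul_eq_zero g M) t hR).trans ?_
  refine mul_le_mul_of_nonneg_left ?_ two_pos.le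
  exact integral_mono (hiM M) hi (truncS_mul_sq_le g M)

/-- The energy of `radWave g` is at most `2‖g‖²`. -/
lemma integrableOn_enD_radWave (hg : ContDiff ℝ ∞ g) (hi : Integrable fun u => g u ^ 2) (t : ℝ) :
    IntegrableOn (fun r => enD (fun x => x ^ 2) (radWave g) (t, r)) (Ioi 0) ∧
      ∫ r in Ioi 0, enD (fun x => x ^ 2) (radWave g) (t, r) ≤ 2 * ∫ u, g u ^ 2 := by
  have hc : Continuous fun r => enD (fun x => x ^ 2) (radWave g) (t, r) :=
    (continuous_enD_radWave hg hi).comp (Continuous.prodMk_right t)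
  have h1 : IntegrableOn (fun r => enD (fun x => x ^ 2) (radWave g) (t, r)) (Ioi 0) := by
    refine integrableOn_Ioi_of_intervalIntegral_norm_bounded (2 * ∫ u, g u ^ 2) 0
      (fun R : ℝ => (hc.integrableOn_Icc).mono_set Ioc_subset_Icc_self) tendsto_id ?_
    filter_upwards [eventually_gt_atTop 0] with R hR
    refine le_trans (le_of_eq ?_) (integral_enD_radWave_le hg hi t hR)
    refine intervalIntegral.integral_congr fun r hr => ?_
    rw [id, uIcc_of_le (le_of_lt hR)] at hr
    exact Real.norm_of_nonneg (enD_nonneg (fun x => sq_nonneg x) hr.1)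
  refine ⟨h1, le_of_tendsto (intervalIntegral_tendsto_integral_Ioi 0 h1 tendsto_id) ?_⟩
  filter_upwards [eventually_gt_atTop 0] with R hR
  exact integral_enD_radWave_le hg hi t hR

end RadWaveEnergy

/-! ### Extraction of the radiation -/

section RadWaveSub

variable {g₁ g₂ : ℝ → ℝ}

lemma integrable_sq_sub (h₁ : ContDiff ℝ ∞ g₁) (hi₁ : Integrable fun u => g₁ u ^ 2)
    (h₂ : ContDiff ℝ ∞ g₂) (hi₂ : Integrable fun u => g₂ u ^ 2) :
    Integrable fun u => (g₁ u - g₂ u) ^ 2 := by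
  refine ((hi₁.add hi₂).const_mul 2).mono'
    ((h₁.continuous.sub h₂.continuous).pow 2).aestronglyMeasurable (ae_of_all _ fun u => ?_)
  rw [Real.norm_of_nonneg (sq_nonneg _)]
  simp only [Pi.add_apply]
  linarith [sq_nonneg (g₁ u + g₂ u)]

lemma halfDer_sub (h₁ : ContDiff ℝ ∞ g₁) (hi₁ : Integrable fun u => g₁ u ^ 2)
    (h₂ : ContDiff ℝ ∞ g₂) (hi₂ : Integrable fun u => g₂ u ^ 2) (u : ℝ) :
    halfDer (fun x => g₁ x - g₂ x) u = halfDer g₁ u - halfDer g₂ u := by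
  have hS := contDiff_cutS.continuous
  have c₁ : Continuous (deriv g₁) := (contDiff_infty_iff_deriv.1 h₁).2.continuous
  have c₂ : Continuous (deriv g₂) := (contDiff_infty_iff_deriv.1 h₂).2.continuous
  have e1 : nearHalf (fun x => g₁ x - g₂ x) u = nearHalf g₁ u - nearHalf g₂ u := by
    rw [nearHalf, nearHalf, nearHalf, ← intervalIntegral.integral_sub
      (Continuous.intervalIntegrable (by fun_prop) _ _)
      (Continuous.intervalIntegrable (by fun_prop) _ _)]
    refine intervalIntegral.integral_congr fun y _ => ?_
    rw [deriv_fun_sub (h₁.differentiable (by simp) _) (h₂.differentiable (by simp) _), sub_mul]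
  have e2 : tailConv (deriv farKer) (fun x => g₁ x - g₂ x) u =
      tailConv (deriv farKer) g₁ u - tailConv (deriv farKer) g₂ u := by
    rw [tailConv, tailConv, tailConv,
      ← integral_sub (isTailKernel_deriv_farKer.integrable h₁.continuous hi₁ u)
        (isTailKernel_deriv_farKer.integrable h₂.continuous hi₂ u)]
    simp only [sub_mul]
  rw [halfDer, halfDer, halfDer, e1, e2]
  ring

lemma radWave_sub (h₁ : ContDiff ℝ ∞ g₁) (hi₁ : Integrable fun u => g₁ u ^ 2)
    (h₂ : ContDiff ℝ ∞ g₂) (hi₂ : Integrable fun u => g₂ u ^ 2) (p : ℝ × ℝ) :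
    radWave (fun x => g₁ x - g₂ x) p = radWave g₁ p - radWave g₂ p := by
  have c₁ := (contDiff_halfDer h₁ hi₁).continuous
  have c₂ := (contDiff_halfDer h₂ hi₂).continuous
  rw [radWave_eq (h₁.sub h₂) (integrable_sq_sub h₁ hi₁ h₂ hi₂), radWave_eq h₁ hi₁,
    radWave_eq h₂ hi₂, planeWave, planeWave, planeWave]
  simp only [halfDer_sub h₁ hi₁ h₂ hi₂, sub_mul]
  rw [intervalIntegral.integral_sub (Continuous.intervalIntegrable (by fun_prop) _ _)
      (Continuous.intervalIntegrable (by fun_prop) _ _)]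
  ring

end RadWaveSub

lemma enD_sub_le {f h : ℝ × ℝ → ℝ} {p : ℝ × ℝ} (hf : DifferentiableAt ℝ f p)
    (hh : DifferentiableAt ℝ h p) (hp : 0 ≤ p.2) :
    enD (fun x => x ^ 2) (fun q => f q - h q) p ≤
      2 * enD (fun x => x ^ 2) f p + 2 * enD (fun x => x ^ 2) h p := by
  simp only [enD]
  rw [dd_sub hf hh, dd_sub hf hh]
  have h3 : (f p - h p) ^ 2 / p.2 ^ 2 ≤ 2 * (f p ^ 2 / p.2 ^ 2) + 2 * (h p ^ 2 / p.2 ^ 2) := by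
    rw [← mul_div_assoc, ← mul_div_assoc, ← add_div]
    gcongr
    linarith [sq_nonneg (f p + h p)]
  have h1 := sq_nonneg (dd eT f p + dd eT h p)
  have h2 := sq_nonneg (dd eR f p + dd eR h p)
  nlinarith

section Extraction

variable {w : ℝ × ℝ → ℝ} {E : ℝ} {g γ : ℝ → ℝ} {b : ℝ}

lemma IsDegreeOne.differentiableAt (h : IsDegreeOne w E) {t r : ℝ} (ht : 0 < t) (hr : 0 < r) :
    DifferentiableAt ℝ w (t, r) :=
  h.isWave.smooth.differentiableAt_of_isOpen h.isWave.isOpen (p := (t, r)) ⟨ht, hr⟩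

lemma continuousOn_enD_sub (h : IsDegreeOne w E) (hγ : ContDiff ℝ ∞ γ)
    (hi : Integrable fun u => γ u ^ 2) :
    ContinuousOn (enD (fun x => x ^ 2) fun q => w q - radWave γ q) quadrant :=
  (contDiffOn_enD h.isWave.isOpen h.isWave.pos (contDiff_id.pow 2)
    (h.isWave.smooth.sub (contDiff_radWave hγ hi).contDiffOn)).continuousOn

/-- Inside windows along the light cone, a wave map is close to a linear wave with the same
radiation field. -/
lemma IsDegreeOne.tendsto_window_sub (h : IsDegreeOne w E)
    (hg : ContDiff ℝ ∞ g) (hrad : RadLim (fun p => √p.2 * dd eN w p) g)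
    (hγ : ContDiff ℝ ∞ γ) (hi : Integrable fun u => γ u ^ 2) (hb : ∀ x ≥ b, γ x = 0)
    {M : ℝ} (hM : 0 ≤ M) (hgγ : ∀ x, |x| ≤ M → γ x = g x) :
    Tendsto (fun t => ∫ r in (t - M)..(t - -M), enD (fun x => x ^ 2)
      (fun q => w q - radWave γ q) (t, r)) atTop (𝓝 0) := by
  have hW := h.isWave
  have hV := isWave_radWave hγ hi
  have hMM : -M ≤ M := by linarith
  obtain ⟨P, hP⟩ := hW.exists_potential
  obtain ⟨P', hP'⟩ := hV.exists_potential
  have hradγ := radLim_radWave hγ hi hb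
  have hsγ := stripBdd_radWave hγ hi hb
  have cdw : ∀ v, ContinuousOn (dd v w) quadrant := fun v => (hW.smooth.dd hW.isOpen v).continuousOn
  have cdφ : ∀ v, ContinuousOn (dd v (radWave γ)) quadrant := fun v =>
    (continuous_dd_radWave hγ hi v).continuousOn
  have cw : ContinuousOn w quadrant := hW.smooth.continuousOn
  have cφ : ContinuousOn (radWave γ) quadrant := (contDiff_radWave hγ hi).continuous.continuousOn
  have csq : ContinuousOn (fun p : ℝ × ℝ => √p.2) quadrant := by fun_prop
  have cden : ContinuousOn (fun p : ℝ × ℝ => p.2) quadrant := by fun_prop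
  have cF : ContinuousOn (fun p => 2 * (√p.2 * dd eN w p - √p.2 * dd eN (radWave γ) p) ^ 2)
      quadrant := by
    have := cdw eN
    have := cdφ eN
    fun_prop
  have cD : ContinuousOn (fun p => (w p - radWave γ p) ^ 2 / p.2) quadrant :=
    ((cw.sub cφ).pow 2).div cden fun p hp => (hW.pos p hp).ne'
  have bN := (hrad.stripBdd hg.continuous).sub (hradγ.stripBdd hγ.continuous)
  have bD := h.stripBdd.sub hsγ
  have lF := hW.tendsto_window hMM cF ((stripBdd_const 2).mul ((bN.mul bN).of_abs_le
    fun p _ => le_of_eq (by rw [pow_two])))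
    (G := fun u => 2 * (g u - γ u) ^ 2)
    fun u => (((hrad.tendsto u).sub (hradγ.tendsto u)).pow 2).const_mul 2
  have lD := hW.tendsto_window hMM cD (((bD.mul stripBdd_rho).mul (bD.mul stripBdd_rho)).of_abs_le
    fun p hp => le_of_eq (by
      rw [mul_mul_mul_comm, ← pow_two, ← pow_two, rho_sq hp, div_eq_mul_inv]))
    (G := fun _ => 0) fun u => by
      have h1 := (tendsto_nul_of_stripBdd_mul_rho bD u).pow 2
      rw [zero_pow two_ne_zero] at h1
      refine h1.congr' ?_
      filter_upwards [eventually_gt_atTop u] with v hv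
      have hp : 0 < (nul u v).2 := by simp only [nul]; linarith
      rw [mul_pow, rho_sq hp, div_eq_mul_inv]
  have lw := hW.tendsto_window_outgoing h.stripBdd hP hg.continuous hrad hMM
    (h.potential_bdd hP _)
  have lφ := hV.tendsto_window_outgoing hsγ hP' hγ.continuous hradγ hMM
    (hP'.radWave_bdd hγ hi hb _)
  have e0 : ∫ u in (-M)..M, 2 * (g u - γ u) ^ 2 = 0 := by
    refine intervalIntegral.integral_zero_ae (ae_of_all _ fun u hu => ?_)
    rw [uIoc_of_le hMM] at hu
    rw [hgγ u (abs_le.2 ⟨hu.1.le, hu.2⟩)]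
    ring
  rw [e0] at lF
  rw [intervalIntegral.integral_zero] at lD
  have lim := ((lF.add (lw.const_mul 2)).add (lφ.const_mul 2)).add lD
  rw [mul_zero, add_zero, add_zero, add_zero] at lim
  refine tendsto_of_tendsto_of_tendsto_of_le_of_le' tendsto_const_nhds lim ?_ ?_
  · filter_upwards [eventually_gt_atTop M] with t ht
    refine intervalIntegral.integral_nonneg (by linarith) fun r hr => ?_
    exact _root_.enD_nonneg (fun x => sq_nonneg x) (p := (t, r)) (by linarith [hr.1] : (0 : ℝ) ≤ r)
  · filter_upwards [eventually_gt_atTop M] with t ht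
    have hle : t - M ≤ t + M := by linarith
    have hq : ∀ r ∈ Icc (t - M) (t + M), (t, r) ∈ quadrant := fun r hr =>
      ⟨by simp only [mem_Ioi]; linarith, by simp only [mem_Ioi]; linarith [hr.1]⟩
    have ii : ∀ {F : ℝ × ℝ → ℝ}, ContinuousOn F quadrant →
        IntervalIntegrable (fun r => F (t, r)) volume (t - M) (t + M) := fun hF => by
      refine ContinuousOn.intervalIntegrable ?_
      rw [uIcc_of_le hle]
      exact hF.comp (by fun_prop) hq
    have iw : ContinuousOn (fun p : ℝ × ℝ => 2 * p.2 * dd eL w p ^ 2) quadrant := by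
      have := cdw eL
      fun_prop
    have iφ : ContinuousOn (fun p : ℝ × ℝ => 2 * p.2 * dd eL (radWave γ) p ^ 2) quadrant := by
      have := cdφ eL
      fun_prop
    have i1 := ii cF
    have i2 := (ii iw).const_mul 2
    have i3 := (ii iφ).const_mul 2
    have i4 := ii cD
    rw [sub_neg_eq_add]
    refine (intervalIntegral.integral_mono_on hle (ii (continuousOn_enD_sub h hγ hi))
      (((i1.add i2).add i3).add i4) fun r hr => ?_).trans_eq ?_
    swap
    · rw [intervalIntegral.integral_add ((i1.add i2).add i3) i4,
        intervalIntegral.integral_add (i1.add i2) i3, intervalIntegral.integral_add i1 i2]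
      simp only [intervalIntegral.integral_const_mul]
    obtain ⟨h1, h2⟩ := hq r hr
    have h2 : 0 < r := h2
    have hdw := h.differentiableAt h1 h2
    have hdφ : DifferentiableAt ℝ (radWave γ) (t, r) :=
      (contDiff_radWave hγ hi).differentiable (by simp) _
    rw [enD_eq_null h2, dd_sub hdw hdφ, dd_sub hdw hdφ]
    have e1 : √r ^ 2 = r := Real.sq_sqrt h2.le
    have e2 : 2 * (√r * dd eN w (t, r) - √r * dd eN (radWave γ) (t, r)) ^ 2 =
        2 * r * (dd eN w (t, r) - dd eN (radWave γ) (t, r)) ^ 2 := by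
      rw [← mul_sub, mul_pow, e1]; ring
    simp only
    rw [e2]
    nlinarith [mul_nonneg h2.le (sq_nonneg (dd eL w (t, r) + dd eL (radWave γ) (t, r)))]

/-- Far outside the light cone, the wave map energy controls the linear energy. -/
lemma IsDegreeOne.exterior_sq_le (h : IsDegreeOne w E) {M t : ℝ} (hM : 0 ≤ M) (ht : 1 ≤ t)
    (hS : ∫ r in Ioi (1 + M), enD sinSq w (1, r) < 2) :
    IntegrableOn (fun r => enD (fun x => x ^ 2) w (t, r)) (Ioi (t + M)) ∧
    ∫ r in Ioi (t + M), enD (fun x => x ^ 2) w (t, r) ≤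
      π ^ 2 / 4 * ∫ r in Ioi (1 + M), enD sinSq w (1, r) := by
  have ht0 : 0 < t := by linarith
  have hsub : Ioi (t + M) ⊆ Ioi 0 := Ioi_subset_Ioi (by linarith)
  have hext := h.exterior_le one_pos ht (R := M) (by linarith)
  have hi : IntegrableOn (fun r => π ^ 2 / 4 * enD sinSq w (t, r)) (Ioi (t + M)) :=
    ((h.integrableOn t ht0).mono_set hsub).const_mul _
  have hpt : ∀ r ∈ Ioi (t + M), enD (fun x => x ^ 2) w (t, r) ≤ π ^ 2 / 4 * enD sinSq w (t, r) :=
      fun r hr => by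
    have hr0 : 0 < r := hsub hr
    have h1 := h.sq_le ht0 hr0 ((h.setIntegral_mono ht0 (Ioi_subset_Ioi (le_of_lt hr)) hsub
      measurableSet_Ioi).trans_lt (hext.trans_lt hS))
    have h2 : 1 ≤ π ^ 2 / 4 := by nlinarith [Real.two_le_pi]
    have h3 : w (t, r) ^ 2 / r ^ 2 ≤ π ^ 2 / 4 * (sinSq (w (t, r)) / r ^ 2) := by
      rw [← mul_div_assoc]
      gcongr
    rw [enD, enD, ← mul_assoc]
    refine mul_le_mul_of_nonneg_right ?_ hr0.le
    nlinarith [sq_nonneg (dd eT w (t, r)), sq_nonneg (dd eR w (t, r))]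
  have hn : ∀ r ∈ Ioi (t + M), 0 ≤ enD (fun x => x ^ 2) w (t, r) := fun r hr =>
    _root_.enD_nonneg (fun x => sq_nonneg x) (p := (t, r)) (le_of_lt (hsub hr))
  have hc : ContinuousOn (fun r => enD (fun x => x ^ 2) w (t, r)) (Ioi (t + M)) :=
    (contDiffOn_enD h.isWave.isOpen h.isWave.pos (contDiff_id.pow 2)
      h.isWave.smooth).continuousOn.comp (by fun_prop) fun r hr => ⟨ht0, hsub hr⟩
  have hI : IntegrableOn (fun r => enD (fun x => x ^ 2) w (t, r)) (Ioi (t + M)) := by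
    refine Integrable.mono' hi (hc.aestronglyMeasurable measurableSet_Ioi) ?_
    filter_upwards [ae_restrict_mem measurableSet_Ioi] with r hr
    rw [Real.norm_of_nonneg (hn r hr)]
    exact hpt r hr
  refine ⟨hI, (setIntegral_mono_on hI hi measurableSet_Ioi hpt).trans ?_⟩
  rw [integral_const_mul]
  gcongr

/-- The `L²` mass of `g` outside `[-M, M]`. -/
def tailMass (g : ℝ → ℝ) (M : ℝ) : ℝ := (∫ u, g u ^ 2) - ∫ u in (-M)..M, g u ^ 2

lemma tendsto_tailMass (hi : Integrable fun u => g u ^ 2) :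
    Tendsto (tailMass g) atTop (𝓝 0) := by
  have := (intervalIntegral_tendsto_integral hi tendsto_neg_atTop_atBot tendsto_id).const_sub
    (∫ u, g u ^ 2)
  rwa [sub_self] at this

lemma integral_sub_truncS_sq_le (hg : ContDiff ℝ ∞ g) (hi : Integrable fun u => g u ^ 2) {M : ℝ}
    (hM : 0 ≤ M) : ∫ u, (g u - truncS M u * g u) ^ 2 ≤ tailMass g M := by
  have hd := integrable_sq_sub hg hi (contDiff_truncS_mul hg M) (integrable_truncS_mul hg hi M)
  have hMM : -M ≤ M := by linarith
  have h0 : ∫ u in Ioc (-M) M, (g u - truncS M u * g u) ^ 2 = 0 :=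
    setIntegral_eq_zero_of_forall_eq_zero fun u hu => by
      rw [truncS_eq_one (abs_le.2 ⟨hu.1.le, hu.2⟩)]
      ring
  rw [← integral_add_compl measurableSet_Ioc hd (s := Ioc (-M) M), h0, zero_add, tailMass,
    ← integral_add_compl measurableSet_Ioc hi (s := Ioc (-M) M),
    intervalIntegral.integral_of_le hMM, add_sub_cancel_left]
  refine integral_mono hd.restrict hi.restrict fun u => ?_
  have h1 := truncS_nonneg M u
  have h2 := truncS_le_one M u
  rw [show (g u - truncS M u * g u) ^ 2 = (1 - truncS M u) ^ 2 * g u ^ 2 by ring]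
  exact mul_le_of_le_one_left (sq_nonneg _) (pow_le_one₀ (by linarith) (by linarith))

lemma exterior_radWave_le (hγ : ContDiff ℝ ∞ γ) (hi : Integrable fun u => γ u ^ 2) {M t : ℝ}
    (hM : 0 ≤ M) (ht : M ≤ t) :
    ∫ r in Ioi (t + M), enD (fun x => x ^ 2) (radWave γ) (t, r) ≤ 2 * (∫ u, γ u ^ 2)
      - ∫ r in (t - M)..(t - -M), enD (fun x => x ^ 2) (radWave γ) (t, r) := by
  obtain ⟨h1, h2⟩ := integrableOn_enD_radWave hγ hi t
  have hle : t - M ≤ t + M := by linarith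
  have hsub : Ioi (t - M) ⊆ Ioi 0 := Ioi_subset_Ioi (by linarith)
  rw [sub_neg_eq_add, le_sub_iff_add_le, add_comm, intervalIntegral.integral_of_le hle,
    ← setIntegral_union (Ioc_disjoint_Ioi le_rfl) measurableSet_Ioi
      (h1.mono_set (Ioc_subset_Ioi_self.trans hsub))
      (h1.mono_set (Ioi_subset_Ioi (by linarith))), Ioc_union_Ioi_eq_Ioi hle]
  refine (setIntegral_mono_set h1 ?_ (ae_of_all _ hsub)).trans h2
  filter_upwards [ae_restrict_mem measurableSet_Ioi] with r hr
  exact enD_nonneg (fun x => sq_nonneg x) (p := (t, r)) (le_of_lt hr)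

lemma IsDegreeOne.setIntegral_sub_le (h : IsDegreeOne w E) (hg : ContDiff ℝ ∞ g)
    (hi : Integrable fun u => g u ^ 2) {A M t : ℝ} (hM : 0 ≤ M) (hAM : A < M) (ht : 1 ≤ t)
    (htM : M < t) (hS : ∫ r in Ioi (1 + M), enD sinSq w (1, r) < 2) :
    ∫ r in Ioi 0 ∩ Ici (t - A), enD (fun x => x ^ 2) (fun q => w q - radWave g q) (t, r) ≤
      2 * (∫ r in (t - M)..(t - -M), enD (fun x => x ^ 2)
        (fun q => w q - radWave (fun x => truncS M x * g x) q) (t, r))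
      + π ^ 2 * (∫ r in Ioi (1 + M), enD sinSq w (1, r))
      + 4 * (2 * (∫ u, g u ^ 2) - ∫ r in (t - M)..(t - -M), enD (fun x => x ^ 2)
        (radWave (fun x => truncS M x * g x)) (t, r))
      + 4 * tailMass g M := by
  set γ : ℝ → ℝ := fun x => truncS M x * g x with hγdef
  have hγ : ContDiff ℝ ∞ γ := contDiff_truncS_mul hg M
  have hiγ : Integrable fun u => γ u ^ 2 := integrable_truncS_mul hg hi M
  have ht0 : 0 < t := by linarith
  have hle : t - M ≤ t + M := by linarith
  have hD : ContDiff ℝ ∞ fun x => g x - γ x := hg.sub hγ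
  have hiD : Integrable fun u => (g u - γ u) ^ 2 := integrable_sq_sub hg hi hγ hiγ
  obtain ⟨d1, d2⟩ := integrableOn_enD_radWave hD hiD t
  obtain ⟨w1, w2⟩ := h.exterior_sq_le hM ht hS
  obtain ⟨γ1, -⟩ := integrableOn_enD_radWave hγ hiγ t
  have γ2 := exterior_radWave_le hγ hiγ hM htM.le
  have γ1' := γ1.mono_set (Ioi_subset_Ioi (by linarith : 0 ≤ t + M))
  have hsub : Ioi (t - M) ⊆ Ioi 0 := Ioi_subset_Ioi (by linarith)
  have hdw : ∀ r ∈ Ioi (0 : ℝ), DifferentiableAt ℝ w (t, r) := fun r hr => h.differentiableAt ht0 hr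
  have hdr : ∀ {k : ℝ → ℝ}, ContDiff ℝ ∞ k → Integrable (fun u => k u ^ 2) → ∀ p,
      DifferentiableAt ℝ (radWave k) p := fun hk hik p =>
    (contDiff_radWave hk hik).differentiable (by simp) p
  have hnn : ∀ (f : ℝ × ℝ → ℝ), ∀ r ∈ Ioi (0 : ℝ), 0 ≤ enD (fun x => x ^ 2) f (t, r) :=
    fun f r hr => _root_.enD_nonneg (fun x => sq_nonneg x) (p := (t, r)) (le_of_lt hr)
  have hc : ContinuousOn (fun r => enD (fun x => x ^ 2) (fun q => w q - radWave γ q) (t, r))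
      (Ioi 0) := (continuousOn_enD_sub h hγ hiγ).comp (by fun_prop) fun r hr => ⟨ht0, hr⟩
  -- exterior part
  have e1 : IntegrableOn (fun r => enD (fun x => x ^ 2) (fun q => w q - radWave γ q) (t, r))
      (Ioi (t + M)) := by
    refine Integrable.mono' ((w1.const_mul 2).add (γ1'.const_mul 2))
      ((hc.mono (Ioi_subset_Ioi (by linarith))).aestronglyMeasurable measurableSet_Ioi) ?_
    filter_upwards [ae_restrict_mem measurableSet_Ioi] with r hr
    have hr0 : 0 < r := by linarith [show t + M < r from hr]
    rw [Real.norm_of_nonneg (hnn _ r hr0)]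
    exact enD_sub_le (hdw r hr0) (hdr hγ hiγ _) hr0.le
  have e2 : ∫ r in Ioi (t + M), enD (fun x => x ^ 2) (fun q => w q - radWave γ q) (t, r) ≤
      2 * (∫ r in Ioi (t + M), enD (fun x => x ^ 2) w (t, r))
      + 2 * ∫ r in Ioi (t + M), enD (fun x => x ^ 2) (radWave γ) (t, r) := by
    rw [← integral_const_mul, ← integral_const_mul,
      ← integral_add (w1.const_mul 2) (γ1'.const_mul 2)]
    refine setIntegral_mono_on e1 ((w1.const_mul 2).add (γ1'.const_mul 2)) measurableSet_Ioi
      fun r hr => ?_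
    have hr0 : 0 < r := by linarith [show t + M < r from hr]
    exact enD_sub_le (hdw r hr0) (hdr hγ hiγ _) hr0.le
  have e3 : IntegrableOn (fun r => enD (fun x => x ^ 2) (fun q => w q - radWave γ q) (t, r))
      (Ioc (t - M) (t + M)) :=
    (hc.mono fun r hr => show 0 < r by linarith [hr.1]).integrableOn_Icc.mono_set
      Ioc_subset_Icc_self
  have e4 : IntegrableOn (fun r => enD (fun x => x ^ 2) (fun q => w q - radWave γ q) (t, r))
      (Ioi (t - M)) := by
    rw [← Ioc_union_Ioi_eq_Ioi hle]
    exact e3.union e1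
  have e5 : ∫ r in Ioi (t - M), enD (fun x => x ^ 2) (fun q => w q - radWave γ q) (t, r) =
      (∫ r in (t - M)..(t - -M), enD (fun x => x ^ 2) (fun q => w q - radWave γ q) (t, r))
      + ∫ r in Ioi (t + M), enD (fun x => x ^ 2) (fun q => w q - radWave γ q) (t, r) := by
    rw [sub_neg_eq_add, intervalIntegral.integral_of_le hle,
      ← setIntegral_union (Ioc_disjoint_Ioi le_rfl) measurableSet_Ioi e3 e1,
      Ioc_union_Ioi_eq_Ioi hle]
  -- comparison with the truncated radiation
  have d1' := d1.mono_set hsub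
  have hrhs := (e4.const_mul 2).add (d1'.const_mul 2)
  have hsubM : Ioi 0 ∩ Ici (t - A) ⊆ Ioi (t - M) := fun r hr => by
    have : t - A ≤ r := hr.2
    change t - M < r
    linarith
  have e6 : ∫ r in Ioi 0 ∩ Ici (t - A),
      enD (fun x => x ^ 2) (fun q => w q - radWave g q) (t, r) ≤
      ∫ r in Ioi (t - M), (2 * enD (fun x => x ^ 2) (fun q => w q - radWave γ q) (t, r)
        + 2 * enD (fun x => x ^ 2) (radWave fun x => g x - γ x) (t, r)) := by
    have hms : MeasurableSet (Ioi 0 ∩ Ici (t - A)) := measurableSet_Ioi.inter measurableSet_Ici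
    refine le_trans (integral_mono_of_nonneg ?_ (IntegrableOn.mono_set hrhs hsubM) ?_)
      (setIntegral_mono_set hrhs ?_ (ae_of_all _ hsubM))
    · filter_upwards [ae_restrict_mem hms] with r hr using hnn _ r hr.1
    · filter_upwards [ae_restrict_mem hms] with r hr
      have hfun : (fun q => w q - radWave g q) =
          fun q => (w q - radWave γ q) - radWave (fun x => g x - γ x) q := by
        funext q
        rw [radWave_sub hg hi hγ hiγ]
        ring
      rw [hfun]
      exact enD_sub_le ((hdw r hr.1).sub (hdr hγ hiγ _)) (hdr hD hiD _) (le_of_lt hr.1)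
    · filter_upwards [ae_restrict_mem measurableSet_Ioi] with r hr
      have hr0 := hsub hr
      have h1 := hnn (fun q => w q - radWave γ q) r hr0
      have h2 := hnn (radWave fun x => g x - γ x) r hr0
      exact add_nonneg (mul_nonneg zero_le_two h1) (mul_nonneg zero_le_two h2)
  rw [integral_add (e4.const_mul 2) (d1'.const_mul 2), integral_const_mul, integral_const_mul,
    e5] at e6
  have e7 : ∫ r in Ioi (t - M), enD (fun x => x ^ 2) (radWave fun x => g x - γ x) (t, r) ≤
      2 * tailMass g M := by
    refine (setIntegral_mono_set d1 ?_ (ae_of_all _ hsub)).trans (d2.trans ?_)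
    · filter_upwards [ae_restrict_mem measurableSet_Ioi] with r hr using hnn _ r hr
    · gcongr
      exact integral_sub_truncS_sq_le hg hi hM
  have e8 : ∫ u, γ u ^ 2 ≤ ∫ u, g u ^ 2 := integral_mono hiγ hi (truncS_mul_sq_le g M)
  linarith

/-- A wave map of degree one approaches the linear wave with the same radiation field in the
region `r ≥ t - A`. -/
lemma IsDegreeOne.tendsto_setIntegral_sub (h : IsDegreeOne w E) (hg : ContDiff ℝ ∞ g)
    (hi : Integrable fun u => g u ^ 2) (hrad : RadLim (fun p => √p.2 * dd eN w p) g) (A : ℝ) :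
    Tendsto (fun t => ∫ r in Ioi 0 ∩ Ici (t - A),
      enD (fun x => x ^ 2) (fun q => w q - radWave g q) (t, r)) atTop (𝓝 0) := by
  refine tendsto_order.2 ⟨fun a ha => ?_, fun ε hε => ?_⟩
  · refine Eventually.of_forall fun t => ha.trans_le (setIntegral_nonneg
      (measurableSet_Ioi.inter measurableSet_Ici) fun r hr => ?_)
    exact _root_.enD_nonneg (fun x => sq_nonneg x) (p := (t, r)) (le_of_lt hr.1)
  have hext := h.tendsto_exterior one_pos
  have hM := (hext.const_mul (π ^ 2)).add ((tendsto_tailMass hi).const_mul 12)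
  rw [mul_zero, mul_zero, add_zero] at hM
  obtain ⟨M, ⟨⟨hMε, hS⟩, hAM⟩, hM0⟩ := (((hM.eventually (gt_mem_nhds hε)).and
    (hext.eventually (gt_mem_nhds two_pos))).and (eventually_gt_atTop A)).and
    (eventually_ge_atTop 0) |>.exists
  set γ : ℝ → ℝ := fun x => truncS M x * g x with hγdef
  have hγ : ContDiff ℝ ∞ γ := contDiff_truncS_mul hg M
  have hiγ : Integrable fun u => γ u ^ 2 := integrable_truncS_mul hg hi M
  have hb : ∀ x ≥ M + 1, γ x = 0 := truncS_mul_eq_zero g M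
  have hgγ : ∀ x, |x| ≤ M → γ x = g x := fun x hx => by
    rw [hγdef]
    simp only [truncS_eq_one hx, one_mul]
  have hMM : -M ≤ M := by linarith
  have hV := isWave_radWave hγ hiγ
  obtain ⟨P, hP⟩ := hV.exists_potential
  have l1 := h.tendsto_window_sub hg hrad hγ hiγ hb hM0 hgγ
  have l2 := hV.tendsto_window_energy (stripBdd_radWave hγ hiγ hb) hP hγ.continuous
    (radLim_radWave hγ hiγ hb) hMM (hP.radWave_bdd hγ hiγ hb _)
  have e2 : ∫ u in (-M)..M, γ u ^ 2 = ∫ u in (-M)..M, g u ^ 2 := by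
    refine intervalIntegral.integral_congr fun u hu => ?_
    rw [uIcc_of_le hMM] at hu
    simp only [hgγ u (abs_le.2 hu)]
  rw [e2] at l2
  have l3 := (((l1.const_mul 2).add_const (π ^ 2 * ∫ r in Ioi (1 + M), enD sinSq w (1, r))).add
    ((l2.const_sub (2 * ∫ u, g u ^ 2)).const_mul 4)).add_const (4 * tailMass g M)
  have hlt : 2 * 0 + π ^ 2 * (∫ r in Ioi (1 + M), enD sinSq w (1, r))
      + 4 * (2 * (∫ u, g u ^ 2) - 2 * ∫ u in (-M)..M, g u ^ 2) + 4 * tailMass g M < ε := by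
    rw [tailMass] at hMε ⊢
    linarith
  filter_upwards [l3.eventually (gt_mem_nhds hlt), eventually_ge_atTop 1, eventually_gt_atTop M]
    with t h1 h2 h3
  exact (h.setIntegral_sub_le hg hi hM0 hAM h2 h3 hS).trans_lt h1

end Extraction

/-! ### The main theorem -/

section RadWaveFields

variable {g : ℝ → ℝ}

lemma pT_radWave (hg : ContDiff ℝ ∞ g) (hi : Integrable fun u => g u ^ 2) (t r : ℝ) :
    pT (fun t r => radWave g (t, r)) t r = dd eT (radWave g) (t, r) :=
  (hasDerivAt_time ((contDiff_radWave hg hi).differentiable (by simp) _)).deriv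

lemma pR_radWave (hg : ContDiff ℝ ∞ g) (hi : Integrable fun u => g u ^ 2) (t r : ℝ) :
    pR (fun t r => radWave g (t, r)) t r = dd eR (radWave g) (t, r) :=
  (hasDerivAt_radial ((contDiff_radWave hg hi).differentiable (by simp) _)).deriv

lemma isLinearWave_radWave (hg : ContDiff ℝ ∞ g) (hi : Integrable fun u => g u ^ 2) :
    IsLinearWave fun t r => radWave g (t, r) := by
  refine ⟨(contDiff_radWave hg hi).contDiffOn, fun t r hr => ?_⟩
  have hd (v : ℝ × ℝ) : DifferentiableAt ℝ (dd v (radWave g)) (t, r) :=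
    ((contDiff_radWave hg hi).contDiffOn.dd isOpen_univ v).differentiableAt_of_isOpen isOpen_univ
      (mem_univ _)
  have heq := (isWave_radWave hg hi).eq (t, r) ⟨mem_univ _, hr⟩
  simp only [pT_radWave hg hi, pR_radWave hg hi]
  rw [(hasDerivAt_time (hd eT)).deriv, (hasDerivAt_radial (hd eR)).deriv]
  simp only [mul_div_mul_left _ _ (two_ne_zero (α := ℝ))] at heq
  rw [one_div_mul_eq_div]
  exact heq

lemma hl2Den_radWave (hg : ContDiff ℝ ∞ g) (hi : Integrable fun u => g u ^ 2) (t : ℝ) :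
    hl2Den (fun r => radWave g (t, r)) (pT (fun t r => radWave g (t, r)) t) =
      fun r => enD (fun x => x ^ 2) (radWave g) (t, r) := by
  funext r
  rw [hl2Den, enD, pT_radWave hg hi, ← pR_radWave hg hi, pR]

lemma pairE_radWave_le (hg : ContDiff ℝ ∞ g) (hi : Integrable fun u => g u ^ 2) (t : ℝ) :
    pairE (fun r => radWave g (t, r)) (pT (fun t r => radWave g (t, r)) t) ≤
      2 * ∫ u, g u ^ 2 := by
  obtain ⟨h1, h2⟩ := integrableOn_enD_radWave hg hi t
  refine le_trans (integral_mono_of_nonneg ?_ h1 ?_) h2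
  · filter_upwards [ae_restrict_mem measurableSet_Ioi] with r hr
    have hr0 : 0 < r := hr
    simp only [Pi.zero_apply]
    positivity
  · filter_upwards [ae_restrict_mem measurableSet_Ioi] with r hr
    have hr0 : 0 < r := hr
    rw [← congrFun (hl2Den_radWave hg hi t) r, hl2Den]
    gcongr (_ + ?_ / _) * r
    exact sq_le_sq.2 Real.abs_sin_le_abs

end RadWaveFields

/-- extraction of the radiation term: there is a linear wave `φ_L` matching
`ψ⃗(t) − (π,0)` near the light cone, whose energy along a sequence of times stays below `2E(Q) = 8`. -/
theorem stmt12_radiation_extraction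
    (ψ : ℝ → ℝ → ℝ) (η : ℝ)
    (hwm : IsWaveMap ψ) (hfe : FiniteEnergy ψ) (hcons : EnergyConserved ψ)
    (hbc : DegreeOneBC ψ)
    (hE : totE ψ 0 = 4 + η) (hE3 : totE ψ 0 < 12) :
    ∃ φL : ℝ → ℝ → ℝ, IsLinearWave φL ∧ LinFiniteEnergy φL ∧
      (∀ A : ℝ, 0 ≤ A →
        Filter.Tendsto
          (fun t => hl2Sq (fun r => ψ t r - Real.pi - φL t r)
            (fun r => pT ψ t r - pT φL t r) (Set.Ioi 0 ∩ Set.Ici (t - A)))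
          Filter.atTop (nhds 0)) ∧
      ∃ C : ℝ, C < 8 ∧ ∃ τ : ℕ → ℝ,
        Filter.Tendsto τ Filter.atTop Filter.atTop ∧
        ∀ᶠ n in Filter.atTop, pairE (φL (τ n)) (pT φL (τ n)) ≤ C := by
  have h := isDegreeOne_of_isWaveMap hwm hfe hcons hbc
  obtain ⟨g, hg, hrad⟩ := h.isWave.exists_radiation h.stripBdd
  obtain ⟨hi, hi2⟩ := integrable_sq_of_interval_le hg.continuous
    fun a b hab => h.integral_sq_le hg.continuous hrad hab
  refine ⟨fun t r => radWave g (t, r), isLinearWave_radWave hg hi, fun t => ?_, fun A _ => ?_,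
    totE ψ 0 - 4, by linarith, fun n => n, tendsto_natCast_atTop_atTop,
    Eventually.of_forall fun n => ?_⟩
  · rw [hl2Den_radWave hg hi]
    exact (integrableOn_enD_radWave hg hi t).1
  · refine (h.tendsto_setIntegral_sub hg hi hrad A).congr' ?_
    filter_upwards [eventually_gt_atTop 0] with t ht
    refine setIntegral_congr_fun (measurableSet_Ioi.inter measurableSet_Ici) fun r hr => ?_
    have hr0 : 0 < r := hr.1
    have hdw := h.differentiableAt ht hr0
    have hdφ := (contDiff_radWave hg hi).differentiable (by simp) (t, r)
    simp only [enD, hl2Den]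
    rw [(eDen_eq_enD hwm ht hr0).1, pT_radWave hg hi, dd_sub hdw hdφ, dd_sub hdw hdφ,
      ((hasDerivAt_radial hdw).fun_sub (hasDerivAt_radial hdφ)).deriv]
  · exact (pairE_radWave_le hg hi n).trans hi2
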